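/- arXiv:2306.10393 — 5 statements merged into one kernel-verified Lean document; each statement's English description precedes it below -/
import Mathlib

section
/- Let p be a prime and let (a_k)_{k≥1} be a sequence in ℚ_p such that for some real ρ > 1 one has |a_k|_p · ρ^k → 0 as k → ∞; let f : ℤ_p → ℚ_p be the function f(x) = Σ_{k≥1} a_k x^k. Then the series Σ_{k≥1} a_k B_k converges in ℚ_p, the sequence N ↦ p^{−N} · Σ_{x=0}^{p^N − 1} f(x) converges in ℚ_p, and the two limits are equal: Σ_{k≥1} a_k B_k = lim_{N→∞} p^{−N} Σ_{x=0}^{p^N − 1} f(x). -/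
open Filter

lemma bv_inv_nat (p : ℕ) [Fact p.Prime] (n : ℕ) (hn : n ≠ 0) : ‖((n : ℚ_[p]))⁻¹‖ ≤ n := by
  have hp : p.Prime := Fact.out
  have hn' : (n : ℤ) ≠ 0 := by exact_mod_cast hn
  have h1 : (1 : ℝ) ≤ n * ‖(n : ℚ_[p])‖ := by
    have : ‖(n : ℚ_[p])‖ = (p : ℝ) ^ (-(padicValNat p n : ℤ)) := by
      rw [Padic.norm_eq_zpow_neg_valuation (by exact_mod_cast hn)]
      simp
    rw [this, zpow_neg, zpow_natCast]
    have h2 : p ^ padicValNat p n ≤ n := Nat.le_of_dvd (Nat.pos_of_ne_zero hn) pow_padicValNat_dvd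
    have h3 : (0 : ℝ) < (p : ℝ) ^ padicValNat p n := by
      have : (0 : ℝ) < p := by exact_mod_cast hp.pos
      positivity
    rw [← div_eq_mul_inv, le_div_iff₀ h3, one_mul]
    exact_mod_cast h2
  have h0 : 0 < ‖(n : ℚ_[p])‖ := norm_pos_iff.mpr (by exact_mod_cast hn)
  rw [norm_inv, inv_le_iff_one_le_mul₀ h0]
  exact h1

lemma bv_inv_prime (p : ℕ) [hp : Fact p.Prime] (q : ℕ) (hq : q.Prime) :
    ‖((q : ℚ_[p]))⁻¹‖ ≤ p := by
  by_cases h : q = p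
  · subst h; simp
  · have h1 : ‖(q : ℚ_[p])‖ = 1 := by
      rw [Padic.norm_natCast_eq_one_iff]
      exact (Nat.coprime_primes hp.out hq).2 (Ne.symm h)
    rw [norm_inv, h1, inv_one]
    exact_mod_cast hp.out.one_lt.le

lemma bv_sum_le (p : ℕ) [hp : Fact p.Prime] {ι : Type*} (s : Finset ι) (f : ι → ℚ_[p]) (C : ℝ)
    (hC : 0 ≤ C) (h : ∀ i ∈ s, ‖f i‖ ≤ C) : ‖∑ i ∈ s, f i‖ ≤ C :=
  IsUltrametricDist.norm_sum_le_of_forall_le_of_nonneg hC h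

lemma bv_bern (p : ℕ) [hp : Fact p.Prime] (k : ℕ) : ‖((bernoulli k : ℚ) : ℚ_[p])‖ ≤ p := by
  have h1p : (1 : ℝ) ≤ p := by exact_mod_cast hp.out.one_lt.le
  rcases Nat.even_or_odd' k with ⟨m, rfl | rfl⟩
  · rcases Nat.eq_zero_or_pos m with rfl | hm
    · simpa using h1p
    · obtain ⟨z, hz⟩ := Bernoulli.vonStaudt_clausen m
      have : bernoulli (2 * m) = (z : ℚ) - ∑ q ∈ Finset.range (2 * m + 2) with
          q.Prime ∧ (q - 1) ∣ 2 * m, (1 : ℚ) / q := by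
        rw [eq_sub_iff_add_eq]; exact_mod_cast hz.symm
      rw [this]
      push_cast
      rw [sub_eq_add_neg]
      refine (IsUltrametricDist.norm_add_le_max _ _).trans (max_le ?_ ?_)
      · exact (Padic.norm_int_le_one z).trans h1p
      · rw [norm_neg]
        refine bv_sum_le p _ _ _ (by positivity) fun q hq => ?_
        rw [one_div]
        exact bv_inv_prime p q (Finset.mem_filter.1 hq).2.1
  · rcases Nat.eq_zero_or_pos m with rfl | hm
    · have := bv_inv_prime p 2 Nat.prime_two
      simp only [mul_zero, zero_add, bernoulli_one]
      push_cast
      simpa [neg_div] using this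
    · rw [bernoulli_eq_zero_of_odd (by simp) (by omega)]
      simp

lemma bv_diff (p : ℕ) [hp : Fact p.Prime] (k N : ℕ) :
    ‖((p : ℚ_[p]) ^ N)⁻¹ * ∑ x ∈ Finset.range (p ^ N), (x : ℚ_[p]) ^ k
      - ((bernoulli k : ℚ) : ℚ_[p])‖ ≤ p * (k + 1) * ((p : ℝ)⁻¹) ^ N := by
  have hp0 : (p : ℚ_[p]) ≠ 0 := by exact_mod_cast hp.out.ne_zero
  have h1p : (1 : ℝ) ≤ p := by exact_mod_cast hp.out.one_lt.le
  have hk0 : ((k : ℚ_[p]) + 1) ≠ 0 := by exact_mod_cast Nat.succ_ne_zero k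
  have key : ((p : ℚ_[p]) ^ N)⁻¹ * ∑ x ∈ Finset.range (p ^ N), (x : ℚ_[p]) ^ k
      - ((bernoulli k : ℚ) : ℚ_[p]) = ∑ i ∈ Finset.range k,
        ((bernoulli i : ℚ) : ℚ_[p]) * ((k + 1).choose i : ℕ) * ((k + 1 : ℕ) : ℚ_[p])⁻¹ *
          ((p : ℚ_[p]) ^ N) ^ (k - i) := by
    have h := congrArg (fun q : ℚ => (q : ℚ_[p])) (sum_range_pow (p ^ N) k)
    push_cast at h
    rw [h, Finset.sum_range_succ, mul_add, Finset.mul_sum, add_sub_assoc]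
    have e : ((p : ℚ_[p]) ^ N)⁻¹ * (((bernoulli k : ℚ) : ℚ_[p]) * ((k + 1).choose k : ℕ) *
        ((p : ℚ_[p]) ^ N) ^ (k + 1 - k) / (k + 1)) - ((bernoulli k : ℚ) : ℚ_[p]) = 0 := by
      rw [Nat.choose_succ_self_right, Nat.add_sub_cancel_left]
      push_cast
      field_simp
      ring
    rw [e, add_zero]
    refine Finset.sum_congr rfl fun i hi => ?_
    have hi' := Finset.mem_range.1 hi
    rw [show k + 1 - i = (k - i) + 1 by omega, pow_succ]
    push_cast
    field_simp
  rw [key]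
  refine bv_sum_le p _ _ _ (by positivity) fun i hi => ?_
  have hi' := Finset.mem_range.1 hi
  rw [norm_mul, norm_mul, norm_mul]
  have a1 := bv_bern p i
  have a2 : ‖(((k + 1).choose i : ℕ) : ℚ_[p])‖ ≤ 1 := by
    exact_mod_cast Padic.norm_int_le_one (p := p) ((k + 1).choose i : ℤ)
  have a3 : ‖((k + 1 : ℕ) : ℚ_[p])⁻¹‖ ≤ (k : ℝ) + 1 := by
    exact_mod_cast bv_inv_nat p (k + 1) (Nat.succ_ne_zero k)
  have a4 : ‖((p : ℚ_[p]) ^ N) ^ (k - i)‖ ≤ ((p : ℝ)⁻¹) ^ N := by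
    rw [norm_pow, norm_pow, Padic.norm_p]
    exact pow_le_of_le_one (by positivity) (pow_le_one₀ (by positivity) (inv_le_one_of_one_le₀ h1p))
      (by omega)
  calc _ ≤ (p : ℝ) * 1 * (k + 1) * ((p : ℝ)⁻¹) ^ N := by gcongr
    _ = _ := by ring

theorem bernoulli_functional_eq_volkenborn
    (p : ℕ) [Fact p.Prime] (a : ℕ → ℚ_[p]) (ha0 : a 0 = 0)
    (ρ : ℝ) (hρ : 1 < ρ)
    (hover : Tendsto (fun k : ℕ => ‖a k‖ * ρ ^ k) atTop (nhds 0)) :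
    Summable (fun k : ℕ => a k * ((bernoulli k : ℚ) : ℚ_[p])) ∧
    Tendsto (fun N : ℕ =>
        ((p : ℚ_[p]) ^ N)⁻¹ *
          ∑ x ∈ Finset.range (p ^ N), ∑' k : ℕ, a k * ((x : ℚ_[p])) ^ k)
      atTop (nhds (∑' k : ℕ, a k * ((bernoulli k : ℚ) : ℚ_[p]))) := by
  have hp : p.Prime := Fact.out
  have h1p : (1 : ℝ) < p := by exact_mod_cast hp.one_lt
  obtain ⟨C, hC⟩ := hover.bddAbove_range
  have hC' : ∀ k, ‖a k‖ ≤ C * (ρ⁻¹) ^ k := fun k => by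
    have := hC ⟨k, rfl⟩
    have h3 : 0 < ρ ^ k := by positivity
    rw [inv_pow, ← div_eq_mul_inv, le_div_iff₀ h3]
    exact this
  have hr : ‖ρ⁻¹‖ < 1 := by
    rw [Real.norm_of_nonneg (by positivity)]
    exact inv_lt_one_of_one_lt₀ hρ
  have hs1 : Summable fun k : ℕ => ‖a k‖ * ((k : ℝ) + 1) := by
    have s1 := summable_pow_mul_geometric_of_norm_lt_one 1 hr
    have s0 := summable_pow_mul_geometric_of_norm_lt_one 0 hr
    refine Summable.of_nonneg_of_le (fun k => by positivity) (fun k => ?_)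
      ((s1.add s0).mul_left C)
    calc ‖a k‖ * ((k : ℝ) + 1) ≤ (C * (ρ⁻¹) ^ k) * ((k : ℝ) + 1) := by gcongr; exact hC' k
      _ = _ := by ring
  have hs0 : Summable fun k : ℕ => ‖a k‖ :=
    Summable.of_nonneg_of_le (fun k => norm_nonneg _)
      (fun k => le_mul_of_one_le_right (norm_nonneg _) (by linarith [(Nat.cast_nonneg k : (0:ℝ) ≤ k)])) hs1
  refine ⟨Summable.of_norm_bounded (hs0.mul_right (p : ℝ)) fun k => ?_, ?_⟩
  · rw [norm_mul]
    gcongr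
    exact bv_bern p k
  have hxs : ∀ x : ℕ, Summable fun k : ℕ => a k * (x : ℚ_[p]) ^ k := fun x => by
    refine Summable.of_norm_bounded hs0 fun k => ?_
    rw [norm_mul, norm_pow]
    refine mul_le_of_le_one_right (norm_nonneg _) (pow_le_one₀ (norm_nonneg _) ?_)
    exact_mod_cast Padic.norm_int_le_one (p := p) (x : ℤ)
  have hrw : ∀ N : ℕ, ((p : ℚ_[p]) ^ N)⁻¹ *
      ∑ x ∈ Finset.range (p ^ N), ∑' k : ℕ, a k * ((x : ℚ_[p])) ^ k =
      ∑' k : ℕ, a k * (((p : ℚ_[p]) ^ N)⁻¹ * ∑ x ∈ Finset.range (p ^ N), (x : ℚ_[p]) ^ k) := by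
    intro N
    rw [← Summable.tsum_finsetSum (fun x _ => hxs x), ← tsum_mul_left]
    refine tsum_congr fun k => ?_
    rw [← Finset.mul_sum]
    ring
  simp_rw [hrw]
  have hq0 : Tendsto (fun N : ℕ => ((p : ℝ)⁻¹) ^ N) atTop (nhds 0) :=
    tendsto_pow_atTop_nhds_zero_of_lt_one (by positivity) (inv_lt_one_of_one_lt₀ h1p)
  refine tendsto_tsum_of_dominated_convergence (hs1.mul_right (p : ℝ)) (fun k => ?_)
    (Eventually.of_forall fun N k => ?_)
  · refine Tendsto.const_mul _ ?_
    rw [tendsto_iff_norm_sub_tendsto_zero]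
    refine squeeze_zero (fun _ => norm_nonneg _) (fun N => bv_diff p k N) ?_
    simpa using hq0.const_mul ((p : ℝ) * (k + 1))
  · rw [norm_mul, mul_assoc]
    gcongr
    have hd := bv_diff p k N
    have hb := bv_bern p k
    have hle : ((p : ℝ)⁻¹) ^ N ≤ 1 := pow_le_one₀ (by positivity) (inv_le_one_of_one_le₀ h1p.le)
    rw [← sub_add_cancel (((p : ℚ_[p]) ^ N)⁻¹ * ∑ x ∈ Finset.range (p ^ N), (x : ℚ_[p]) ^ k)
      ((bernoulli k : ℚ) : ℚ_[p])]
    refine (IsUltrametricDist.norm_add_le_max _ _).trans (max_le ?_ ?_)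
    · refine hd.trans ?_
      rw [mul_comm (p : ℝ)]
      exact mul_le_of_le_one_right (by positivity) hle
    · refine hb.trans ?_
      exact le_mul_of_one_le_left (by positivity) (by linarith [(Nat.cast_nonneg k : (0:ℝ) ≤ k)])
end

section
/- Let N be a positive integer. Then lim_{x → +∞} (1/x) · #{ b ∈ ℤ_{≥1} : φ(Nb) ≤ x } = (ζ(2)ζ(3)/ζ(6)) · (1/N) · ∏_{q | N} q²/(q² − q + 1), where the product runs over all prime divisors q of N. -/
open Filter

/-- The value `ζ(s) = ∑_{n≥1} 1/n^s` of the Riemann zeta function at a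
natural number `s`, as a real number. -/
noncomputable def zetaR (s : ℕ) : ℝ := ∑' n : ℕ, 1 / ((n : ℝ) + 1) ^ s

/-- Truncated totient ratio. -/
noncomputable def fS (N : ℕ) (S : Finset ℕ) (b : ℕ) : ℝ :=
  N * ∏ p ∈ S, (if p ∣ N * b then (1 - 1 / (p : ℝ)) else 1)

/-- Truncated counting set. -/
def AS (N : ℕ) (S : Finset ℕ) (x : ℝ) : Set ℕ := {b : ℕ | 1 ≤ b ∧ (b : ℝ) * fS N S b ≤ x}

lemma one_sub_pos_of_prime {p : ℕ} (hp : p.Prime) : 0 < 1 - 1 / (p : ℝ) := by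
  have : (2 : ℝ) ≤ p := by exact_mod_cast hp.two_le
  have h : 1 / (p : ℝ) ≤ 1 / 2 := one_div_le_one_div_of_le (by norm_num) this
  linarith

lemma AS_finite (N : ℕ) (hN : 0 < N) (S : Finset ℕ) (hS : ∀ p ∈ S, p.Prime) (x : ℝ) :
    (AS N S x).Finite := by
  set c : ℝ := N * ∏ p ∈ S, (1 - 1 / (p : ℝ)) with hc
  have hN' : (0 : ℝ) < N := by exact_mod_cast hN
  have hcpos : 0 < c := mul_pos hN' (Finset.prod_pos fun p hp => one_sub_pos_of_prime (hS p hp))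
  refine (Set.finite_Iic (⌈x / c⌉₊)).subset ?_
  rintro b ⟨hb, hbx⟩
  have h1 : c ≤ fS N S b := by
    unfold fS
    rw [hc]
    gcongr with p hp
    · intro p hp
      exact (one_sub_pos_of_prime (hS p hp)).le
    · split_ifs
      · exact le_rfl
      · have : 0 ≤ 1 / (p : ℝ) := by positivity
        linarith
  have h2 : (b : ℝ) * c ≤ x := (mul_le_mul_of_nonneg_left h1 (by positivity)).trans hbx
  have h3 : (b : ℝ) ≤ x / c := by rwa [le_div_iff₀ hcpos]
  have := h3.trans (Nat.le_ceil (x / c))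
  exact_mod_cast this

lemma fS_insert (N : ℕ) (S : Finset ℕ) (p : ℕ) (hp : p ∉ S) (b : ℕ) :
    fS N (insert p S) b = (if p ∣ N * b then (1 - 1 / (p : ℝ)) else 1) * fS N S b := by
  unfold fS
  rw [Finset.prod_insert hp]; ring

lemma fS_mul (N : ℕ) (S : Finset ℕ) (hS : ∀ p ∈ S, p.Prime) (p : ℕ) (hp : p ∉ S)
    (hpp : p.Prime) (b : ℕ) : fS N S (p * b) = fS N S b := by
  unfold fS
  congr 1
  refine Finset.prod_congr rfl fun q hq => ?_
  have hqp : q.Prime := hS q hq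
  have : (q ∣ N * (p * b)) ↔ (q ∣ N * b) := by
    have hne : ¬ q ∣ p := by
      intro h
      rw [Nat.prime_dvd_prime_iff_eq hqp hpp] at h
      exact hp (h ▸ hq)
    rw [hqp.dvd_mul, hqp.dvd_mul, hqp.dvd_mul]
    tauto
  simp only [this]

lemma AS_tendsto (N : ℕ) (hN : 0 < N) (S : Finset ℕ) : (∀ p ∈ S, p.Prime) →
    Tendsto (fun x : ℝ => ((AS N S x).ncard : ℝ) / x) atTop
      (nhds (1 / (N : ℝ) * ∏ p ∈ S, (if p ∣ N then (p : ℝ) / (p - 1)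
        else 1 + 1 / ((p : ℝ) * (p - 1))))) := by
  have hN' : (0 : ℝ) < N := by exact_mod_cast hN
  induction S using Finset.induction_on with
  | empty =>
    intro _
    have h0 : ∀ x : ℝ, (AS N ∅ x).ncard = ⌊(1 / (N : ℝ)) * x⌋₊ := by
      intro x
      have : AS N ∅ x = ((Finset.Icc 1 ⌊(1 / (N : ℝ)) * x⌋₊ : Finset ℕ) : Set ℕ) := by
        ext b
        simp only [AS, fS, Finset.prod_empty, mul_one, Set.mem_ofPred_eq, Finset.coe_Icc,
          Set.mem_Icc]
        refine and_congr_right fun hb => ?_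
        rw [Nat.le_floor_iff' (by omega), one_div, inv_mul_eq_div, le_div_iff₀ hN']
      rw [this, Set.ncard_coe_finset]; simp
    simp only [h0, Finset.prod_empty, mul_one]
    exact tendsto_nat_floor_mul_div_atTop (by positivity)
  | insert p S hpS ih =>
    intro hS
    have hpp : p.Prime := hS p (Finset.mem_insert_self _ _)
    have hS' : ∀ q ∈ S, q.Prime := fun q hq => hS q (Finset.mem_insert_of_mem hq)
    have ih := ih hS'
    set L := 1 / (N : ℝ) * ∏ p ∈ S, (if p ∣ N then (p : ℝ) / (p - 1)
        else 1 + 1 / ((p : ℝ) * (p - 1))) with hL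
    have hp2 : (2 : ℝ) ≤ p := by exact_mod_cast hpp.two_le
    have hp1 : (0 : ℝ) < p - 1 := by linarith
    have hp0 : (0 : ℝ) < p := by linarith
    have scale : ∀ c : ℝ, 0 < c →
        Tendsto (fun x : ℝ => ((AS N S (x * c)).ncard : ℝ) / x) atTop (nhds (L * c)) := by
      intro c hc
      have h1 := (ih.comp (tendsto_id.atTop_mul_const hc)).mul_const c
      refine h1.congr' ?_
      filter_upwards [eventually_gt_atTop 0] with x hx
      simp only [Function.comp, id]
      field_simp
    rw [Finset.prod_insert hpS]
    by_cases hpN : p ∣ N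
    · rw [if_pos hpN]
      have : (1 / (N : ℝ) * ((p : ℝ) / (p - 1) * ∏ p ∈ S, (if p ∣ N then (p : ℝ) / (p - 1)
        else 1 + 1 / ((p : ℝ) * (p - 1))))) = L * (p / (p - 1)) := by rw [hL]; ring
      rw [this]
      refine (scale _ (div_pos hp0 hp1)).congr fun x => ?_
      congr 3
      ext b
      simp only [AS, Set.mem_ofPred_eq, fS_insert N S p hpS, if_pos (hpN.mul_right b)]
      refine and_congr_right fun hb => ?_
      rw [← mul_div_assoc, le_div_iff₀ hp1]
      have : (b : ℝ) * ((1 - 1 / (p : ℝ)) * fS N S b) = (b * fS N S b * (p - 1)) / p := by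
        field_simp
      rw [this, div_le_iff₀ hp0]
    · rw [if_neg hpN]
      have hLL : (1 / (N : ℝ) * ((1 + 1 / ((p : ℝ) * (p - 1))) *
          ∏ p ∈ S, (if p ∣ N then (p : ℝ) / (p - 1)
        else 1 + 1 / ((p : ℝ) * (p - 1))))) = L + L * (1 / (p - 1)) - L * (1 / p) := by
        have : (1 + 1 / ((p : ℝ) * (p - 1))) = 1 + 1 / (p - 1) - 1 / p := by
          field_simp; ring
        rw [this, hL]; ring
      rw [hLL]
      refine ((ih.add (scale _ (one_div_pos.2 hp1))).sub (scale _ (one_div_pos.2 hp0))).congr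
        fun x => ?_
      have hinj : Function.Injective (fun b : ℕ => p * b) :=
        fun a b h => Nat.eq_of_mul_eq_mul_left hpp.pos h
      have hdvd : ∀ b, p ∣ N * b ↔ p ∣ b := fun b => by
        rw [hpp.dvd_mul]; tauto
      have e1 : AS N S x = {b ∈ AS N S x | ¬ p ∣ b} ∪ (fun b => p * b) '' AS N S (x * (1 / p)) := by
        ext b
        simp only [Set.mem_union, Set.mem_ofPred_eq, Set.mem_image]
        have key : ∀ c : ℕ, p * c ∈ AS N S x ↔ c ∈ AS N S (x * (1 / p)) := by
          intro c
          simp only [AS, Set.mem_ofPred_eq, fS_mul N S hS' p hpS hpp]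
          refine and_congr ?_ ?_
          · simp only [Nat.one_le_iff_ne_zero, mul_ne_zero_iff]
            simp [hpp.ne_zero]
          · push_cast
            rw [mul_one_div, le_div_iff₀ hp0]
            ring_nf
        constructor
        · intro h
          by_cases hb : p ∣ b
          · obtain ⟨c, rfl⟩ := hb
            exact Or.inr ⟨c, (key c).1 h, rfl⟩
          · exact Or.inl ⟨h, hb⟩
        · rintro (h | ⟨c, hc, rfl⟩)
          · exact h.1
          · exact (key c).2 hc
      have e2 : AS N (insert p S) x =
          {b ∈ AS N S x | ¬ p ∣ b} ∪ (fun b => p * b) '' AS N S (x * (1 / (p - 1))) := by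
        ext b
        simp only [Set.mem_union, Set.mem_ofPred_eq, Set.mem_image]
        have key : ∀ c : ℕ, p * c ∈ AS N (insert p S) x ↔ c ∈ AS N S (x * (1 / (p - 1))) := by
          intro c
          simp only [AS, Set.mem_ofPred_eq, fS_insert N S p hpS, fS_mul N S hS' p hpS hpp]
          rw [if_pos ((hdvd _).2 (dvd_mul_right p c))]
          refine and_congr ?_ ?_
          · simp only [Nat.one_le_iff_ne_zero, mul_ne_zero_iff]
            simp [hpp.ne_zero]
          · push_cast
            rw [mul_one_div, le_div_iff₀ hp1]
            have : (p : ℝ) * c * ((1 - 1 / (p : ℝ)) * fS N S c) = c * fS N S c * (p - 1) := by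
              field_simp
            rw [this]
        have key2 : ∀ c : ℕ, ¬ p ∣ c → (c ∈ AS N (insert p S) x ↔ c ∈ AS N S x) := by
          intro c hc
          simp only [AS, Set.mem_ofPred_eq, fS_insert N S p hpS]
          rw [if_neg (by rwa [hdvd]), one_mul]
        constructor
        · intro h
          by_cases hb : p ∣ b
          · obtain ⟨c, rfl⟩ := hb
            exact Or.inr ⟨c, (key c).1 h, rfl⟩
          · exact Or.inl ⟨(key2 b hb).1 h, hb⟩
        · rintro (h | ⟨c, hc, rfl⟩)
          · exact (key2 b h.2).2 h.1
          · exact (key c).2 hc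
      have card : ∀ z : ℝ, ({b ∈ AS N S x | ¬ p ∣ b} ∪ (fun b => p * b) '' AS N S z).ncard =
          ({b ∈ AS N S x | ¬ p ∣ b}).ncard + (AS N S z).ncard := by
        intro z
        rw [Set.ncard_union_eq ?_ ((AS_finite N hN S hS' x).subset fun b hb => hb.1)
          ((AS_finite N hN S hS' z).image _), Set.ncard_image_of_injective _ hinj]
        rw [Set.disjoint_left]
        rintro b ⟨_, hb⟩ ⟨c, _, rfl⟩
        exact hb (dvd_mul_right _ _)
      have c1 := congrArg Set.ncard e1
      have c2 := congrArg Set.ncard e2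
      rw [card] at c1 c2
      have c1' : ((AS N S x).ncard : ℝ) = ({b ∈ AS N S x | ¬ p ∣ b}).ncard +
        (AS N S (x * (1 / p))).ncard := by exact_mod_cast c1
      have c2' : ((AS N (insert p S) x).ncard : ℝ) = ({b ∈ AS N S x | ¬ p ∣ b}).ncard +
        (AS N S (x * (1 / (p - 1)))).ncard := by exact_mod_cast c2
      rw [c1', c2']
      ring

lemma totient_real (n : ℕ) : (n.totient : ℝ) = n * ∏ p ∈ n.primeFactors, (1 - 1 / (p : ℝ)) := by
  have h := Nat.totient_eq_mul_prod_factors n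
  have h2 := congrArg (fun q : ℚ => (q : ℝ)) h
  push_cast at h2
  simpa using h2

lemma prod_sqrt_le (b : ℕ) (hb : b ≠ 0) :
    ∏ p ∈ b.primeFactors, (1 + 1 / √(p : ℝ)) ≤ ∑ d ∈ b.divisors, 1 / √(d : ℝ) := by
  rw [Finset.prod_one_add]
  have hinj : Set.InjOn (fun s : Finset ℕ => ∏ p ∈ s, p) (b.primeFactors.powerset : Set (Finset ℕ)) := by
    intro s hs t ht h
    simp only [Finset.coe_powerset, Set.mem_preimage, Set.mem_powerset_iff, Finset.coe_subset] at hs ht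
    have h1 := Nat.primeFactors_prod (s := s) fun p hp => Nat.prime_of_mem_primeFactors (hs hp)
    have h2 := Nat.primeFactors_prod (s := t) fun p hp => Nat.prime_of_mem_primeFactors (ht hp)
    rw [← h1, ← h2]
    simp only at h
    rw [h]
  have e : ∑ t ∈ b.primeFactors.powerset, ∏ i ∈ t, 1 / √(i : ℝ) =
      ∑ d ∈ b.primeFactors.powerset.image (fun s : Finset ℕ => ∏ p ∈ s, p), 1 / √(d : ℝ) := by
    rw [Finset.sum_image hinj]
    refine Finset.sum_congr rfl fun t _ => ?_
    rw [Finset.prod_div_distrib, Finset.prod_const_one]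
    push_cast
    rw [Real.sqrt_prod _ (fun i _ => by positivity)]
  rw [e]
  refine Finset.sum_le_sum_of_subset_of_nonneg ?_ fun d _ _ => by positivity
  intro d hd
  simp only [Finset.mem_image, Finset.mem_powerset] at hd
  obtain ⟨s, hs, rfl⟩ := hd
  rw [Nat.mem_divisors]
  exact ⟨(Finset.prod_dvd_prod_of_subset _ _ _ hs).trans (Nat.prod_primeFactors_dvd b), hb⟩

lemma prime_factor_bound (p : ℕ) (hp : p.Prime) :
    1 ≤ (1 - 1 / (p : ℝ)) ^ 2 * ((if p < 16 then 4 else 1) * (1 + 1 / √(p : ℝ))) := by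
  have hp2 : (2 : ℝ) ≤ p := by exact_mod_cast hp.two_le
  set u := 1 / √(p : ℝ) with hu
  have hu0 : 0 ≤ u := by positivity
  have huu : 1 / (p : ℝ) = u ^ 2 := by
    rw [hu, div_pow, Real.sq_sqrt (by linarith)]; simp
  split_ifs with h
  · have h1 : 1 / (p : ℝ) ≤ 1 / 2 := one_div_le_one_div_of_le (by norm_num) hp2
    have : (1 / 2 : ℝ) ^ 2 ≤ (1 - 1 / (p : ℝ)) ^ 2 := by gcongr; linarith
    nlinarith
  · have h16 : (16 : ℝ) ≤ p := by exact_mod_cast not_lt.1 h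
    have h4 : 4 ≤ √(p : ℝ) := Real.le_sqrt_of_sq_le (by linarith)
    have hu4 : u ≤ 1 / 4 := one_div_le_one_div_of_le (by norm_num) h4
    rw [huu, one_mul]
    have : 0 ≤ u * (1 - 2 * u - 2 * u ^ 2) := mul_nonneg hu0 (by nlinarith)
    have h5 : 0 ≤ u ^ 4 * (1 + u) := by positivity
    nlinarith

lemma totient_sq_bound (b : ℕ) (hb : b ≠ 0) :
    (b : ℝ) ^ 2 ≤ (b.totient : ℝ) ^ 2 * (4 ^ 16 * ∑ d ∈ b.divisors, 1 / √(d : ℝ)) := by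
  have h1 : 1 ≤ ∏ p ∈ b.primeFactors,
      ((1 - 1 / (p : ℝ)) ^ 2 * ((if p < 16 then 4 else 1) * (1 + 1 / √(p : ℝ)))) := by
    calc (1 : ℝ) = ∏ p ∈ b.primeFactors, (1 : ℝ) := by simp
      _ ≤ _ := Finset.prod_le_prod (fun _ _ => by norm_num)
        fun p hp => prime_factor_bound p (Nat.prime_of_mem_primeFactors hp)
  rw [Finset.prod_mul_distrib, Finset.prod_mul_distrib, Finset.prod_pow] at h1
  have h2 : ∏ p ∈ b.primeFactors, (if p < 16 then (4 : ℝ) else 1) ≤ 4 ^ 16 := by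
    rw [← Finset.prod_filter, Finset.prod_const]
    refine pow_le_pow_right₀ (by norm_num) ?_
    calc _ ≤ (Finset.range 16).card := Finset.card_le_card (by
            intro p hp; simp only [Finset.mem_filter] at hp; simpa using hp.2)
      _ = 16 := by simp
  rw [totient_real b, mul_pow, mul_assoc]
  refine le_mul_of_one_le_right (by positivity) (h1.trans ?_)
  gcongr
  exact prod_sqrt_le b hb

lemma le_totient_sq (b : ℕ) (hb : b ≠ 0) : (b : ℝ) ≤ 4 ^ 16 * (b.totient : ℝ) ^ 2 := by
  have h := totient_sq_bound b hb
  have h2 : ∑ d ∈ b.divisors, 1 / √(d : ℝ) ≤ b := by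
    calc _ ≤ ∑ d ∈ b.divisors, (1 : ℝ) := by
          refine Finset.sum_le_sum fun d hd => ?_
          have : (1 : ℝ) ≤ d := by exact_mod_cast Nat.pos_of_mem_divisors hd
          rw [div_le_one (by positivity)]
          exact Real.one_le_sqrt.2 this
      _ = b.divisors.card := by simp
      _ ≤ b := by exact_mod_cast Nat.card_divisors_le_self b
  have hb0 : (0 : ℝ) < b := by exact_mod_cast Nat.pos_of_ne_zero hb
  have h3 : (b : ℝ) ^ 2 ≤ (b.totient : ℝ) ^ 2 * (4 ^ 16 * b) := h.trans (by gcongr)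
  have : (b : ℝ) * b ≤ (4 ^ 16 * (b.totient : ℝ) ^ 2) * b := by nlinarith
  exact le_of_mul_le_mul_right this hb0

lemma tail_sum : ∃ C : ℝ, 0 < C ∧ ∀ (T : Finset ℕ) (X : ℝ), 0 < X → (∀ b ∈ T, X < (b : ℝ)) →
    ∑ b ∈ T, 1 / (b.totient : ℝ) ^ 2 ≤ C / X := by
  have hsum : Summable (fun d : ℕ => 1 / ((d : ℝ) * √(d : ℝ))) := by
    have := Real.summable_one_div_nat_rpow.2 (show (1 : ℝ) < 3 / 2 by norm_num)
    refine this.congr fun d => ?_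
    rcases Nat.eq_zero_or_pos d with rfl | hd
    · simp
    · have : (0 : ℝ) < d := by exact_mod_cast hd
      rw [Real.sqrt_eq_rpow, show (3 / 2 : ℝ) = 1 + 1 / 2 by norm_num, Real.rpow_add this,
        Real.rpow_one]
  set Z := ∑' d : ℕ, 1 / ((d : ℝ) * √(d : ℝ)) with hZ
  have hZ0 : 0 ≤ Z := tsum_nonneg fun d => by positivity
  refine ⟨4 ^ 16 * (2 * Z) + 1, by positivity, fun T X hX hT => ?_⟩
  obtain ⟨M, hM⟩ : ∃ M : ℕ, ∀ b ∈ T, b < M := by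
    refine ⟨T.sup id + 1, fun b hb => Nat.lt_succ_of_le (Finset.le_sup (f := id) hb)⟩
  have hpos : ∀ b ∈ T, 0 < b := fun b hb => by
    have := hX.trans (hT b hb); exact_mod_cast this
  have step1 : ∀ b ∈ T, 1 / (b.totient : ℝ) ^ 2 ≤
      4 ^ 16 * ∑ d ∈ b.divisors, (1 / √(d : ℝ)) * (((b : ℝ) ^ 2)⁻¹) := by
    intro b hb
    have h := totient_sq_bound b (hpos b hb).ne'
    have hb0 : (0 : ℝ) < b := by exact_mod_cast hpos b hb
    have ht0 : (0 : ℝ) < b.totient := by exact_mod_cast Nat.totient_pos.2 (hpos b hb)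
    rw [← Finset.sum_mul, div_le_iff₀ (by positivity)]
    calc (1 : ℝ) = b ^ 2 * ((b : ℝ) ^ 2)⁻¹ := by field_simp
      _ ≤ ((b.totient : ℝ) ^ 2 * (4 ^ 16 * ∑ d ∈ b.divisors, 1 / √(d : ℝ))) * ((b : ℝ) ^ 2)⁻¹ := by
          gcongr
      _ = _ := by ring
  have step2 : ∑ b ∈ T, ∑ d ∈ b.divisors, (1 / √(d : ℝ)) * (((b : ℝ) ^ 2)⁻¹) =
      ∑ d ∈ Finset.Ioo 0 M, ∑ b ∈ T with d ∣ b, (1 / √(d : ℝ)) * (((b : ℝ) ^ 2)⁻¹) := by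
    refine Finset.sum_comm' fun b d => ?_
    simp only [Nat.mem_divisors, Finset.mem_filter, Finset.mem_Ioo]
    constructor
    · rintro ⟨hb, hd, _⟩
      exact ⟨⟨hb, hd⟩, Nat.pos_of_dvd_of_pos hd (hpos b hb),
        (Nat.le_of_dvd (hpos b hb) hd).trans_lt (hM b hb)⟩
    · rintro ⟨⟨hb, hd⟩, _⟩
      exact ⟨hb, hd, (hpos b hb).ne'⟩
  have step3 : ∀ d ∈ Finset.Ioo 0 M, ∑ b ∈ T with d ∣ b, (1 / √(d : ℝ)) * (((b : ℝ) ^ 2)⁻¹) ≤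
      2 / X * (1 / ((d : ℝ) * √(d : ℝ))) := by
    intro d hd
    have hd0' : 0 < d := (Finset.mem_Ioo.1 hd).1
    have hd0 : (0 : ℝ) < d := by exact_mod_cast hd0'
    have hs : √(d : ℝ) > 0 := Real.sqrt_pos.2 hd0
    have h1 : ∑ b ∈ T with d ∣ b, (((b : ℝ) ^ 2)⁻¹) ≤
        ∑ m ∈ Finset.Ioo ⌊X / d⌋₊ M, ((((d * m : ℕ) : ℝ) ^ 2)⁻¹) := by
      rw [← Finset.sum_image (f := fun b : ℕ => (((b : ℝ) ^ 2)⁻¹)) (g := fun m => d * m)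
        (s := Finset.Ioo ⌊X / d⌋₊ M) (fun a _ b _ h => Nat.eq_of_mul_eq_mul_left hd0' h)]
      refine Finset.sum_le_sum_of_subset_of_nonneg ?_ fun _ _ _ => by positivity
      intro b hb
      obtain ⟨hbT, m, rfl⟩ := Finset.mem_filter.1 hb
      refine Finset.mem_image.2 ⟨m, Finset.mem_Ioo.2 ⟨?_, ?_⟩, rfl⟩
      · have := hT _ hbT
        push_cast at this
        rw [Nat.floor_lt (by positivity), div_lt_iff₀ hd0]
        linarith
      · exact (Nat.le_mul_of_pos_left m hd0').trans_lt (hM _ hbT)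
    have h2 : ∑ m ∈ Finset.Ioo ⌊X / d⌋₊ M, ((((d * m : ℕ) : ℝ) ^ 2)⁻¹) ≤
        ((d : ℝ) ^ 2)⁻¹ * (2 * d / X) := by
      have h3 := sum_Ioo_inv_sq_le (α := ℝ) ⌊X / d⌋₊ M
      have h4 : X / d ≤ (⌊X / d⌋₊ : ℝ) + 1 := (Nat.lt_floor_add_one _).le
      calc _ = ((d : ℝ) ^ 2)⁻¹ * ∑ m ∈ Finset.Ioo ⌊X / d⌋₊ M, (((m : ℝ) ^ 2)⁻¹) := by
            rw [Finset.mul_sum]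
            refine Finset.sum_congr rfl fun m _ => ?_
            push_cast; rw [mul_pow, mul_inv]
        _ ≤ ((d : ℝ) ^ 2)⁻¹ * (2 / (X / d)) := by
            gcongr
            exact h3.trans (by gcongr)
        _ = _ := by field_simp
    rw [← Finset.mul_sum]
    calc _ ≤ 1 / √(d : ℝ) * (((d : ℝ) ^ 2)⁻¹ * (2 * d / X)) := by
          gcongr; exact h1.trans h2
      _ = _ := by field_simp
  calc ∑ b ∈ T, 1 / (b.totient : ℝ) ^ 2
      ≤ ∑ b ∈ T, 4 ^ 16 * ∑ d ∈ b.divisors, (1 / √(d : ℝ)) * (((b : ℝ) ^ 2)⁻¹) :=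
        Finset.sum_le_sum step1
    _ = 4 ^ 16 * ∑ d ∈ Finset.Ioo 0 M, ∑ b ∈ T with d ∣ b, (1 / √(d : ℝ)) * (((b : ℝ) ^ 2)⁻¹) := by
        rw [← Finset.mul_sum, step2]
    _ ≤ 4 ^ 16 * ∑ d ∈ Finset.Ioo 0 M, 2 / X * (1 / ((d : ℝ) * √(d : ℝ))) := by
        gcongr with d hd; exact step3 d hd
    _ ≤ 4 ^ 16 * (2 / X * Z) := by
        rw [← Finset.mul_sum]
        gcongr
        exact hsum.sum_le_tsum _ fun d _ => by positivity
    _ = (4 ^ 16 * (2 * Z)) / X := by ring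
    _ ≤ _ := by gcongr; linarith

lemma tail_card (T : Finset ℕ) (X δ : ℝ) (hX : 0 < X) (hδ : 0 < δ) (y : ℕ) (hy : 0 < y)
    (hT : ∀ b ∈ T, 1 ≤ b ∧ (b : ℝ) ≤ X ∧
      δ < ∑ p ∈ b.primeFactors with y ≤ p, 2 / (p : ℝ)) :
    (T.card : ℝ) ≤ 4 * X / (δ * y) := by
  set n := ⌊X⌋₊ with hn
  have hnX : (n : ℝ) ≤ X := Nat.floor_le hX.le
  have hy0 : (0 : ℝ) < y := by exact_mod_cast hy
  have h1 : T.card * δ ≤ ∑ b ∈ Finset.Ioc 0 n, ∑ p ∈ b.primeFactors with y ≤ p, 2 / (p : ℝ) := by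
    calc T.card * δ = ∑ b ∈ T, δ := by simp
      _ ≤ ∑ b ∈ T, ∑ p ∈ b.primeFactors with y ≤ p, 2 / (p : ℝ) :=
          Finset.sum_le_sum fun b hb => (hT b hb).2.2.le
      _ ≤ _ := by
          refine Finset.sum_le_sum_of_subset_of_nonneg ?_ fun b _ _ =>
            Finset.sum_nonneg fun p _ => by positivity
          intro b hb
          obtain ⟨hb1, hb2, _⟩ := hT b hb
          exact Finset.mem_Ioc.2 ⟨hb1, Nat.le_floor hb2⟩
  have h2 : ∑ b ∈ Finset.Ioc 0 n, ∑ p ∈ b.primeFactors with y ≤ p, 2 / (p : ℝ) =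
      ∑ p ∈ (Finset.Ioo (y - 1) (n + 1)) with p.Prime, ∑ b ∈ Finset.Ioc 0 n with p ∣ b, 2 / (p : ℝ) := by
    refine Finset.sum_comm' fun b p => ?_
    simp only [Nat.mem_primeFactors, Finset.mem_filter, Finset.mem_Ioo, Finset.mem_Ioc]
    constructor
    · rintro ⟨⟨hb0, hbn⟩, ⟨hp, hpb, _⟩, hyp⟩
      have := Nat.le_of_dvd hb0 hpb
      exact ⟨⟨⟨hb0, hbn⟩, hpb⟩, ⟨by omega, by omega⟩, hp⟩
    · rintro ⟨⟨⟨hb0, hbn⟩, hpb⟩, ⟨h3, h4⟩, hp⟩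
      exact ⟨⟨hb0, hbn⟩, ⟨hp, hpb, by omega⟩, by omega⟩
  have h3 : ∑ p ∈ (Finset.Ioo (y - 1) (n + 1)) with p.Prime,
      ∑ b ∈ Finset.Ioc 0 n with p ∣ b, 2 / (p : ℝ) ≤
      ∑ p ∈ Finset.Ioo (y - 1) (n + 1), 2 * X * (((p : ℝ) ^ 2)⁻¹) := by
    refine (Finset.sum_le_sum_of_subset_of_nonneg (Finset.filter_subset _ _)
      fun _ _ _ => Finset.sum_nonneg fun _ _ => by positivity).trans ?_
    refine Finset.sum_le_sum fun p hp => ?_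
    have hp0 : 0 < p := by have := (Finset.mem_Ioo.1 hp).1; omega
    have hp0' : (0 : ℝ) < p := by exact_mod_cast hp0
    rw [Finset.sum_const, Nat.Ioc_filter_dvd_card_eq_div, nsmul_eq_mul]
    calc ((n / p : ℕ) : ℝ) * (2 / p) ≤ (X / p) * (2 / p) := by
          gcongr
          exact Nat.cast_div_le.trans (by gcongr)
      _ = _ := by field_simp
  have h4 := sum_Ioo_inv_sq_le (α := ℝ) (y - 1) (n + 1)
  have h5 : ((y - 1 : ℕ) : ℝ) + 1 = y := by
    have : y - 1 + 1 = y := by omega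
    exact_mod_cast this
  rw [h5] at h4
  rw [le_div_iff₀ (by positivity)]
  have h6 : T.card * δ ≤ 2 * X * (2 / y) := by
    rw [h2] at h1
    refine h1.trans (h3.trans ?_)
    rw [← Finset.mul_sum]
    gcongr
  calc (T.card : ℝ) * (δ * y) = (T.card * δ) * y := by ring
    _ ≤ (2 * X * (2 / y)) * y := by gcongr
    _ = 4 * X := by field_simp; ring

lemma zeta_euler (s : ℕ) (hs : 2 ≤ s) :
    Tendsto (fun n : ℕ => ∏ p ∈ n.primesBelow, (1 - ((p : ℝ) ^ s)⁻¹)⁻¹) atTop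
      (nhds (zetaR s)) := by
  let f : ℕ →*₀ ℝ :=
    { toFun := fun n => ((n : ℝ) ^ s)⁻¹
      map_zero' := by simp [show s ≠ 0 by omega]
      map_one' := by simp
      map_mul' := fun a b => by push_cast; rw [mul_pow, mul_inv] }
  have hf : ∀ n : ℕ, f n = ((n : ℝ) ^ s)⁻¹ := fun n => rfl
  have hsum : Summable (fun n : ℕ => ((n : ℝ) ^ s)⁻¹) :=
    Real.summable_nat_pow_inv.2 (by omega)
  have h := EulerProduct.eulerProduct_completely_multiplicative (f := f) (by
    simp only [hf]; exact hsum.norm)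
  simp only [hf] at h
  have e : ∑' n : ℕ, ((n : ℝ) ^ s)⁻¹ = zetaR s := by
    rw [hsum.tsum_eq_zero_add]
    simp [zetaR, show s ≠ 0 by omega]
  rwa [e] at h

lemma zetaR_pos (s : ℕ) (hs : 2 ≤ s) : 0 < zetaR s := by
  have hsum : Summable (fun n : ℕ => 1 / ((n : ℝ) + 1) ^ s) := by
    have := (summable_nat_add_iff 1).2 (Real.summable_one_div_nat_pow.2 (show 1 < s by omega))
    simpa using this
  exact hsum.tsum_pos (fun n => by positivity) 0 (by norm_num)

lemma prod_tendsto :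
    Tendsto (fun n : ℕ => ∏ p ∈ n.primesBelow, (1 + 1 / ((p : ℝ) * (p - 1)))) atTop
      (nhds (zetaR 2 * zetaR 3 / zetaR 6)) := by
  refine (((zeta_euler 2 le_rfl).mul (zeta_euler 3 (by norm_num))).div
    (zeta_euler 6 (by norm_num)) (zetaR_pos 6 (by norm_num)).ne').congr fun n => ?_
  simp only [Pi.div_apply]
  rw [← Finset.prod_mul_distrib, ← Finset.prod_div_distrib]
  refine Finset.prod_congr rfl fun p hp => ?_
  have hp2 : (2 : ℝ) ≤ p := by exact_mod_cast (Nat.mem_primesBelow.1 hp).2.two_le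
  have h2 : (1 : ℝ) - ((p : ℝ) ^ 2)⁻¹ ≠ 0 := by
    have : ((p : ℝ) ^ 2)⁻¹ < 1 := inv_lt_one_of_one_lt₀ (one_lt_pow₀ (by linarith) (by norm_num))
    linarith
  have h3 : (1 : ℝ) - ((p : ℝ) ^ 3)⁻¹ ≠ 0 := by
    have : ((p : ℝ) ^ 3)⁻¹ < 1 := inv_lt_one_of_one_lt₀ (one_lt_pow₀ (by linarith) (by norm_num))
    linarith
  have hp0 : (p : ℝ) ≠ 0 := by linarith
  have hp1 : (p : ℝ) - 1 ≠ 0 := by linarith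
  rw [div_inv_eq_mul, ← mul_inv, inv_mul_eq_div, div_eq_iff (mul_ne_zero h2 h3)]
  field_simp
  ring

lemma const_tendsto (N : ℕ) (hN : 0 < N) :
    Tendsto (fun y : ℕ => 1 / (N : ℝ) * ∏ p ∈ y.primesBelow, (if p ∣ N then (p : ℝ) / (p - 1)
        else 1 + 1 / ((p : ℝ) * (p - 1)))) atTop
      (nhds ((zetaR 2 * zetaR 3 / zetaR 6) * (1 / (N : ℝ)) *
        ∏ q ∈ N.primeFactors, (q : ℝ) ^ 2 / ((q : ℝ) ^ 2 - (q : ℝ) + 1))) := by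
  refine ((prod_tendsto.mul_const (1 / (N : ℝ))).mul_const
    (∏ q ∈ N.primeFactors, (q : ℝ) ^ 2 / ((q : ℝ) ^ 2 - (q : ℝ) + 1))).congr' ?_
  filter_upwards [eventually_gt_atTop N] with y hy
  have e : N.primeFactors = y.primesBelow.filter (fun p => p ∣ N) := by
    ext p
    simp only [Nat.mem_primeFactors, Finset.mem_filter, Nat.mem_primesBelow]
    constructor
    · rintro ⟨hp, hd, _⟩
      exact ⟨⟨(Nat.le_of_dvd hN hd).trans_lt hy, hp⟩, hd⟩
    · rintro ⟨⟨_, hp⟩, hd⟩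
      exact ⟨hp, hd, hN.ne'⟩
  rw [e, Finset.prod_filter, mul_right_comm, ← Finset.prod_mul_distrib, mul_comm]
  congr 1
  refine Finset.prod_congr rfl fun p hp => ?_
  have hp2 : (2 : ℝ) ≤ p := by exact_mod_cast (Nat.mem_primesBelow.1 hp).2.two_le
  have hp0 : (p : ℝ) ≠ 0 := by linarith
  have hp1 : (p : ℝ) - 1 ≠ 0 := by linarith
  have hp3 : (p : ℝ) ^ 2 - p + 1 ≠ 0 := by nlinarith
  split_ifs
  · have e3 : 1 + 1 / ((p : ℝ) * (p - 1)) = ((p : ℝ) ^ 2 - p + 1) / (p * (p - 1)) := by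
      field_simp
    rw [e3, div_mul_div_cancel₀' hp3]
    field_simp
  · rw [mul_one]

lemma totient_ratio (N : ℕ) (hN : 0 < N) (y : ℕ) (hy : N < y) (b : ℕ) (hb : 1 ≤ b) :
    ((N * b).totient : ℝ) = b * fS N y.primesBelow b *
      ∏ p ∈ b.primeFactors with y ≤ p, (1 - 1 / (p : ℝ)) := by
  have hNb : N * b ≠ 0 := mul_ne_zero hN.ne' (by omega)
  rw [totient_real, ← Finset.prod_filter_mul_prod_filter_not (N * b).primeFactors (fun p => p < y)]
  unfold fS
  rw [← Finset.prod_filter]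
  have e1 : (N * b).primeFactors.filter (fun p => p < y) =
      y.primesBelow.filter (fun p => p ∣ N * b) := by
    ext p
    simp only [Nat.mem_primeFactors, Finset.mem_filter, Nat.mem_primesBelow]
    tauto
  have e2 : (N * b).primeFactors.filter (fun p => ¬ p < y) =
      b.primeFactors.filter (fun p => y ≤ p) := by
    ext p
    simp only [Nat.mem_primeFactors, Finset.mem_filter, not_lt]
    constructor
    · rintro ⟨⟨hp, hd, _⟩, hyp⟩
      refine ⟨⟨hp, ?_, by omega⟩, hyp⟩
      rcases hp.dvd_mul.1 hd with h | h
      · have := Nat.le_of_dvd hN h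
        omega
      · exact h
    · rintro ⟨⟨hp, hd, _⟩, hyp⟩
      exact ⟨⟨hp, hd.mul_left N, hNb⟩, hyp⟩
  rw [e1, e2]
  push_cast
  ring

/-- The counting set. -/
def AT (N : ℕ) (x : ℝ) : Set ℕ := {b : ℕ | 1 ≤ b ∧ ((N * b).totient : ℝ) ≤ x}

lemma totient_le_mul (N : ℕ) (hN : 0 < N) (b : ℕ) (hb : 1 ≤ b) :
    (b.totient : ℝ) ≤ ((N * b).totient : ℝ) := by
  have : b.totient ≤ (N * b).totient :=
    Nat.le_of_dvd (Nat.totient_pos.2 (Nat.mul_pos hN hb))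
      (Nat.totient_dvd_of_dvd (dvd_mul_left b N))
  exact_mod_cast this

lemma AT_finite (N : ℕ) (hN : 0 < N) (x : ℝ) : (AT N x).Finite := by
  refine (Set.finite_Iic (⌈4 ^ 16 * x ^ 2⌉₊)).subset ?_
  rintro b ⟨hb, hbx⟩
  have h1 := le_totient_sq b (by omega)
  have h2 := (totient_le_mul N hN b hb).trans hbx
  have h3 : (b : ℝ) ≤ 4 ^ 16 * x ^ 2 := h1.trans (by gcongr)
  have := h3.trans (Nat.le_ceil _)
  exact_mod_cast this

lemma fS_nonneg (N : ℕ) (y : ℕ) (b : ℕ) : 0 ≤ fS N y.primesBelow b := by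
  unfold fS
  refine mul_nonneg (by positivity) (Finset.prod_nonneg fun p hp => ?_)
  split_ifs
  · exact (one_sub_pos_of_prime (Nat.mem_primesBelow.1 hp).2).le
  · norm_num

lemma AS_subset (N : ℕ) (hN : 0 < N) (y : ℕ) (hy : N < y) (x : ℝ) :
    AS N y.primesBelow x ⊆ AT N x := by
  rintro b ⟨hb, hbx⟩
  refine ⟨hb, ?_⟩
  rw [totient_ratio N hN y hy b hb]
  refine le_trans (mul_le_of_le_one_right (mul_nonneg (by positivity) (fS_nonneg N y b)) ?_) hbx
  refine Finset.prod_le_one (fun p hp => ?_) fun p hp => ?_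
  · exact (one_sub_pos_of_prime (Nat.prime_of_mem_primeFactors (Finset.mem_filter.1 hp).1)).le
  · have : 0 ≤ 1 / (p : ℝ) := by positivity
    linarith

lemma exp_le_one_sub (p : ℕ) (hp : p.Prime) : Real.exp (-(2 / (p : ℝ))) ≤ 1 - 1 / (p : ℝ) := by
  have hp2 : (2 : ℝ) ≤ p := by exact_mod_cast hp.two_le
  have h := one_sub_pos_of_prime hp
  rw [Real.exp_neg, inv_le_comm₀ (Real.exp_pos _) h]
  refine le_trans ?_ (Real.add_one_le_exp _)
  rw [inv_le_iff_one_le_mul₀ h]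
  have h1 : 1 / (p : ℝ) ≤ 1 / 2 := one_div_le_one_div_of_le (by norm_num) hp2
  have h0 : 0 ≤ 1 / (p : ℝ) := by positivity
  rw [show 2 / (p : ℝ) = 2 * (1 / p) by ring]
  nlinarith

lemma upper_bound (N : ℕ) (hN : 0 < N) : ∃ C : ℝ, 0 < C ∧ ∀ (y : ℕ), N < y → ∀ δ K x : ℝ,
    0 < δ → 0 < K → 0 < x →
    ((AT N x).ncard : ℝ) ≤ (AS N y.primesBelow (x * Real.exp δ)).ncard +
      4 * (K * x) / (δ * y) + C * x / K := by
  obtain ⟨C, hC, hC'⟩ := tail_sum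
  refine ⟨C, hC, fun y hy δ K x hδ hK hx => ?_⟩
  have hfin := AT_finite N hN x
  set D : Set ℕ := AT N x with hD
  set D1 : Set ℕ := {b ∈ D | (b : ℝ) ≤ K * x ∧
      δ < ∑ p ∈ b.primeFactors with y ≤ p, 2 / (p : ℝ)} with hD1
  set D2 : Set ℕ := {b ∈ D | K * x < (b : ℝ)} with hD2
  have f1 : D1.Finite := hfin.subset fun b hb => hb.1
  have f2 : D2.Finite := hfin.subset fun b hb => hb.1
  have f0 := AS_finite N hN y.primesBelow (fun p hp => (Nat.mem_primesBelow.1 hp).2)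
    (x * Real.exp δ)
  have hsub : D ⊆ (AS N y.primesBelow (x * Real.exp δ) ∪ D1) ∪ D2 := by
    intro b hb
    by_cases h2 : K * x < (b : ℝ)
    · exact Or.inr ⟨hb, h2⟩
    by_cases h1 : δ < ∑ p ∈ b.primeFactors with y ≤ p, 2 / (p : ℝ)
    · exact Or.inl (Or.inr ⟨hb, not_lt.1 h2, h1⟩)
    refine Or.inl (Or.inl ⟨hb.1, ?_⟩)
    have h3 := hb.2
    rw [totient_ratio N hN y hy b hb.1] at h3
    have h4 : Real.exp (-δ) ≤ ∏ p ∈ b.primeFactors with y ≤ p, (1 - 1 / (p : ℝ)) := by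
      calc Real.exp (-δ) ≤ Real.exp (∑ p ∈ b.primeFactors with y ≤ p, -(2 / (p : ℝ))) := by
            rw [Real.exp_le_exp, Finset.sum_neg_distrib]
            linarith
        _ = ∏ p ∈ b.primeFactors with y ≤ p, Real.exp (-(2 / (p : ℝ))) := Real.exp_sum _ _
        _ ≤ _ := Finset.prod_le_prod (fun _ _ => (Real.exp_pos _).le) fun p hp =>
            exp_le_one_sub p (Nat.prime_of_mem_primeFactors (Finset.mem_filter.1 hp).1)
    have h5 : (b : ℝ) * fS N y.primesBelow b * Real.exp (-δ) ≤ x :=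
      (mul_le_mul_of_nonneg_left h4 (mul_nonneg (by positivity) (fS_nonneg N y b))).trans h3
    rwa [Real.exp_neg, ← div_eq_mul_inv, div_le_iff₀ (Real.exp_pos _)] at h5
  have c0 : D.ncard ≤ (AS N y.primesBelow (x * Real.exp δ)).ncard + D1.ncard + D2.ncard := by
    refine (Set.ncard_le_ncard hsub ((f0.union f1).union f2)).trans ?_
    refine (Set.ncard_union_le _ _).trans ?_
    gcongr
    exact Set.ncard_union_le _ _
  have c1 : (D1.ncard : ℝ) ≤ 4 * (K * x) / (δ * y) := by
    rw [Set.ncard_eq_toFinset_card D1 f1]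
    refine tail_card _ (K * x) δ (by positivity) hδ y (by omega) fun b hb => ?_
    rw [Set.Finite.mem_toFinset] at hb
    exact ⟨hb.1.1, hb.2⟩
  have c2 : (D2.ncard : ℝ) ≤ C * x / K := by
    rw [Set.ncard_eq_toFinset_card D2 f2]
    have h := hC' f2.toFinset (K * x) (by positivity) (fun b hb => by
      rw [Set.Finite.mem_toFinset] at hb; exact hb.2)
    have h6 : (f2.toFinset.card : ℝ) ≤ x ^ 2 * ∑ b ∈ f2.toFinset, 1 / (b.totient : ℝ) ^ 2 := by
      rw [Finset.mul_sum]
      calc (f2.toFinset.card : ℝ) = ∑ b ∈ f2.toFinset, (1 : ℝ) := by simp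
        _ ≤ _ := by
          refine Finset.sum_le_sum fun b hb => ?_
          rw [Set.Finite.mem_toFinset] at hb
          have hb1 : 1 ≤ b := hb.1.1
          have ht0 : (0 : ℝ) < b.totient := by exact_mod_cast Nat.totient_pos.2 hb1
          have h7 := (totient_le_mul N hN b hb1).trans hb.1.2
          rw [mul_one_div, one_le_div (by positivity)]
          gcongr
    calc _ ≤ x ^ 2 * (C / (K * x)) := h6.trans (by gcongr)
      _ = C * x / K := by field_simp
  have c0' : (D.ncard : ℝ) ≤ (AS N y.primesBelow (x * Real.exp δ)).ncard + D1.ncard + D2.ncard := by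
    exact_mod_cast c0
  linarith

/-- Lemma 3.2, asymptotics of the inverse totient counting function.
For a positive integer `N`,
`#{b ≥ 1 : φ(Nb) ≤ x} / x → (ζ(2)ζ(3)/ζ(6)) · (1/N) · ∏_{q ∣ N} q²/(q²-q+1)`. -/
theorem inverse_totient_counting
    (N : ℕ) (hN : 0 < N) :
    Tendsto (fun x : ℝ =>
        (Nat.card {b : ℕ | 1 ≤ b ∧ ((N * b).totient : ℝ) ≤ x} : ℝ) / x)
      atTop
      (nhds ((zetaR 2 * zetaR 3 / zetaR 6) * (1 / (N : ℝ)) *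
        ∏ q ∈ N.primeFactors, (q : ℝ) ^ 2 / ((q : ℝ) ^ 2 - (q : ℝ) + 1))) := by
  have hconst := const_tendsto N hN
  set L := (zetaR 2 * zetaR 3 / zetaR 6) * (1 / (N : ℝ)) *
        ∏ q ∈ N.primeFactors, (q : ℝ) ^ 2 / ((q : ℝ) ^ 2 - (q : ℝ) + 1) with hL
  set l : ℕ → ℝ := fun y => 1 / (N : ℝ) * ∏ p ∈ y.primesBelow, (if p ∣ N then (p : ℝ) / (p - 1)
        else 1 + 1 / ((p : ℝ) * (p - 1))) with hl
  have hAS : ∀ y : ℕ, Tendsto (fun x : ℝ => ((AS N y.primesBelow x).ncard : ℝ) / x) atTop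
      (nhds (l y)) := fun y =>
    AS_tendsto N hN y.primesBelow fun p hp => (Nat.mem_primesBelow.1 hp).2
  change Tendsto (fun x : ℝ => ((AT N x).ncard : ℝ) / x) atTop (nhds L)
  obtain ⟨C, hC, hub⟩ := upper_bound N hN
  rw [tendsto_order]
  constructor
  · intro a ha
    obtain ⟨y, hy1, hy2⟩ := ((hconst.eventually_const_lt ha).and (eventually_gt_atTop N)).exists
    filter_upwards [(hAS y).eventually_const_lt hy1, eventually_gt_atTop 0] with x hx hx0
    refine hx.trans_le ?_
    gcongr
    · exact AT_finite N hN x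
    · exact AS_subset N hN y hy2 x
  · intro a ha
    have hy : Tendsto (fun K : ℕ => K ^ 3 + N + 1) atTop atTop := by
      refine tendsto_atTop_mono (fun K => ?_) tendsto_id
      have : K ≤ K ^ 3 := Nat.le_self_pow (by norm_num) K
      simp only [id]; omega
    have hinv : Tendsto (fun K : ℕ => 1 / (K : ℝ)) atTop (nhds 0) :=
      tendsto_one_div_atTop_nhds_zero_nat
    have hu : Tendsto (fun K : ℕ => l (K ^ 3 + N + 1) * Real.exp (1 / (K : ℝ)) +
        (4 + C) * (1 / (K : ℝ))) atTop (nhds (L * Real.exp 0 + (4 + C) * 0)) :=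
      ((hconst.comp hy).mul ((Real.continuous_exp.tendsto 0).comp hinv)).add
        (hinv.const_mul (4 + C))
    rw [Real.exp_zero, mul_one, mul_zero, add_zero] at hu
    obtain ⟨K, hK1, hK2⟩ := ((hu.eventually_lt_const ha).and (eventually_gt_atTop 0)).exists
    have hK0 : (0 : ℝ) < K := by exact_mod_cast hK2
    set y := K ^ 3 + N + 1 with hydef
    set c := Real.exp (1 / (K : ℝ)) with hc
    have hc0 : 0 < c := Real.exp_pos _
    have hlim : Tendsto (fun x : ℝ => ((AS N y.primesBelow (x * c)).ncard : ℝ) / x +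
        (4 + C) * (1 / (K : ℝ))) atTop (nhds (l y * c + (4 + C) * (1 / (K : ℝ)))) := by
      refine Tendsto.add_const _ ?_
      refine (((hAS y).comp (tendsto_id.atTop_mul_const hc0)).mul_const c).congr' ?_
      filter_upwards [eventually_gt_atTop 0] with x hx
      simp only [Function.comp, id]
      field_simp
    filter_upwards [hlim.eventually_lt_const hK1, eventually_gt_atTop 0] with x hx hx0
    refine lt_of_le_of_lt ?_ hx
    have h := hub y (by omega) (1 / K) K x (by positivity) hK0 hx0
    have hyK : (K : ℝ) ^ 3 ≤ y := by
      have : K ^ 3 ≤ y := by omega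
      exact_mod_cast this
    have h2 : 4 * (K * x) / (1 / (K : ℝ) * y) ≤ 4 * x * (1 / K) := by
      calc 4 * (K * x) / (1 / (K : ℝ) * y) ≤ 4 * (K * x) / (1 / (K : ℝ) * K ^ 3) := by gcongr
        _ = _ := by field_simp
    rw [div_le_iff₀ hx0]
    calc ((AT N x).ncard : ℝ) ≤ _ := h
      _ ≤ (AS N y.primesBelow (x * c)).ncard + 4 * x * (1 / K) + C * x / K := by gcongr
      _ = _ := by field_simp; ring
end

section
/- Fix a prime p and set l_p = 1 if p ≥ 5, l_p = 2 if p = 3, l_p = 3 if p = 2. For real B > 0 let Ψ_B = { b ∈ ℤ_{≥1} : φ(p^{l_p} b) ≤ B }. Then |Ψ_B| = (a_p + o(1))·B as B → +∞, i.e. |Ψ_B|/B → a_p, where a_p = (ζ(2)ζ(3)/ζ(6)) · 1/(p^{l_p−2}(p² − p + 1)). -/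
open Filter

/-- The integer `l_p`: `1` if `p ≥ 5`, `2` if `p = 3`, `3` if `p = 2`. -/
def ellp (p : ℕ) : ℕ := if 5 ≤ p then 1 else if p = 3 then 2 else 3

/-- The constant `a_p = (ζ(2)ζ(3)/ζ(6)) · 1/(p^{l_p-2}(p²-p+1))`. -/
noncomputable def ap (p : ℕ) : ℝ :=
  (zetaR 2 * zetaR 3 / zetaR 6) *
    (1 / ((p : ℝ) ^ ((ellp p : ℤ) - 2) * ((p : ℝ) ^ 2 - (p : ℝ) + 1)))


lemma wsum (X : ℝ) (hX : 0 < X) (N : ℕ) :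
    ∑ m ∈ Finset.range N, (X / (X + ((m : ℝ) + 1))) ^ 2 ≤ X - X ^ 2 / (X + N) := by
  induction N with
  | zero =>
    have : X ^ 2 / X = X := by field_simp
    simp [this]
  | succ n ih =>
    rw [Finset.sum_range_succ]
    have hn : (0 : ℝ) ≤ n := Nat.cast_nonneg n
    have h : (X / (X + ((n : ℝ) + 1))) ^ 2 ≤ X ^ 2 / (X + n) - X ^ 2 / (X + ((n : ℝ) + 1)) := by
      rw [div_sub_div _ _ (by positivity) (by positivity), div_pow,
        div_le_div_iff₀ (by positivity) (by positivity)]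
      have h1 : X ^ 2 * (X + ((n : ℝ) + 1)) - (X + n) * X ^ 2 = X ^ 2 := by ring
      rw [h1]
      apply mul_le_mul_of_nonneg_left _ (by positivity)
      nlinarith
    push_cast
    linarith

lemma wsum_dvd (B : ℝ) (hB : 0 < B) (D : ℕ) (hD : 0 < D) (s : Finset ℕ) (hs : ∀ b ∈ s, 1 ≤ b ∧ D ∣ b) :
    ∑ b ∈ s, (B / (B + (b : ℝ))) ^ 2 ≤ B / D := by
  have hD' : (0 : ℝ) < D := by exact_mod_cast hD
  have hsub : s ⊆ (Finset.range (s.sup id)).image (fun m => D * (m + 1)) := by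
    intro b hb
    obtain ⟨h1, m, hm⟩ := hs b hb
    have hle : b ≤ s.sup id := Finset.le_sup (f := id) hb
    rw [Finset.mem_image]
    have hm0 : m ≠ 0 := by rintro rfl; omega
    refine ⟨m - 1, ?_, ?_⟩
    · rw [Finset.mem_range]
      have : m ≤ b := by rw [hm]; exact Nat.le_mul_of_pos_left _ hD
      omega
    · rw [Nat.sub_add_cancel (by omega)]; exact hm.symm
  refine (Finset.sum_le_sum_of_subset_of_nonneg hsub (fun _ _ _ => by positivity)).trans ?_
  rw [Finset.sum_image]
  · have h := wsum (B / D) (by positivity) (s.sup id)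
    have h2 : 0 ≤ (B / D) ^ 2 / (B / D + (s.sup id : ℕ)) := by positivity
    refine le_trans (le_of_eq ?_) (h.trans (by linarith))
    refine Finset.sum_congr rfl fun m _ => ?_
    congr 1
    push_cast
    field_simp
  · intro a _ b _ hab
    simpa [hD.ne'] using hab

/-- Key averaging lemma. -/
lemma avg (B : ℝ) (hB : 0 < B) (c : Finset ℕ → ℝ) (hc : ∀ S, 0 ≤ c S)
    (hsum : Summable fun S : Finset ℕ => c S / ((∏ q ∈ S, q : ℕ) : ℝ)) (s : Finset ℕ)
    (hs : ∀ b ∈ s, 1 ≤ b) :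
    ∑ b ∈ s, (B / (B + (b : ℝ))) ^ 2 * ∑ S ∈ b.primeFactors.powerset, c S
      ≤ B * ∑' S : Finset ℕ, c S / ((∏ q ∈ S, q : ℕ) : ℝ) := by
  classical
  set U : Finset (Finset ℕ) := s.biUnion (fun b => b.primeFactors.powerset) with hU
  have h1 : ∑ b ∈ s, (B / (B + (b : ℝ))) ^ 2 * ∑ S ∈ b.primeFactors.powerset, c S
      = ∑ S ∈ U, c S * ∑ b ∈ s with S ⊆ b.primeFactors, (B / (B + (b : ℝ))) ^ 2 := by
    simp_rw [Finset.mul_sum, Finset.sum_filter]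
    rw [Finset.sum_comm]
    refine Finset.sum_congr rfl fun b hb => ?_
    rw [← Finset.sum_filter]
    refine Finset.sum_congr ?_ fun S _ => by ring
    ext S
    simp only [Finset.mem_powerset, Finset.mem_filter, hU, Finset.mem_biUnion]
    exact ⟨fun h => ⟨⟨b, hb, h⟩, h⟩, fun h => h.2⟩
  rw [h1, ← tsum_mul_left]
  refine le_trans (Finset.sum_le_sum (g := fun S => B * (c S / ((∏ q ∈ S, q : ℕ) : ℝ))) ?_)
    ((hsum.mul_left B).sum_le_tsum U (fun S _ => mul_nonneg hB.le (div_nonneg (hc S) (by positivity))))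
  intro S hS
  rw [hU, Finset.mem_biUnion] at hS
  obtain ⟨b0, _, hb0⟩ := hS
  rw [Finset.mem_powerset] at hb0
  have hpr : ∀ q ∈ S, q.Prime := fun q hq => Nat.prime_of_mem_primeFactors (hb0 hq)
  have := wsum_dvd B hB (∏ q ∈ S, q) (Finset.prod_pos fun q hq => (hpr q hq).pos)
    (s.filter fun b => S ⊆ b.primeFactors) (by
      intro b hb
      rw [Finset.mem_filter] at hb
      exact ⟨hs b hb.1, Finset.prod_primes_dvd b (fun q hq => (hpr q hq).prime)
        fun q hq => Nat.dvd_of_mem_primeFactors (hb.2 hq)⟩)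
  calc _ ≤ c S * (B / ((∏ q ∈ S, q : ℕ) : ℝ)) := mul_le_mul_of_nonneg_left this (hc S)
    _ = _ := by ring

/-- The full multiplicative function. -/
noncomputable def FF (u : ℕ → ℝ) (b : ℕ) : ℝ := ∏ q ∈ b.primeFactors, (1 + u q)

/-- The truncated multiplicative function. -/
noncomputable def FT (u : ℕ → ℝ) (T : Finset ℕ) (b : ℕ) : ℝ := ∏ q ∈ T with q ∣ b, (1 + u q)

lemma summ_aux (u : ℕ → ℝ) (hu : ∀ q, 0 ≤ u q) (hs : Summable fun q : ℕ => u q / q) :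
    Summable fun S : Finset ℕ => (∏ q ∈ S, u q) / ((∏ q ∈ S, q : ℕ) : ℝ) := by
  have h : Summable fun S : Finset ℕ => ∏ q ∈ S, (u q / q) :=
    summable_finsetProd_of_summable_nonneg (fun q => div_nonneg (hu q) (by positivity)) hs
  refine h.congr fun S => ?_
  rw [Finset.prod_div_distrib]; push_cast; rfl

lemma hasProd_aux (u : ℕ → ℝ) (hu : ∀ q, 0 ≤ u q) (hs : Summable fun q : ℕ => u q / q) :
    HasProd (fun q : ℕ => 1 + u q / q)
      (∑' S : Finset ℕ, (∏ q ∈ S, u q) / ((∏ q ∈ S, q : ℕ) : ℝ)) := by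
  apply hasProd_one_add_of_hasSum_prod
  refine Eq.subst (motive := fun f => HasSum f _) (funext fun S => ?_) (summ_aux u hu hs).hasSum
  rw [Finset.prod_div_distrib]; push_cast; rfl

lemma FT_eq (u : ℕ → ℝ) (T : Finset ℕ) (hT : ∀ q ∈ T, q.Prime) (b : ℕ) (hb : 1 ≤ b) :
    FT u T b = ∑ S ∈ b.primeFactors.powerset, if S ⊆ T then ∏ q ∈ S, u q else 0 := by
  classical
  rw [FT, Finset.prod_one_add, ← Finset.sum_filter]
  refine Finset.sum_congr ?_ fun _ _ => rfl
  ext S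
  simp only [Finset.mem_powerset, Finset.mem_filter, Finset.subset_iff, Nat.mem_primeFactors]
  constructor
  · intro h
    exact ⟨fun q hq => ⟨hT q (h hq).1, (h hq).2, by omega⟩, fun q hq => (h hq).1⟩
  · intro h q hq
    exact ⟨h.2 hq, (h.1 hq).2.1⟩

lemma FF_eq (u : ℕ → ℝ) (b : ℕ) : FF u b = ∑ S ∈ b.primeFactors.powerset, ∏ q ∈ S, u q := by
  rw [FF, Finset.prod_one_add]

lemma FF_sub (u : ℕ → ℝ) (T : Finset ℕ) (hT : ∀ q ∈ T, q.Prime) (b : ℕ) (hb : 1 ≤ b) :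
    FF u b - FT u T b = ∑ S ∈ b.primeFactors.powerset, if S ⊆ T then 0 else ∏ q ∈ S, u q := by
  rw [FF_eq, FT_eq u T hT b hb, ← Finset.sum_sub_distrib]
  refine Finset.sum_congr rfl fun S _ => ?_
  split_ifs <;> simp

lemma FT_ge_one (u : ℕ → ℝ) (hu : ∀ q, 0 ≤ u q) (T : Finset ℕ) (b : ℕ) : 1 ≤ FT u T b := by
  unfold FT
  calc (1 : ℝ) = ∏ q ∈ T with q ∣ b, (1 : ℝ) := by simp
    _ ≤ _ := Finset.prod_le_prod (fun _ _ => zero_le_one) fun q _ => by linarith [hu q]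

lemma FT_le (u : ℕ → ℝ) (hu : ∀ q, 0 ≤ u q) (T : Finset ℕ) (hT : ∀ q ∈ T, q.Prime) (b : ℕ)
    (hb : 1 ≤ b) : FT u T b ≤ FF u b := by
  rw [← sub_nonneg, FF_sub u T hT b hb]
  refine Finset.sum_nonneg fun S _ => ?_
  split_ifs
  · exact le_rfl
  · exact Finset.prod_nonneg fun q _ => hu q

lemma tail_sum_s6 (u : ℕ → ℝ) (hu : ∀ q, 0 ≤ u q) (hs : Summable fun q : ℕ => u q / q) (T : Finset ℕ) :
    (Summable fun S : Finset ℕ => (if S ⊆ T then 0 else ∏ q ∈ S, u q) / ((∏ q ∈ S, q : ℕ) : ℝ)) ∧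
    ∑' S : Finset ℕ, (if S ⊆ T then 0 else ∏ q ∈ S, u q) / ((∏ q ∈ S, q : ℕ) : ℝ)
     = ∑' S : Finset ℕ, (∏ q ∈ S, u q) / ((∏ q ∈ S, q : ℕ) : ℝ) - ∏ q ∈ T, (1 + u q / q) := by
  have h := (summ_aux u hu hs).hasSum
  have h2 : HasSum (fun S : Finset ℕ =>
      if S ⊆ T then (∏ q ∈ S, u q) / ((∏ q ∈ S, q : ℕ) : ℝ) else 0) (∏ q ∈ T, (1 + u q / q)) := by
    rw [Finset.prod_one_add]
    have : ∑ t ∈ T.powerset, ∏ i ∈ t, u i / (i : ℝ) = ∑ S ∈ T.powerset,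
        if S ⊆ T then (∏ q ∈ S, u q) / ((∏ q ∈ S, q : ℕ) : ℝ) else 0 := by
      refine Finset.sum_congr rfl fun S hS => ?_
      rw [if_pos (Finset.mem_powerset.1 hS), Finset.prod_div_distrib]; push_cast; rfl
    rw [this]
    apply hasSum_sum_of_ne_finset_zero
    intro S hS
    rw [Finset.mem_powerset] at hS
    simp [hS]
  have h3 := h.sub h2
  have h4 : HasSum (fun S : Finset ℕ => (if S ⊆ T then 0 else ∏ q ∈ S, u q) / ((∏ q ∈ S, q : ℕ) : ℝ))
     (∑' S : Finset ℕ, (∏ q ∈ S, u q) / ((∏ q ∈ S, q : ℕ) : ℝ) - ∏ q ∈ T, (1 + u q / q)) := by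
    refine Eq.subst (motive := fun f => HasSum f _) (funext fun S => ?_) h3
    split_ifs <;> simp
  exact ⟨h4.summable, h4.tsum_eq⟩

lemma FF_cube (u : ℕ → ℝ) (b : ℕ) : FF u b ^ 3 = FF (fun q => (1 + u q) ^ 3 - 1) b := by
  unfold FF
  rw [← Finset.prod_pow]
  refine Finset.prod_congr rfl fun q _ => by ring

lemma tail_bound (u : ℕ → ℝ) (A : ℝ) (hu : ∀ q, 0 ≤ u q) (huA : ∀ q, u q ≤ A)
    (hs : Summable fun q : ℕ => u q / q) :
    ∃ C : ℝ, 0 ≤ C ∧ ∀ (T : Finset ℕ), (∀ q ∈ T, q.Prime) → ∀ B δ K : ℝ, 0 < B → 0 < δ → 1 ≤ K →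
      ∀ s : Finset ℕ, (∀ b ∈ s, 1 ≤ b ∧ (b : ℝ) ≤ B * FF u b ∧ B * ((1 + δ) * FT u T b) < b) →
      (s.card : ℝ) ≤ B * (4 * (K ^ 2 / δ * (∑' S : Finset ℕ, (∏ q ∈ S, u q) / ((∏ q ∈ S, q : ℕ) : ℝ)
        - ∏ q ∈ T, (1 + u q / q)) + C / K)) := by
  set u3 : ℕ → ℝ := fun q => (1 + u q) ^ 3 - 1 with hu3
  have hu3n : ∀ q, 0 ≤ u3 q := fun q => by
    have := hu q
    simp only [hu3]; nlinarith [pow_nonneg this 2, pow_nonneg this 3]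
  have hs3 : Summable fun q : ℕ => u3 q / q := by
    refine Summable.of_nonneg_of_le (fun q => div_nonneg (hu3n q) (by positivity)) (fun q => ?_)
      (hs.mul_left (3 + 3 * A + A ^ 2))
    rw [← mul_div_assoc]
    apply div_le_div_of_nonneg_right _ (by positivity)
    have h0 := hu q
    have h1 := huA q
    have : u3 q = (3 + 3 * u q + u q ^ 2) * u q := by simp only [hu3]; ring
    rw [this]
    apply mul_le_mul_of_nonneg_right _ h0
    nlinarith
  refine ⟨∑' S : Finset ℕ, (∏ q ∈ S, u3 q) / ((∏ q ∈ S, q : ℕ) : ℝ),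
    tsum_nonneg fun S => div_nonneg (Finset.prod_nonneg fun q _ => hu3n q) (by positivity), ?_⟩
  intro T hT B δ K hB hδ hK s hsb
  obtain ⟨ht1, ht2⟩ := tail_sum_s6 u hu hs T
  have e1 := avg B hB _ (fun S => by
    split_ifs
    · exact le_rfl
    · exact Finset.prod_nonneg fun q _ => hu q) ht1 s (fun b hb => (hsb b hb).1)
  have e2 := avg B hB _ (fun S => Finset.prod_nonneg fun q _ => hu3n q) (summ_aux u3 hu3n hs3) s
    (fun b hb => (hsb b hb).1)
  rw [ht2] at e1
  set M := ∑' S : Finset ℕ, (∏ q ∈ S, u q) / ((∏ q ∈ S, q : ℕ) : ℝ)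
  set C := ∑' S : Finset ℕ, (∏ q ∈ S, u3 q) / ((∏ q ∈ S, q : ℕ) : ℝ)
  have key : ∀ b ∈ s, (1 : ℝ) ≤ 4 * (K ^ 2 / δ) * ((B / (B + (b : ℝ))) ^ 2 *
      ∑ S ∈ b.primeFactors.powerset, if S ⊆ T then 0 else ∏ q ∈ S, u q) +
      4 / K * ((B / (B + (b : ℝ))) ^ 2 * ∑ S ∈ b.primeFactors.powerset, ∏ q ∈ S, u3 q) := by
    intro b hb
    obtain ⟨hb1, hb2, hb3⟩ := hsb b hb
    rw [← FF_sub u T hT b hb1, ← FF_eq, ← FF_cube]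
    have hT1 := FT_ge_one u hu T b
    have hTF := FT_le u hu T hT b hb1
    set F := FF u b
    set G := FT u T b
    have hb0 : (0 : ℝ) ≤ b := by positivity
    have hFG : δ ≤ F - G := by
      have : B * ((1 + δ) * G) < B * F := by linarith
      have := lt_of_mul_lt_mul_left this hB.le
      nlinarith
    have hw : 1 ≤ 4 * (B / (B + (b : ℝ))) ^ 2 * F ^ 2 := by
      have : 1 ≤ 2 * (B / (B + b)) * F := by
        rw [mul_div_assoc', div_mul_eq_mul_div, le_div_iff₀ (by positivity)]
        nlinarith
      nlinarith
    set w := (B / (B + (b : ℝ))) ^ 2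
    have hw0 : 0 ≤ w := by positivity
    have hK0 : 0 < K := by linarith
    have hF0 : 0 < F := by linarith
    have t1 : 0 ≤ 4 * (K ^ 2 / δ) * (w * (F - G)) := by
      have : 0 ≤ F - G := by linarith
      positivity
    have t2 : 0 ≤ 4 / K * (w * F ^ 3) := by positivity
    rcases le_total F K with h | h
    · have : 4 * w * F ^ 2 ≤ 4 * (K ^ 2 / δ) * (w * (F - G)) := by
        have a1 : F ^ 2 ≤ K ^ 2 := by gcongr
        have a2 : 1 ≤ (F - G) / δ := by rwa [le_div_iff₀ hδ, one_mul]
        calc 4 * w * F ^ 2 ≤ 4 * w * K ^ 2 * 1 := by rw [mul_one]; gcongr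
          _ ≤ 4 * w * K ^ 2 * ((F - G) / δ) := by gcongr
          _ = _ := by ring
      linarith
    · have : 4 * w * F ^ 2 ≤ 4 / K * (w * F ^ 3) := by
        have a2 : 1 ≤ F / K := by rwa [le_div_iff₀ hK0, one_mul]
        calc 4 * w * F ^ 2 = 4 * w * F ^ 2 * 1 := by ring
          _ ≤ 4 * w * F ^ 2 * (F / K) := by gcongr
          _ = _ := by ring
      linarith
  have := Finset.sum_le_sum key
  rw [Finset.sum_add_distrib, ← Finset.mul_sum, ← Finset.mul_sum] at this
  simp only [Finset.sum_const, nsmul_eq_mul, mul_one] at this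
  refine this.trans ?_
  have hK0 : 0 < K := by linarith
  have f1 := mul_le_mul_of_nonneg_left e1 (show 0 ≤ 4 * (K ^ 2 / δ) by positivity)
  have f2 := mul_le_mul_of_nonneg_left e2 (show 0 ≤ 4 / K by positivity)
  refine (add_le_add f1 f2).trans (le_of_eq ?_)
  ring

/-- Counting an arithmetic progression. -/
lemma ap_count (P r : ℕ) (hP : 0 < P) (c : ℝ) (hc : 0 ≤ c) :
    Tendsto (fun B : ℝ => (({b ∈ Finset.Ioc 0 ⌊B * c⌋₊ | b ≡ r [MOD P]}.card : ℕ) : ℝ) / B)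
      atTop (nhds (c / P)) := by
  have hP' : (0 : ℝ) < P := by exact_mod_cast hP
  have bd : ∀ B : ℝ, 0 < B →
      |(({b ∈ Finset.Ioc 0 ⌊B * c⌋₊ | b ≡ r [MOD P]}.card : ℕ) : ℝ) / B - c / P| ≤ 3 / B := by
    intro B hB
    have h := Nat.Ioc_filter_modEq_card 0 ⌊B * c⌋₊ hP r
    set n := {b ∈ Finset.Ioc 0 ⌊B * c⌋₊ | b ≡ r [MOD P]}.card
    have hBc : 0 ≤ B * c := by positivity
    have f1 := Nat.floor_le hBc
    have f2 := Nat.lt_floor_add_one (B * c)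
    set N := ⌊B * c⌋₊
    have hmono : ⌊(((0 : ℕ) : ℚ) - r) / P⌋ ≤ ⌊((N : ℚ) - r) / P⌋ := by
      apply Int.floor_le_floor
      gcongr
      simp
    rw [max_eq_left (by omega)] at h
    have hn : (n : ℝ) = ((⌊((N : ℚ) - r) / P⌋ : ℤ) : ℝ) - ((⌊(((0 : ℕ) : ℚ) - r) / P⌋ : ℤ) : ℝ) := by
      exact_mod_cast h
    have g1 : ((⌊((N : ℚ) - r) / P⌋ : ℤ) : ℝ) ≤ ((N : ℝ) - r) / P := by
      exact_mod_cast Int.floor_le (((N : ℚ) - r) / P)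
    have g2 : ((N : ℝ) - r) / P < ((⌊((N : ℚ) - r) / P⌋ : ℤ) : ℝ) + 1 := by
      exact_mod_cast Int.lt_floor_add_one (((N : ℚ) - r) / P)
    have g3 : ((⌊(((0 : ℕ) : ℚ) - r) / P⌋ : ℤ) : ℝ) ≤ (((0 : ℕ) : ℝ) - r) / P := by
      exact_mod_cast Int.floor_le ((((0 : ℕ) : ℚ) - r) / P)
    have g4 : (((0 : ℕ) : ℝ) - r) / P < ((⌊(((0 : ℕ) : ℚ) - r) / P⌋ : ℤ) : ℝ) + 1 := by
      exact_mod_cast Int.lt_floor_add_one ((((0 : ℕ) : ℚ) - r) / P)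
    have k1 : ((N : ℝ) - r) / P - (((0 : ℕ) : ℝ) - r) / P = N / P := by push_cast; ring
    have k2 : (N : ℝ) / P ≤ B * c / P := by gcongr
    have k3 : B * c / P - 1 ≤ N / P := by
      have : B * c / P ≤ (N + 1) / P := by gcongr
      have h1 : (1 : ℝ) / P ≤ 1 := by
        rw [div_le_one hP']; exact_mod_cast hP
      rw [add_div] at this
      linarith
    have : (n : ℝ) / B - c / P = (n - B * c / P) / B := by field_simp
    rw [this, abs_div, abs_of_pos hB]
    gcongr
    rw [abs_le]
    constructor <;> linarith
  rw [tendsto_iff_norm_sub_tendsto_zero]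
  refine squeeze_zero' (Eventually.of_forall fun _ => norm_nonneg _)
    (g := fun B : ℝ => 3 / B) ?_ (tendsto_const_nhds.div_atTop tendsto_id)
  filter_upwards [eventually_gt_atTop 0] with B hB
  exact bd B hB

lemma per_finite (P : ℕ) (hP : 0 < P) (G : ℕ → ℝ) (hper : ∀ b, G b = G (b % P)) (B : ℝ) :
    {b : ℕ | 1 ≤ b ∧ (b : ℝ) ≤ B * G b}.Finite := by
  refine ((Finset.range P).finite_toSet.biUnion fun r _ =>
    (Finset.Iic ⌊B * G r⌋₊).finite_toSet).subset ?_
  intro b hb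
  simp only [Set.mem_iUnion]
  refine ⟨b % P, by simpa using Nat.mod_lt _ hP, ?_⟩
  have := hb.2
  rw [hper] at this
  simpa using Nat.le_floor this

lemma per_count (P : ℕ) (hP : 0 < P) (G : ℕ → ℝ) (hper : ∀ b, G b = G (b % P)) (hG : ∀ b, 0 ≤ G b) :
    Tendsto (fun B : ℝ => (Nat.card {b : ℕ | 1 ≤ b ∧ (b : ℝ) ≤ B * G b} : ℝ) / B)
      atTop (nhds ((∑ r ∈ Finset.range P, G r) / P)) := by
  classical
  rw [Finset.sum_div]
  have h := tendsto_finsetSum (Finset.range P) fun r _ => ap_count P r hP (G r) (hG r)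
  refine h.congr' ?_
  filter_upwards [eventually_gt_atTop 0] with B hB
  rw [← Finset.sum_div]
  congr 1
  have hd : Set.PairwiseDisjoint (↑(Finset.range P)) fun r =>
      {b ∈ Finset.Ioc 0 ⌊B * G r⌋₊ | b ≡ r [MOD P]} := by
    intro r hr r' hr' hne
    rw [Function.onFun, Finset.disjoint_left]
    intro b hb hb'
    simp only [Finset.mem_filter] at hb hb'
    have := hb.2.symm.trans hb'.2
    simp only [Finset.coe_range, Set.mem_Iio] at hr hr'
    exact hne (Nat.ModEq.eq_of_lt_of_lt this hr hr')
  rw [← Nat.cast_sum, ← Finset.card_biUnion hd, Nat.card_coe_set_eq, ← Set.ncard_coe_finset]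
  congr 2
  ext b
  simp only [Finset.coe_biUnion, Finset.coe_range, Set.mem_iUnion, Finset.coe_filter,
    Finset.mem_Ioc, Set.mem_ofPred_eq, Set.mem_Iio, exists_prop]
  constructor
  · rintro ⟨r, hr, ⟨h0, hb⟩, hbr⟩
    have : b % P = r := by rw [hbr, Nat.mod_eq_of_lt hr]
    refine ⟨h0, ?_⟩
    rw [hper, this]
    exact (Nat.le_floor_iff (mul_nonneg hB.le (hG r))).1 hb
  · rintro ⟨h1, hb⟩
    refine ⟨b % P, Nat.mod_lt _ hP, ⟨h1, ?_⟩, (Nat.mod_modEq b P).symm⟩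
    rw [hper] at hb
    exact Nat.le_floor hb

lemma FT_per (u : ℕ → ℝ) (T : Finset ℕ) (b : ℕ) :
    FT u T b = FT u T (b % ∏ q ∈ T, q) := by
  unfold FT
  congr 1
  refine Finset.filter_congr fun q hq => ?_
  exact ((Nat.dvd_mod_iff (Finset.dvd_prod_of_mem (fun q => q) hq))).symm

lemma FT_mean (u : ℕ → ℝ) (T : Finset ℕ) (hT : ∀ q ∈ T, q.Prime) :
    (∑ r ∈ Finset.range (∏ q ∈ T, q), FT u T r) / ((∏ q ∈ T, q : ℕ) : ℝ) = ∏ q ∈ T, (1 + u q / q) := by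
  classical
  set P := ∏ q ∈ T, q with hPdef
  have hP : 0 < P := Finset.prod_pos fun q hq => (hT q hq).pos
  have hP' : (0 : ℝ) < P := by exact_mod_cast hP
  have e : ∀ r, FT u T r = ∑ S ∈ T.powerset, if (∏ q ∈ S, q) ∣ r then ∏ q ∈ S, u q else 0 := by
    intro r
    rw [FT, Finset.prod_one_add, ← Finset.sum_filter]
    refine Finset.sum_congr ?_ fun _ _ => rfl
    ext S
    simp only [Finset.mem_powerset, Finset.mem_filter]
    constructor
    · intro h
      refine ⟨h.trans (Finset.filter_subset _ _), Finset.prod_primes_dvd r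
        (fun q hq => (hT q (Finset.mem_filter.1 (h hq)).1).prime)
        fun q hq => (Finset.mem_filter.1 (h hq)).2⟩
    · rintro ⟨h1, h2⟩ q hq
      exact Finset.mem_filter.2 ⟨h1 hq, (Finset.dvd_prod_of_mem (fun q => q) hq).trans h2⟩
  simp_rw [e]
  rw [Finset.sum_comm, Finset.sum_div, Finset.prod_one_add]
  refine Finset.sum_congr rfl fun S hS => ?_
  rw [Finset.mem_powerset] at hS
  have hD : 0 < ∏ q ∈ S, q := Finset.prod_pos fun q hq => (hT q (hS hq)).pos
  have hDP : (∏ q ∈ S, q) ∣ P := Finset.prod_dvd_prod_of_subset _ _ _ hS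
  rw [Finset.prod_div_distrib, ← Nat.cast_prod]
  set D := ∏ q ∈ S, q
  rw [← Finset.sum_filter, Finset.sum_const, nsmul_eq_mul]
  have hc : ((Finset.range P).filter fun r => D ∣ r).card = P / D := by
    have := Nat.count_modEq_card P hD 0
    rw [Nat.count_eq_card_filter_range] at this
    simp only [Nat.modEq_zero_iff_dvd, Nat.mod_eq_zero_of_dvd hDP, lt_irrefl, Nat.zero_mod,
      if_false, add_zero] at this
    exact this
  rw [hc, Nat.cast_div hDP (by positivity)]
  field_simp

theorem core (u : ℕ → ℝ) (A : ℝ) (hu : ∀ q, 0 ≤ u q) (huA : ∀ q, u q ≤ A)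
    (hup : ∀ q, ¬ q.Prime → u q = 0) (hs : Summable fun q : ℕ => u q / q) (M : ℝ)
    (hM : HasProd (fun q : ℕ => 1 + u q / q) M) :
    Tendsto (fun B : ℝ => (Nat.card {b : ℕ | 1 ≤ b ∧ (b : ℝ) ≤ B * FF u b} : ℝ) / B)
      atTop (nhds M) := by
  classical
  obtain ⟨C, hC, htail⟩ := tail_bound u A hu huA hs
  rw [(hasProd_aux u hu hs).unique hM] at htail
  -- truncations
  have hTex : ∀ η > 0, ∃ T : Finset ℕ, (∀ q ∈ T, q.Prime) ∧ |∏ q ∈ T, (1 + u q / q) - M| < η := by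
    intro η hη
    have h1 : Tendsto (fun T : Finset ℕ => ∏ q ∈ T, (1 + u q / q)) atTop (nhds M) := by
      simpa [HasProd] using hM
    obtain ⟨T, hT⟩ := (Metric.tendsto_nhds.1 h1 η hη).exists
    refine ⟨T.filter Nat.Prime, fun q hq => (Finset.mem_filter.1 hq).2, ?_⟩
    rw [Finset.prod_filter_of_ne]
    · exact hT
    · intro q _ hne
      by_contra hq
      exact hne (by simp [hup q hq])
  -- comparison with truncations
  have hcmp : ∀ (T : Finset ℕ), (∀ q ∈ T, q.Prime) → ∀ δ K B : ℝ, 0 < δ → 1 ≤ K → 0 < B →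
      (Nat.card {b : ℕ | 1 ≤ b ∧ (b : ℝ) ≤ B * FT u T b} : ℝ) / B ≤
        (Nat.card {b : ℕ | 1 ≤ b ∧ (b : ℝ) ≤ B * FF u b} : ℝ) / B ∧
      (Nat.card {b : ℕ | 1 ≤ b ∧ (b : ℝ) ≤ B * FF u b} : ℝ) / B ≤
        (Nat.card {b : ℕ | 1 ≤ b ∧ (b : ℝ) ≤ B * ((1 + δ) * FT u T b)} : ℝ) / B +
          4 * (K ^ 2 / δ * (M - ∏ q ∈ T, (1 + u q / q)) + C / K) := by
    intro T hT δ K B hδ hK hB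
    have hP : 0 < ∏ q ∈ T, q := Finset.prod_pos fun q hq => (hT q hq).pos
    set E := 4 * (K ^ 2 / δ * (M - ∏ q ∈ T, (1 + u q / q)) + C / K)
    set X := {b : ℕ | 1 ≤ b ∧ (b : ℝ) ≤ B * FF u b}
    set Y := {b : ℕ | 1 ≤ b ∧ (b : ℝ) ≤ B * ((1 + δ) * FT u T b)}
    have hY : Y.Finite := per_finite _ hP (fun b => (1 + δ) * FT u T b)
      (fun b => by rw [← FT_per]) B
    have hZ : ∀ s : Finset ℕ, (s : Set ℕ) ⊆ X \ Y → (s.card : ℝ) ≤ B * E := by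
      intro s hsub
      apply htail T hT B δ K hB hδ hK
      intro b hb
      obtain ⟨hx, hy⟩ := hsub hb
      refine ⟨hx.1, hx.2, ?_⟩
      by_contra hh
      exact hy ⟨hx.1, not_lt.1 hh⟩
    have hZf : (X \ Y).Finite := by
      by_contra hinf
      obtain ⟨t, ht, hc⟩ := Set.Infinite.exists_subset_card_eq hinf (⌊B * E⌋₊ + 1)
      have h1 := hZ t ht
      rw [hc] at h1
      have := Nat.lt_floor_add_one (B * E)
      push_cast at h1
      linarith
    have hX : X.Finite := (hZf.union hY).subset (by
      intro b hb
      by_cases h : b ∈ Y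
      · exact Or.inr h
      · exact Or.inl ⟨hb, h⟩)
    rw [Nat.card_coe_set_eq, Nat.card_coe_set_eq, Nat.card_coe_set_eq]
    constructor
    · gcongr
      intro b hb
      refine ⟨hb.1, hb.2.trans ?_⟩
      have := FT_le u hu T hT b hb.1
      gcongr
    · have h1 : X.ncard ≤ (X \ Y).ncard + Y.ncard := Set.ncard_le_ncard_sdiff_add_ncard X Y hY
      have h2 := hZ hZf.toFinset (by simp)
      rw [← Set.ncard_eq_toFinset_card _ hZf] at h2
      have h3 : (X.ncard : ℝ) ≤ (X \ Y).ncard + Y.ncard := by exact_mod_cast h1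
      rw [div_add' _ _ _ hB.ne']
      gcongr
      linarith
  have hlim : ∀ (T : Finset ℕ), (∀ q ∈ T, q.Prime) → ∀ δ : ℝ, 0 ≤ δ →
      Tendsto (fun B : ℝ => (Nat.card {b : ℕ | 1 ≤ b ∧ (b : ℝ) ≤ B * ((1 + δ) * FT u T b)} : ℝ) / B)
      atTop (nhds ((1 + δ) * ∏ q ∈ T, (1 + u q / q))) := by
    intro T hT δ hδ
    have hP : 0 < ∏ q ∈ T, q := Finset.prod_pos fun q hq => (hT q hq).pos
    have := per_count _ hP (fun b => (1 + δ) * FT u T b) (fun b => by rw [← FT_per])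
      (fun b => by have := FT_ge_one u hu T b; positivity)
    rwa [← Finset.mul_sum, mul_div_assoc, FT_mean u T hT] at this
  rw [Metric.tendsto_nhds]
  intro ε hε
  set δ : ℝ := ε / (8 * (|M| + 1)) with hδ
  have hM0 : 0 ≤ |M| := abs_nonneg M
  have hδ0 : 0 < δ := by positivity
  set K : ℝ := 1 + 32 * C / ε with hK
  have hK1 : 1 ≤ K := by have : 0 ≤ 32 * C / ε := by positivity
                         linarith
  obtain ⟨T, hT, hTM⟩ := hTex (min (min 1 (ε / 4)) (ε / 8 / (4 * (K ^ 2 / δ)))) (by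
    have : 0 < K := by linarith
    positivity)
  set m := ∏ q ∈ T, (1 + u q / q)
  have hT1 : |m - M| < 1 := hTM.trans_le ((min_le_left _ _).trans (min_le_left _ _))
  have hT2 : |m - M| < ε / 4 := hTM.trans_le ((min_le_left _ _).trans (min_le_right _ _))
  have hT3 : |m - M| < ε / 8 / (4 * (K ^ 2 / δ)) := hTM.trans_le (min_le_right _ _)
  have hKd : 0 < 4 * (K ^ 2 / δ) := by
    have : 0 < K := by linarith
    positivity
  rw [lt_div_iff₀ hKd] at hT3
  have hCK : 4 * (C / K) ≤ ε / 8 := by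
    have hK0 : 0 < K := by linarith
    rw [mul_div_assoc', div_le_iff₀ hK0, hK]
    have : ε / 8 * (1 + 32 * C / ε) = ε / 8 + 4 * C := by field_simp; ring
    rw [this]; linarith
  have hδM : δ * m ≤ ε / 8 := by
    have : m ≤ |M| + 1 := by
      have := abs_lt.1 hT1
      have := le_abs_self M
      linarith
    calc δ * m ≤ δ * (|M| + 1) := by gcongr
      _ = ε / 8 := by rw [hδ]; field_simp
  have l1 := Metric.tendsto_nhds.1 (hlim T hT 0 le_rfl) (ε / 4) (by positivity)
  have l2 := Metric.tendsto_nhds.1 (hlim T hT δ hδ0.le) (ε / 4) (by positivity)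
  filter_upwards [l1, l2, eventually_gt_atTop 0] with B h1 h2 hB
  obtain ⟨c1, c2⟩ := hcmp T hT δ K B hδ0 hK1 hB
  simp only [add_zero, one_mul] at h1
  rw [Real.dist_eq, abs_lt] at h1 h2 ⊢
  have a2 := abs_lt.1 hT2
  have a3 : 4 * (K ^ 2 / δ) * (M - m) ≤ ε / 8 := by
    have : M - m ≤ |m - M| := by rw [abs_sub_comm]; exact le_abs_self _
    have := mul_le_mul_of_nonneg_left this hKd.le
    linarith
  constructor <;> linarith [h1.1, h1.2, h2.1, h2.2]

lemma zeta_euler_s6 (s : ℕ) (hs : 2 ≤ s) :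
    HasProd (fun q : Nat.Primes => (1 - 1 / ((q : ℕ) : ℝ) ^ s)⁻¹) (zetaR s) := by
  let f : ℕ →*₀ ℝ :=
    { toFun := fun n => 1 / (n : ℝ) ^ s
      map_zero' := by simp; omega
      map_one' := by simp
      map_mul' := fun a b => by push_cast; rw [mul_pow]; ring }
  have hsum : Summable fun n : ℕ => f n := Real.summable_one_div_nat_pow.2 (by omega)
  have h := EulerProduct.eulerProduct_completely_multiplicative_hasProd (f := f) hsum.norm
  have e : ∑' n, f n = zetaR s := by
    rw [hsum.tsum_eq_zero_add, map_zero, zero_add, zetaR]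
    refine tsum_congr fun n => ?_
    change 1 / ((n + 1 : ℕ) : ℝ) ^ s = _
    push_cast; rfl
  rw [e] at h
  exact h

/-- The weight `1/(q-1)` at primes `q`. -/
noncomputable def uu (q : ℕ) : ℝ := if q.Prime then 1 / ((q : ℝ) - 1) else 0

lemma uu_bounds (q : ℕ) : 0 ≤ uu q ∧ uu q ≤ 1 ∧ uu q / q ≤ 2 * (1 / (q : ℝ) ^ 2) := by
  unfold uu
  split_ifs with h
  · have h2 : (2 : ℝ) ≤ q := by exact_mod_cast h.two_le
    have h1 : 0 < (q : ℝ) - 1 := by linarith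
    refine ⟨by positivity, ?_, ?_⟩
    · rw [div_le_one h1]; linarith
    · rw [div_div, mul_one_div, div_le_div_iff₀ (by positivity) (by positivity)]
      nlinarith
  · refine ⟨le_rfl, zero_le_one, ?_⟩
    rw [zero_div]; positivity

lemma uu_summable : Summable fun q : ℕ => uu q / q :=
  Summable.of_nonneg_of_le (fun q => div_nonneg (uu_bounds q).1 (by positivity))
    (fun q => (uu_bounds q).2.2) ((Real.summable_one_div_nat_pow.2 (by norm_num)).mul_left 2)

lemma uu_hasProd : HasProd (fun q : ℕ => 1 + uu q / q) (zetaR 2 * zetaR 3 / zetaR 6) := by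
  obtain ⟨M, hM⟩ : ∃ M, HasProd (fun q : ℕ => 1 + uu q / q) M :=
    ⟨_, hasProd_aux uu (fun q => (uu_bounds q).1) uu_summable⟩
  have hM' : HasProd (fun q : Nat.Primes => 1 + uu q / ((q : ℕ) : ℝ)) M := by
    have h := (hasProd_subtype_iff_mulIndicator (s := {q : ℕ | q.Prime})
      (f := fun q : ℕ => 1 + uu q / q) (a := M)).2 (by
        convert hM using 1
        funext q
        by_cases hq : q.Prime
        · exact Set.mulIndicator_of_mem (by exact hq) _
        · rw [Set.mulIndicator_of_notMem (by exact hq)]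
          simp [uu, hq])
    exact h
  have h1 := hM'.mul (zeta_euler_s6 6 (by norm_num))
  have h2 := (zeta_euler_s6 2 (by norm_num)).mul (zeta_euler_s6 3 (by norm_num))
  have e : M * zetaR 6 = zetaR 2 * zetaR 3 := by
    refine h1.unique ?_
    convert h2 using 1
    funext q
    have hq := q.2
    have hq2 : (2 : ℝ) ≤ ((q : ℕ) : ℝ) := by exact_mod_cast hq.two_le
    simp only [uu, if_pos hq]
    set x : ℝ := ((q : ℕ) : ℝ)
    have a1 : x - 1 ≠ 0 := by linarith
    have a0 : x ≠ 0 := by linarith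
    have b : ∀ k : ℕ, k ≠ 0 → 1 - 1 / x ^ k = (x ^ k - 1) / x ^ k := fun k _ => by
      field_simp
    have c : ∀ k : ℕ, k ≠ 0 → x ^ k - 1 ≠ 0 := fun k hk => by
      have : 1 < x ^ k := one_lt_pow₀ (by linarith) hk
      linarith
    rw [b 6 (by norm_num), b 2 (by norm_num), b 3 (by norm_num)]
    have c6 := c 6 (by norm_num)
    have c2 := c 2 (by norm_num)
    have c3 := c 3 (by norm_num)
    rw [inv_div, inv_div, inv_div]
    field_simp
    ring
  rw [← e, mul_div_cancel_right₀ _ (zetaR_pos 6 (by norm_num)).ne']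
  exact hM

lemma totient_FF (p : ℕ) (hp : p.Prime) (l b : ℕ) (hl : l ≠ 0) (hb : 1 ≤ b) :
    ((p ^ l * b).totient : ℝ) * (1 / ((p : ℝ) ^ l * (1 - (p : ℝ)⁻¹)) *
      FF (fun q => if q = p then 0 else uu q) b) = b := by
  classical
  have h := Nat.totient_eq_mul_prod_factors (p ^ l * b)
  have h' : ((p ^ l * b).totient : ℝ) = (p : ℝ) ^ l * b *
      ∏ q ∈ (p ^ l * b).primeFactors, (1 - (q : ℝ)⁻¹) := by
    have := congrArg (fun x : ℚ => (x : ℝ)) h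
    push_cast at this
    exact this
  have hpf : (p ^ l * b).primeFactors = insert p (b.primeFactors.erase p) := by
    rw [Nat.primeFactors_mul (pow_ne_zero _ hp.ne_zero) (by omega), Nat.primeFactors_prime_pow hl hp]
    ext q; simp [Finset.mem_erase]; tauto
  have hF : FF (fun q => if q = p then 0 else uu q) b =
      ∏ q ∈ b.primeFactors.erase p, (1 - (q : ℝ)⁻¹)⁻¹ := by
    unfold FF
    rw [← Finset.prod_erase b.primeFactors (a := p) (by simp)]
    refine Finset.prod_congr rfl fun q hq => ?_
    rw [Finset.mem_erase] at hq
    have hqp := Nat.prime_of_mem_primeFactors hq.2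
    have hq2 : (2 : ℝ) ≤ q := by exact_mod_cast hqp.two_le
    have a1 : (q : ℝ) - 1 ≠ 0 := by linarith
    have a0 : (q : ℝ) ≠ 0 := by linarith
    have e : (1 : ℝ) - (q : ℝ)⁻¹ = (q - 1) / q := by field_simp
    simp only [hq.1, if_false, uu, if_pos hqp]
    rw [e, inv_div]
    field_simp
    ring
  rw [h', hpf, Finset.prod_insert (by simp), hF, Finset.prod_inv_distrib]
  have hne : ∏ q ∈ b.primeFactors.erase p, (1 - (q : ℝ)⁻¹) ≠ 0 := by
    refine Finset.prod_ne_zero_iff.2 fun q hq => ?_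
    have hqp := Nat.prime_of_mem_primeFactors (Finset.mem_erase.1 hq).2
    have hq2 : (1 : ℝ) < q := by exact_mod_cast hqp.one_lt
    have := inv_lt_one_of_one_lt₀ hq2
    linarith
  have hp1 : (1 : ℝ) - (p : ℝ)⁻¹ ≠ 0 := by
    have hq2 : (1 : ℝ) < p := by exact_mod_cast hp.one_lt
    have := inv_lt_one_of_one_lt₀ hq2
    linarith
  have hp0 : (p : ℝ) ^ l ≠ 0 := pow_ne_zero _ (by exact_mod_cast hp.ne_zero)
  generalize (1 : ℝ) - (p : ℝ)⁻¹ = y at *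
  generalize ∏ q ∈ b.primeFactors.erase p, (1 - (q : ℝ)⁻¹) = z at *
  field_simp

/-- size of `Ψ_B`: `|Ψ_B| = (a_p + o(1))·B` as `B → +∞`. -/
theorem card_PsiB_asymptotic (p : ℕ) [Fact p.Prime] :
    Tendsto (fun B : ℝ =>
        (Nat.card {b : ℕ | 1 ≤ b ∧ ((p ^ ellp p * b).totient : ℝ) ≤ B} : ℝ) / B)
      atTop (nhds (ap p)) := by
  classical
  have hp : p.Prime := Fact.out
  have hl : ellp p ≠ 0 := by unfold ellp; split_ifs <;> norm_num
  have hp1 : (1 : ℝ) < p := by exact_mod_cast hp.one_lt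
  have hpi : 0 < (1 : ℝ) - (p : ℝ)⁻¹ := by
    have := inv_lt_one_of_one_lt₀ hp1
    linarith
  set l := ellp p with hldef
  set κ : ℝ := 1 / ((p : ℝ) ^ l * (1 - (p : ℝ)⁻¹)) with hκ
  have hκ0 : 0 < κ := by positivity
  set u : ℕ → ℝ := fun q => if q = p then 0 else uu q with hu
  have hu0 : ∀ q, 0 ≤ u q := fun q => by
    simp only [hu]; split_ifs
    · exact le_rfl
    · exact (uu_bounds q).1
  have huu : ∀ q, u q ≤ uu q := fun q => by
    simp only [hu]; split_ifs
    · exact (uu_bounds q).1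
    · exact le_rfl
  have hus : Summable fun q : ℕ => u q / q :=
    Summable.of_nonneg_of_le (fun q => div_nonneg (hu0 q) (by positivity))
      (fun q => div_le_div_of_nonneg_right (huu q) (by positivity)) uu_summable
  obtain ⟨M, hM⟩ : ∃ M, HasProd (fun q : ℕ => 1 + u q / q) M := ⟨_, hasProd_aux u hu0 hus⟩
  have hMe : M * (1 + uu p / p) = zetaR 2 * zetaR 3 / zetaR 6 := by
    refine (hM.mul (hasProd_ite_eq p (1 + uu p / p))).unique ?_
    convert uu_hasProd using 1
    funext q
    by_cases h : q = p
    · subst h; simp [hu]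
    · simp [hu, h]
  have hc := core u 1 hu0 (fun q => (huu q).trans (uu_bounds q).2.1)
    (fun q hq => by simp [hu, uu, hq]) hus M hM
  have hc2 := (hc.comp (tendsto_id.atTop_mul_const hκ0)).mul_const κ
  have hap : ap p = M * κ := by
    have hx : (p : ℝ) ^ 2 - p + 1 ≠ 0 := by nlinarith
    have hp0 : (p : ℝ) ≠ 0 := by linarith
    have hpm : (p : ℝ) - 1 ≠ 0 := by linarith
    rw [ap, ← hMe, ← hldef, zpow_sub₀ hp0, zpow_natCast, hκ]
    have e : (1 : ℝ) - (p : ℝ)⁻¹ = (p - 1) / p := by field_simp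
    simp only [uu, if_pos hp]
    rw [e]
    have e2 : (1 : ℝ) + 1 / ((p : ℝ) - 1) / p = (p ^ 2 - p + 1) / (p * (p - 1)) := by
      field_simp
    rw [e2]
    have e3 : (p : ℝ) ^ (2 : ℤ) = (p : ℝ) ^ 2 := by norm_cast
    rw [e3]
    generalize (p : ℝ) ^ 2 - p + 1 = z at *
    field_simp
  rw [hap]
  refine hc2.congr' ?_
  filter_upwards [eventually_gt_atTop 0] with B hB
  simp only [Function.comp, id]
  have hset : {b : ℕ | 1 ≤ b ∧ (b : ℝ) ≤ B * κ * FF u b} =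
      {b : ℕ | 1 ≤ b ∧ ((p ^ l * b).totient : ℝ) ≤ B} := by
    ext b
    refine and_congr_right fun hb => ?_
    have ht := totient_FF p hp l b hl hb
    have hF : 0 < FF u b := Finset.prod_pos fun q _ => by linarith [hu0 q]
    conv_lhs => rw [← ht, mul_assoc]
    exact mul_le_mul_iff_left₀ (mul_pos hκ0 hF)
  rw [hset]
  field_simp
end

section
/- Fix a prime p and set l_p = 1 if p ≥ 5, l_p = 2 if p = 3, l_p = 3 if p = 2. For real B > 0 let Ψ_B = { b ∈ ℤ_{≥1} : φ(p^{l_p} b) ≤ B } and 𝒵_B = { a/(p^{l_p} b) : b ∈ Ψ_B, 1 ≤ a ≤ p^{l_p} b, gcd(a, p^{l_p} b) = 1 }. Then |𝒵_B| = (a_p/2 + o(1))·B² as B → +∞, i.e. |𝒵_B|/B² → a_p/2, where a_p = (ζ(2)ζ(3)/ζ(6)) · 1/(p^{l_p−2}(p² − p + 1)). Equivalently, Σ_{b ∈ Ψ_B} φ(p^{l_p} b) = (a_p/2 + o(1))·B². -/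
open Filter

/-- The set `𝒵_B` of rational numbers `a/(p^{l_p} b)` with `b ∈ Ψ_B`,
`1 ≤ a ≤ p^{l_p} b` and `gcd(a, p^{l_p} b) = 1`. -/
def Zset (p : ℕ) (B : ℝ) : Set ℚ :=
  {x : ℚ | ∃ a b : ℕ, (1 ≤ b ∧ ((p ^ ellp p * b).totient : ℝ) ≤ B) ∧
    1 ≤ a ∧ a ≤ p ^ ellp p * b ∧ Nat.gcd a (p ^ ellp p * b) = 1 ∧
    x = (a : ℚ) / ((p ^ ellp p * b : ℕ) : ℚ)}


namespace ZB

open Finset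
lemma tail_sq (Y K L : ℕ) (hL : 1 ≤ L) (hY : 1 ≤ Y) :
    ∑ n ∈ (Ioc Y K).filter (fun n => L ∣ n), (1 : ℝ) / (n : ℝ)^2 ≤ 2 / (L * Y) := by
  have h1 : (Ioc Y K).filter (fun n => L ∣ n) ⊆ (Ioo (Y / L) (K + 1)).image (fun m => L * m) := by
    intro n hn
    simp only [mem_filter, mem_Ioc] at hn
    obtain ⟨⟨h1, h2⟩, m, rfl⟩ := hn
    refine mem_image.2 ⟨m, ?_, rfl⟩
    rw [mem_Ioo]
    refine ⟨(Nat.div_lt_iff_lt_mul hL).2 (by rw [mul_comm]; exact h1), ?_⟩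
    nlinarith
  have hLr : (1:ℝ) ≤ L := by exact_mod_cast hL
  have hYr : (1:ℝ) ≤ Y := by exact_mod_cast hY
  calc _ ≤ ∑ n ∈ (Ioo (Y / L) (K + 1)).image (fun m => L * m), (1 : ℝ) / (n : ℝ)^2 :=
        sum_le_sum_of_subset_of_nonneg h1 (fun _ _ _ => by positivity)
    _ = ∑ m ∈ Ioo (Y / L) (K + 1), (1 : ℝ) / ((L * m : ℕ) : ℝ)^2 := by
        rw [sum_image]
        intro a _ b _ h
        exact Nat.eq_of_mul_eq_mul_left hL h
    _ = (1 / (L:ℝ)^2) * ∑ m ∈ Ioo (Y / L) (K + 1), ((m : ℝ)^2)⁻¹ := by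
        rw [mul_sum]; refine sum_congr rfl fun m _ => ?_
        push_cast; rw [mul_pow, one_div, mul_inv, one_div]
    _ ≤ (1 / (L:ℝ)^2) * (2 / ((Y / L : ℕ) + 1)) := by
        gcongr; exact sum_Ioo_inv_sq_le _ _
    _ ≤ (1 / (L:ℝ)^2) * (2 / (Y / L)) := by
        gcongr
        rw [div_le_iff₀ (by positivity)]
        have := Nat.lt_div_mul_add (a := Y) (b := L) hL
        have h2 : Y ≤ (Y / L + 1) * L := by linarith
        exact_mod_cast h2
    _ = _ := by field_simp

lemma class_card (P c N : ℕ) (hP : 0 < P) :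
    |((((Ioc 0 N).filter (fun n => n % P = c % P)).card : ℕ) : ℝ) - (N : ℝ) / P| ≤ 1 := by
  have := Nat.Ioc_filter_modEq_card 0 N (r := P) hP (c % P)
  have hP' : (0:ℝ) < P := by exact_mod_cast hP
  have hPq : (0:ℚ) < P := by exact_mod_cast hP
  have e : (Ioc 0 N).filter (fun n => n % P = c % P) = (Ioc 0 N).filter (fun n => n ≡ c % P [MOD P]) := by
    refine filter_congr fun n _ => ?_
    unfold Nat.ModEq; rw [Nat.mod_mod]
  rw [e]
  set A : ℚ := ((N : ℚ) - ((c % P : ℕ) : ℚ)) / P with hA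
  set B : ℚ := (((0:ℕ) : ℚ) - ((c % P : ℕ) : ℚ)) / P with hB
  have hAB : A - B = (N:ℚ) / P := by rw [hA, hB]; push_cast; ring
  have hBA : B ≤ A := by
    have : (0:ℚ) ≤ (N:ℚ)/P := by positivity
    linarith
  rw [max_eq_left (sub_nonneg.2 (Int.floor_mono hBA))] at this
  have hq : |((((Ioc 0 N).filter (fun n => n ≡ c % P [MOD P])).card : ℕ) : ℚ) - (N : ℚ) / P| ≤ 1 := by
    have t : ((((Ioc 0 N).filter (fun n => n ≡ c % P [MOD P])).card : ℕ) : ℚ) = (⌊A⌋ : ℚ) - ⌊B⌋ := by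
      exact_mod_cast this
    rw [t, ← hAB, abs_le]
    constructor <;> linarith [Int.floor_le A, Int.floor_le B, Int.lt_floor_add_one A, Int.lt_floor_add_one B]
  have hq2 := (Rat.cast_le (K := ℝ)).2 hq
  push_cast at hq2
  exact hq2

/-- counting for periodic functions, upper bound -/
lemma per_upper (g : ℕ → ℝ) (P : ℕ) (hP : 0 < P) (hg : ∀ n, g (n % P) = g n) (h0 : ∀ n, 0 ≤ g n)
    (X K : ℕ) :
    (((Ioc 0 K).filter (fun n : ℕ => (n : ℝ) ≤ X * g n)).card : ℝ) ≤
      X * ((∑ c ∈ range P, g c) / P) + P := by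
  have h1 : ((Ioc 0 K).filter (fun n : ℕ => (n : ℝ) ≤ X * g n)).card ≤
      ∑ c ∈ range P, ((Ioc 0 ⌊X * g c⌋₊).filter (fun n => n % P = c % P)).card := by
    rw [card_eq_sum_card_fiberwise (f := fun n => n % P) (t := range P)]
    · refine sum_le_sum fun c hc => card_le_card ?_
      intro n hn
      simp only [mem_filter, mem_Ioc] at hn ⊢
      obtain ⟨⟨⟨h1, h2⟩, h3⟩, h4⟩ := hn
      refine ⟨⟨h1, Nat.le_floor ?_⟩, ?_⟩
      · rw [← h4, hg]; exact h3
      · rw [h4, Nat.mod_eq_of_lt (mem_range.1 hc)]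
    · intro n _; simpa using Nat.mod_lt _ hP
  have h2 : ∀ c ∈ range P, (((Ioc 0 ⌊X * g c⌋₊).filter (fun n => n % P = c % P)).card : ℝ) ≤
      X * g c / P + 1 := by
    intro c _
    have h := (abs_le.1 (class_card P c ⌊X * g c⌋₊ hP)).2
    have h' : ((⌊X * g c⌋₊ : ℕ) : ℝ) ≤ X * g c := Nat.floor_le (mul_nonneg (by positivity) (h0 c))
    have : ((⌊X * g c⌋₊ : ℕ) : ℝ) / P ≤ X * g c / P := by gcongr
    linarith
  calc _ ≤ ((∑ c ∈ range P, ((Ioc 0 ⌊X * g c⌋₊).filter (fun n => n % P = c % P)).card : ℕ) : ℝ) := by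
        exact_mod_cast h1
    _ ≤ ∑ c ∈ range P, (X * g c / P + 1) := by push_cast; exact sum_le_sum h2
    _ = _ := by rw [sum_add_distrib, ← sum_div, ← mul_sum]; simp; ring

lemma per_lower (g : ℕ → ℝ) (P : ℕ) (hP : 0 < P) (hg : ∀ n, g (n % P) = g n) (h0 : ∀ n, 0 ≤ g n)
    (X K : ℕ) (hK : ∀ n : ℕ, 1 ≤ n → (n : ℝ) ≤ X * g n → n ≤ K) :
      X * ((∑ c ∈ range P, g c) / P) - 2 * P ≤
    (((Ioc 0 K).filter (fun n : ℕ => (n : ℝ) ≤ X * g n)).card : ℝ) := by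
  have h1 : ∑ c ∈ range P, ((Ioc 0 ⌊X * g c⌋₊).filter (fun n => n % P = c % P)).card ≤ 
     ((Ioc 0 K).filter (fun n : ℕ => (n : ℝ) ≤ X * g n)).card := by
    rw [card_eq_sum_card_fiberwise (s := (Ioc 0 K).filter _) (f := fun n => n % P) (t := range P)]
    · refine sum_le_sum fun c hc => card_le_card ?_
      intro n hn
      simp only [mem_filter, mem_Ioc] at hn ⊢
      obtain ⟨⟨h1, h2⟩, h4⟩ := hn
      rw [Nat.mod_eq_of_lt (mem_range.1 hc)] at h4
      have h5 := (Nat.le_floor_iff (mul_nonneg (by positivity) (h0 c))).1 h2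
      rw [← h4, hg] at h5
      exact ⟨⟨⟨h1, hK n h1 h5⟩, h5⟩, h4⟩
    · intro n _; simpa using Nat.mod_lt _ hP
  have hP' : (1:ℝ) ≤ P := by exact_mod_cast hP
  have h2 : ∀ c ∈ range P, X * g c / P - 2 ≤ 
      (((Ioc 0 ⌊X * g c⌋₊).filter (fun n => n % P = c % P)).card : ℝ) := by
    intro c _
    have h := (abs_le.1 (class_card P c ⌊X * g c⌋₊ hP)).1
    have h' := (Nat.lt_floor_add_one (X * g c)).le
    have : X * g c / P ≤ ((⌊X * g c⌋₊ : ℕ) : ℝ) / P + 1 := by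
      rw [div_add_one (by positivity)]
      gcongr; linarith
    linarith
  calc _ = ∑ c ∈ range P, (X * g c / P - 2) := by 
        rw [sum_sub_distrib, ← sum_div, ← mul_sum]; simp; ring
    _ ≤ ((∑ c ∈ range P, ((Ioc 0 ⌊X * g c⌋₊).filter (fun n => n % P = c % P)).card : ℕ) : ℝ) := by
       push_cast; exact sum_le_sum h2
    _ ≤ _ := by exact_mod_cast h1

/-- truncated divisor sum -/
noncomputable def fD (h : ℕ → ℝ) (D n : ℕ) : ℝ := ∑ d ∈ Ioc 0 D, if d ∣ n then h d else 0

lemma fD_mod (h : ℕ → ℝ) (D n : ℕ) : fD h D (n % D.factorial) = fD h D n := by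
  unfold fD
  refine sum_congr rfl fun d hd => ?_
  rw [mem_Ioc] at hd
  simp only [Nat.dvd_mod_iff (Nat.dvd_factorial hd.1 hd.2)]

lemma sum_ite_dvd (h : ℕ → ℝ) (s : Finset ℕ) (P : ℕ) : 
   ∑ n ∈ Ioc 0 P, (∑ d ∈ s, if d ∣ n then h d else 0) = ∑ d ∈ s, h d * ((P / d : ℕ) : ℝ) := by
  rw [sum_comm]
  refine sum_congr rfl fun d hd => ?_
  rw [← sum_filter, sum_const, Nat.Ioc_filter_dvd_card_eq_div, nsmul_eq_mul, mul_comm]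

lemma fD_mean (h : ℕ → ℝ) (D : ℕ) : 
   (∑ c ∈ range D.factorial, fD h D c) / (D.factorial : ℝ) = ∑ d ∈ Ioc 0 D, h d / d := by
  have h1 : ∑ c ∈ range D.factorial, fD h D c = ∑ c ∈ Ioc 0 D.factorial, fD h D c := by
    have e1 := sum_range_succ (fD h D) D.factorial
    have e2 := sum_range_succ' (fD h D) D.factorial
    have e3 : fD h D D.factorial = fD h D 0 := by
      rw [← fD_mod]; simp
    have e4 : ∑ c ∈ Ioc 0 D.factorial, fD h D c = ∑ c ∈ range D.factorial, fD h D (c+1) := by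
      rw [range_eq_Ico, sum_Ico_add' (fD h D) 0 D.factorial 1]; rfl
    linarith
  have hP : (0:ℝ) < D.factorial := by exact_mod_cast D.factorial_pos
  rw [h1]
  unfold fD
  rw [sum_ite_dvd, sum_div]
  refine sum_congr rfl fun d hd => ?_
  rw [mem_Ioc] at hd
  have : (0:ℝ) < d := by exact_mod_cast hd.1
  rw [Nat.cast_div (Nat.dvd_factorial hd.1 hd.2) this.ne']
  field_simp

lemma divsum_eq (h : ℕ → ℝ) (n K : ℕ) (hn : 1 ≤ n) (hK : n ≤ K) :
    ∑ d ∈ n.divisors, h d = fD h K n := by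
  unfold fD
  rw [← sum_filter]
  refine sum_congr ?_ fun _ _ => rfl
  ext d
  simp only [Nat.mem_divisors, mem_filter, mem_Ioc]
  constructor
  · rintro ⟨h1, h2⟩
    exact ⟨⟨Nat.pos_of_dvd_of_pos h1 hn, (Nat.le_of_dvd hn h1).trans hK⟩, h1⟩
  · rintro ⟨h1, h2⟩
    exact ⟨h2, by omega⟩

lemma fD_nonneg (h : ℕ → ℝ) (hh : ∀ d, 0 ≤ h d) (D n : ℕ) : 0 ≤ fD h D n :=
  sum_nonneg fun d _ => by split_ifs <;> simp [hh]

lemma fD_le (h : ℕ → ℝ) (hh : ∀ d, 0 ≤ h d) (D n : ℕ) (hn : 1 ≤ n) :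
    fD h D n ≤ ∑ d ∈ n.divisors, h d := by
  unfold fD
  rw [← sum_filter]
  refine sum_le_sum_of_subset_of_nonneg ?_ fun d _ _ => hh d
  intro d
  simp only [Nat.mem_divisors, mem_filter, mem_Ioc]
  rintro ⟨h1, h2⟩
  exact ⟨h2, by omega⟩

/-- first moment bound for the remainder -/
lemma rem_bound (h : ℕ → ℝ) (hh : ∀ d, 0 ≤ h d) (hs : Summable fun d : ℕ => h d / d) (D Y : ℕ) :
    ∑ n ∈ Ioc 0 Y, (∑ d ∈ n.divisors, h d - fD h D n) ≤
      Y * (∑' d : ℕ, h d / d - ∑ d ∈ Ioc 0 D, h d / d) := by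
  have h1 : ∀ n ∈ Ioc 0 Y, ∑ d ∈ n.divisors, h d - fD h D n ≤
      ∑ d ∈ Ioc D (max D Y), if d ∣ n then h d else 0 := by
    intro n hn
    rw [mem_Ioc] at hn
    rw [divsum_eq h n (max D Y) hn.1 (hn.2.trans (le_max_right _ _))]
    unfold fD
    rw [← sum_Ioc_consecutive _ (Nat.zero_le D) (le_max_left D Y)]
    linarith
  refine (sum_le_sum h1).trans ?_
  rw [sum_ite_dvd]
  have h2 : ∑ d ∈ Ioc D (max D Y), h d * ((Y / d : ℕ) : ℝ) ≤ Y * ∑ d ∈ Ioc D (max D Y), h d / d := by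
    rw [mul_sum]
    refine sum_le_sum fun d _ => ?_
    calc h d * ((Y / d : ℕ) : ℝ) ≤ h d * ((Y:ℝ) / d) :=
          mul_le_mul_of_nonneg_left Nat.cast_div_le (hh d)
      _ = _ := by ring
  refine h2.trans ?_
  gcongr
  have h3 : ∑ d ∈ Ioc 0 (max D Y), h d / d ≤ ∑' d : ℕ, h d / d :=
    hs.sum_le_tsum _ fun d _ => div_nonneg (hh d) (by positivity)
  rw [← sum_Ioc_consecutive _ (Nat.zero_le D) (le_max_left D Y)] at h3
  linarith

lemma lcm_bound (d e : ℕ) (hd : 1 ≤ d) (he : 1 ≤ e) : √(d:ℝ) * √(e:ℝ) ≤ (Nat.lcm d e : ℝ) := by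
  have h1 : d ≤ Nat.lcm d e := Nat.le_of_dvd (Nat.lcm_pos hd he) (Nat.dvd_lcm_left d e)
  have h2 : e ≤ Nat.lcm d e := Nat.le_of_dvd (Nat.lcm_pos hd he) (Nat.dvd_lcm_right d e)
  have h1' : √(d:ℝ) ≤ √(Nat.lcm d e : ℝ) := Real.sqrt_le_sqrt (by exact_mod_cast h1)
  have h2' : √(e:ℝ) ≤ √(Nat.lcm d e : ℝ) := Real.sqrt_le_sqrt (by exact_mod_cast h2)
  calc _ ≤ √(Nat.lcm d e : ℝ) * √(Nat.lcm d e : ℝ) := by gcongr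
    _ = _ := Real.mul_self_sqrt (by positivity)

/-- second moment tail bound -/
lemma second_moment (h : ℕ → ℝ) (hh : ∀ d, 0 ≤ h d) (hs : Summable fun d : ℕ => h d / √(d:ℝ))
    (Y K : ℕ) (hY : 1 ≤ Y) :
    ∑ n ∈ Ioc Y K, (∑ d ∈ n.divisors, h d) ^ 2 / (n:ℝ)^2 ≤
      2 / Y * (∑' d : ℕ, h d / √(d:ℝ)) ^ 2 := by
  have hYr : (1:ℝ) ≤ Y := by exact_mod_cast hY
  have h1 : ∀ n ∈ Ioc Y K, (∑ d ∈ n.divisors, h d) ^ 2 / (n:ℝ)^2 =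
      ∑ d ∈ Ioc 0 K, ∑ e ∈ Ioc 0 K, if Nat.lcm d e ∣ n then h d * h e * (1 / (n:ℝ)^2) else 0 := by
    intro n hn
    rw [mem_Ioc] at hn
    rw [divsum_eq h n K (by omega) hn.2]
    unfold fD
    rw [sq, sum_mul_sum, sum_div]
    refine sum_congr rfl fun d _ => ?_
    rw [sum_div]
    refine sum_congr rfl fun e _ => ?_
    simp only [Nat.lcm_dvd_iff]
    by_cases h1 : d ∣ n <;> by_cases h2 : e ∣ n <;> simp [h1, h2, div_eq_mul_inv]
  rw [sum_congr rfl h1, sum_comm]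
  have h2 : ∀ d ∈ Ioc 0 K, ∑ n ∈ Ioc Y K, ∑ e ∈ Ioc 0 K,
      (if Nat.lcm d e ∣ n then h d * h e * (1 / (n:ℝ)^2) else 0) ≤
      ∑ e ∈ Ioc 0 K, 2 / Y * ((h d / √(d:ℝ)) * (h e / √(e:ℝ))) := by
    intro d hd
    rw [sum_comm]
    refine sum_le_sum fun e he => ?_
    rw [mem_Ioc] at hd he
    have hd' : (0:ℝ) < d := by exact_mod_cast hd.1
    have he' : (0:ℝ) < e := by exact_mod_cast he.1
    rw [← sum_filter, ← mul_sum]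
    have t := tail_sq Y K (Nat.lcm d e) (Nat.lcm_pos hd.1 he.1) hY
    have l := lcm_bound d e hd.1 he.1
    have s1 : 0 < √(d:ℝ) := Real.sqrt_pos.2 hd'
    have s2 : 0 < √(e:ℝ) := Real.sqrt_pos.2 he'
    calc _ ≤ h d * h e * (2 / (Nat.lcm d e * Y)) :=
          mul_le_mul_of_nonneg_left t (mul_nonneg (hh d) (hh e))
      _ ≤ h d * h e * (2 / (√(d:ℝ) * √(e:ℝ) * Y)) := by
          have := mul_nonneg (hh d) (hh e)
          gcongr
      _ = _ := by field_simp
  refine (sum_le_sum h2).trans ?_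
  simp_rw [← mul_sum]
  rw [← sum_mul, sq]
  have h3 : ∑ d ∈ Ioc 0 K, h d / √(d:ℝ) ≤ ∑' d : ℕ, h d / √(d:ℝ) :=
    hs.sum_le_tsum _ fun d _ => div_nonneg (hh d) (by positivity)
  have h4 : 0 ≤ ∑ d ∈ Ioc 0 K, h d / √(d:ℝ) := sum_nonneg fun d _ => div_nonneg (hh d) (by positivity)
  gcongr
  exact h4.trans h3

/-- the counting theorem -/
theorem count_asymp (h : ℕ → ℝ) (hh : ∀ d, 0 ≤ h d) (hs : Summable fun d : ℕ => h d / √(d:ℝ))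
    (hs1 : Summable fun d : ℕ => h d / d)
    (K : ℕ → ℕ) (hK : ∀ X n : ℕ, 1 ≤ n → (n:ℝ) ≤ X * ∑ d ∈ n.divisors, h d → n ≤ K X) :
    Tendsto (fun X : ℕ => (((Ioc 0 (K X)).filter
      (fun n : ℕ => (n:ℝ) ≤ X * ∑ d ∈ n.divisors, h d)).card : ℝ) / X) atTop
      (nhds (∑' d : ℕ, h d / d)) := by
  set M := ∑' d : ℕ, h d / d with hM
  set C := (∑' d : ℕ, h d / √(d:ℝ)) ^ 2 with hC
  have hC0 : 0 ≤ C := sq_nonneg _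
  have htail : Tendsto (fun D : ℕ => ∑ d ∈ Ioc 0 D, h d / d) atTop (nhds M) := by
    have := hs1.hasSum.tendsto_sum_nat.comp (tendsto_add_atTop_nat 1)
    refine this.congr fun D => ?_
    simp only [Function.comp]
    rw [sum_range_succ', range_eq_Ico, sum_Ico_add' (fun d : ℕ => h d / (d:ℝ)) 0 D 1]
    simp; rfl
  rw [Metric.tendsto_atTop]
  intro ε' hε'
  set ε := ε' / 6 with hε
  have hε0 : 0 < ε := by positivity
  obtain ⟨T, hT⟩ := exists_nat_gt (2 * C / ε + 1)
  have hT1 : (1:ℝ) < T := by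
    have : 0 ≤ 2 * C / ε := by positivity
    linarith
  have hT2 : 2 * C / T ≤ ε := by
    rw [div_le_iff₀ (by linarith)]
    have : 2 * C / ε < T := by linarith
    rw [div_lt_iff₀ hε0] at this
    linarith
  have hη : 0 < ε * ε / T := by positivity
  obtain ⟨D, hD⟩ := (Metric.tendsto_atTop.1 htail) (min ε (ε * ε / T)) (lt_min hε0 hη)
  have hD := hD D le_rfl
  rw [Real.dist_eq, abs_lt] at hD
  have hDm : M - ε ≤ ∑ d ∈ Ioc 0 D, h d / d := by linarith [min_le_left ε (ε * ε / T)]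
  have hDt : M - ∑ d ∈ Ioc 0 D, h d / d ≤ ε * ε / T := by linarith [min_le_right ε (ε * ε / T)]
  have hDM : ∑ d ∈ Ioc 0 D, h d / d ≤ M :=
    hs1.sum_le_tsum _ fun d _ => div_nonneg (hh d) (by positivity)
  set P := D.factorial with hP
  have hP0 : 0 < P := D.factorial_pos
  have hP0' : (0:ℝ) < P := by exact_mod_cast hP0
  obtain ⟨X0, hX0⟩ := exists_nat_gt (2 * (P:ℝ) / ε)
  refine ⟨X0 + 1, fun X hX => ?_⟩
  have hX1 : 1 ≤ X := by omega
  have hXr : (0:ℝ) < X := by exact_mod_cast hX1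
  have hPX : 2 * (P:ℝ) ≤ ε * X := by
    rw [div_lt_iff₀ hε0] at hX0
    have : (X0:ℝ) ≤ X := by exact_mod_cast (by omega : X0 ≤ X)
    nlinarith
  set A := (Ioc 0 (K X)).filter (fun n : ℕ => (n:ℝ) ≤ X * ∑ d ∈ n.divisors, h d) with hA
  -- lower bound
  have hlow : X * (M - 2 * ε) ≤ (A.card : ℝ) := by
    have l1 := per_lower (fD h D) P hP0 (fD_mod h D) (fD_nonneg h hh D) X (K X)
      (fun n hn hle => hK X n hn (hle.trans (mul_le_mul_of_nonneg_left (fD_le h hh D n hn) hXr.le)))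
    rw [fD_mean] at l1
    have l2 : ((Ioc 0 (K X)).filter (fun n : ℕ => (n : ℝ) ≤ X * fD h D n)).card ≤ A.card := by
      refine card_le_card fun n hn => ?_
      simp only [hA, mem_filter, mem_Ioc] at hn ⊢
      exact ⟨hn.1, hn.2.trans (mul_le_mul_of_nonneg_left (fD_le h hh D n hn.1.1) hXr.le)⟩
    have l3 : (((Ioc 0 (K X)).filter (fun n : ℕ => (n : ℝ) ≤ X * fD h D n)).card : ℝ) ≤ A.card := by
      exact_mod_cast l2
    nlinarith
  -- upper bound
  have hup : (A.card : ℝ) ≤ X * (M + 4 * ε) := by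
    set A1 := (Ioc 0 (K X)).filter (fun n : ℕ => (n : ℝ) ≤ X * (fD h D n + ε)) with hA1
    set A2 := (Ioc 0 (T * X)).filter (fun n : ℕ => ε ≤ ∑ d ∈ n.divisors, h d - fD h D n) with hA2
    set A3 := (Ioc (T * X) (K X)).filter (fun n : ℕ => (n:ℝ) ≤ X * ∑ d ∈ n.divisors, h d) with hA3
    have hsub : A ⊆ A1 ∪ (A2 ∪ A3) := by
      intro n hn
      simp only [hA, hA1, hA2, hA3, mem_union, mem_filter, mem_Ioc] at hn ⊢
      obtain ⟨⟨h1, h2⟩, h3⟩ := hn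
      by_cases c1 : n ≤ T * X
      · by_cases c2 : ε ≤ ∑ d ∈ n.divisors, h d - fD h D n
        · exact Or.inr (Or.inl ⟨⟨h1, c1⟩, c2⟩)
        · refine Or.inl ⟨⟨h1, h2⟩, h3.trans (mul_le_mul_of_nonneg_left ?_ hXr.le)⟩
          linarith
      · exact Or.inr (Or.inr ⟨⟨by omega, h2⟩, h3⟩)
    have hcard : (A.card : ℝ) ≤ A1.card + (A2.card + A3.card) := by
      exact_mod_cast (card_le_card hsub).trans ((card_union_le _ _).trans
        (Nat.add_le_add_left (card_union_le _ _) _))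
    have u1 : (A1.card : ℝ) ≤ X * (M + ε) + P := by
      have := per_upper (fun n => fD h D n + ε) P hP0 (fun n => by simp only [hP, fD_mod])
        (fun n => add_nonneg (fD_nonneg h hh D n) hε0.le) X (K X)
      refine this.trans ?_
      rw [sum_add_distrib, add_div, fD_mean]
      have e : (∑ c ∈ range P, ε) / (P:ℝ) = ε := by
        rw [sum_const, card_range, nsmul_eq_mul]; field_simp
      rw [e]
      gcongr
    have u2 : (A2.card : ℝ) ≤ X * ε := by
      have r := rem_bound h hh hs1 D (T * X)
      have r2 : ε * A2.card ≤ ∑ n ∈ Ioc 0 (T * X), (∑ d ∈ n.divisors, h d - fD h D n) := by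
        calc ε * A2.card = ∑ n ∈ A2, ε := by rw [sum_const, nsmul_eq_mul, mul_comm]
          _ ≤ ∑ n ∈ A2, (∑ d ∈ n.divisors, h d - fD h D n) :=
              sum_le_sum fun n hn => (mem_filter.1 hn).2
          _ ≤ _ := sum_le_sum_of_subset_of_nonneg (filter_subset _ _) fun n hn _ =>
              sub_nonneg.2 (fD_le h hh D n (mem_Ioc.1 hn).1)
      have r3 : ε * A2.card ≤ (T * X : ℝ) * (ε * ε / T) := by
        refine r2.trans (r.trans ?_)
        push_cast
        gcongr
      have r4 : (T * X : ℝ) * (ε * ε / T) = ε * (X * ε) := by field_simp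
      rw [r4] at r3
      exact le_of_mul_le_mul_left r3 hε0
    have u3 : (A3.card : ℝ) ≤ X * ε := by
      have hTX : 1 ≤ T * X := by
        have : 1 < T := by exact_mod_cast hT1
        nlinarith
      have r := second_moment h hh hs (T * X) (K X) hTX
      have r2 : (A3.card : ℝ) ≤ (X:ℝ)^2 *
          ∑ n ∈ Ioc (T * X) (K X), (∑ d ∈ n.divisors, h d) ^ 2 / (n:ℝ)^2 := by
        rw [mul_sum]
        calc (A3.card : ℝ) = ∑ n ∈ A3, (1:ℝ) := by simp
          _ ≤ ∑ n ∈ A3, (X:ℝ)^2 * ((∑ d ∈ n.divisors, h d) ^ 2 / (n:ℝ)^2) := by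
              refine sum_le_sum fun n hn => ?_
              simp only [hA3, mem_filter, mem_Ioc] at hn
              have hn0 : (0:ℝ) < n := by exact_mod_cast (by omega : 0 < n)
              rw [← mul_div_assoc, le_div_iff₀ (by positivity), one_mul, ← mul_pow]
              exact pow_le_pow_left₀ hn0.le hn.2 2
          _ ≤ _ := sum_le_sum_of_subset_of_nonneg (filter_subset _ _) fun n hn _ => by positivity
      calc (A3.card : ℝ) ≤ (X:ℝ)^2 * (2 / ((T * X : ℕ):ℝ) * C) := by
            refine r2.trans ?_
            gcongr
        _ = X * (2 * C / T) := by push_cast; field_simp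
        _ ≤ _ := by gcongr
    nlinarith
  rw [Real.dist_eq, abs_lt]
  constructor
  · have : M - 2 * ε ≤ A.card / (X:ℝ) := by rw [le_div_iff₀ hXr]; linarith
    linarith
  · have : A.card / (X:ℝ) ≤ M + 4 * ε := by rw [div_le_iff₀ hXr]; linarith
    linarith

/-- auxiliary constant for the totient lower bound -/
def cTot (n : ℕ) : ℕ := (if 2 ∣ n then 8 else 1) * (if 3 ∣ n then 2 else 1)

lemma cTot_mul (a b : ℕ) (h : a.Coprime b) : cTot (a * b) = cTot a * cTot b := by
  unfold cTot
  have h2 : ¬ (2 ∣ a ∧ 2 ∣ b) := fun ⟨x, y⟩ => by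
    have := Nat.dvd_gcd x y; rw [h] at this; omega
  have h3 : ¬ (3 ∣ a ∧ 3 ∣ b) := fun ⟨x, y⟩ => by
    have := Nat.dvd_gcd x y; rw [h] at this; omega
  simp only [Nat.prime_two.dvd_mul, Nat.prime_three.dvd_mul]
  by_cases x : 2 ∣ a <;> by_cases y : 2 ∣ b <;> by_cases z : 3 ∣ a <;> by_cases w : 3 ∣ b <;>
    simp only [x, y, z, w, and_self, not_true_eq_false] at h2 h3 <;> simp [x, y, z, w, -Nat.two_dvd_ne_zero]

lemma totient_bound' (n : ℕ) : n ^ 3 ≤ cTot n * n.totient ^ 4 := by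
  induction n using Nat.recOnPosPrimePosCoprime with
  | zero => simp
  | one => simp [cTot]
  | prime_pow r k hr hk =>
    obtain ⟨j, rfl⟩ : ∃ j, k = j + 1 := ⟨k - 1, by omega⟩
    rw [Nat.totient_prime_pow hr hk, Nat.add_sub_cancel]
    have key : r ^ 3 ≤ cTot (r ^ (j+1)) * (r - 1) ^ 4 := by
      have d2 : 2 ∣ r ^ (j+1) ↔ 2 = r :=
        ⟨fun h => (Nat.prime_dvd_prime_iff_eq Nat.prime_two hr).1 (Nat.prime_two.dvd_of_dvd_pow h),
         fun h => h ▸ dvd_pow_self _ (by omega)⟩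
      have d3 : 3 ∣ r ^ (j+1) ↔ 3 = r :=
        ⟨fun h => (Nat.prime_dvd_prime_iff_eq Nat.prime_three hr).1 (Nat.prime_three.dvd_of_dvd_pow h),
         fun h => h ▸ dvd_pow_self _ (by omega)⟩
      unfold cTot
      simp only [d2, d3]
      by_cases e2 : 2 = r
      · subst e2; norm_num
      by_cases e3 : 3 = r
      · subst e3; norm_num
      simp only [e2, e3, if_false, one_mul]
      have := hr.two_le
      have h4 : 4 ≤ r := by omega
      have : r ≠ 4 := by rintro rfl; revert hr; decide
      obtain ⟨m, rfl⟩ : ∃ m, r = m + 5 := ⟨r - 5, by omega⟩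
      have : m + 5 - 1 = m + 4 := by omega
      rw [this]
      nlinarith [Nat.zero_le m, Nat.zero_le (m^2), Nat.zero_le (m^3), Nat.zero_le (m^4)]
    have hr1 := hr.one_lt
    calc (r ^ (j+1)) ^ 3 = (r ^ j) ^ 3 * r ^ 3 := by ring
      _ ≤ (r ^ j) ^ 4 * (cTot (r ^ (j+1)) * (r - 1) ^ 4) :=
          Nat.mul_le_mul (Nat.pow_le_pow_right (Nat.pow_pos (by omega)) (by omega)) key
      _ = _ := by ring
  | coprime a b ha hb hab iha ihb =>
    rw [cTot_mul a b hab, Nat.totient_mul hab]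
    calc (a * b) ^ 3 = a ^ 3 * b ^ 3 := by ring
      _ ≤ _ := Nat.mul_le_mul iha ihb
      _ = _ := by ring

lemma totient_bound (n : ℕ) : n ^ 3 ≤ 16 * n.totient ^ 4 := by
  refine (totient_bound' n).trans (Nat.mul_le_mul_right _ ?_)
  unfold cTot; split_ifs <;> norm_num

/-- `μ²(d)/φ(d)` restricted to `d` coprime to `p` -/
noncomputable def hq (p d : ℕ) : ℝ := by
  classical exact if Squarefree d ∧ Nat.Coprime p d then 1 / (d.totient : ℝ) else 0

lemma hq_nonneg (p d : ℕ) : 0 ≤ hq p d := by unfold hq; split_ifs <;> positivity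

lemma hq_zero (p : ℕ) : hq p 0 = 0 := by simp [hq]

lemma hq_one (p : ℕ) : hq p 1 = 1 := by simp [hq]

lemma hq_mul (p m n : ℕ) (h : m.Coprime n) : hq p (m * n) = hq p m * hq p n := by
  unfold hq
  simp only [Nat.squarefree_mul h, Nat.coprime_mul_iff_right, Nat.totient_mul h]
  push_cast
  by_cases a : Squarefree m ∧ p.Coprime m
  · by_cases b : Squarefree n ∧ p.Coprime n
    · rw [if_pos a, if_pos b, if_pos ⟨⟨a.1, b.1⟩, a.2, b.2⟩, one_div_mul_one_div]
    · rw [if_neg b, mul_zero, if_neg (fun t => b ⟨t.1.2, t.2.2⟩)]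
  · rw [if_neg a, zero_mul, if_neg (fun t => a ⟨t.1.1, t.2.1⟩)]

lemma hq_pow (p r e : ℕ) (hr : r.Prime) (he : 2 ≤ e) : hq p (r ^ e) = 0 := by
  unfold hq
  rw [if_neg]
  rintro ⟨h, -⟩
  rw [Nat.squarefree_pow_iff hr.one_lt.ne' (by omega)] at h
  omega

lemma hq_prime (p r : ℕ) (hr : r.Prime) :
    hq p r = if Nat.Coprime p r then 1 / ((r:ℝ) - 1) else 0 := by
  unfold hq
  simp only [hr.squarefree, true_and, Nat.totient_prime hr, Nat.cast_sub hr.one_lt.le, Nat.cast_one]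

lemma hq_le (p d : ℕ) : hq p d / √(d:ℝ) ≤ 2 * (1 / (d:ℝ) ^ ((5:ℝ)/4)) := by
  rcases Nat.eq_zero_or_pos d with rfl | hd
  · simp [hq_zero]
  have hd' : (0:ℝ) < d := by exact_mod_cast hd
  have ht : (0:ℝ) < d.totient := by exact_mod_cast Nat.totient_pos.2 hd
  have h1 : hq p d ≤ 1 / (d.totient : ℝ) := by
    unfold hq; split_ifs
    · exact le_rfl
    · positivity
  have h2 : (d:ℝ) ^ ((3:ℝ)/4) ≤ 2 * d.totient := by
    have b : (d:ℝ)^3 ≤ 16 * (d.totient:ℝ)^4 := by exact_mod_cast totient_bound d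
    refine le_of_pow_le_pow_left₀ (n := 4) (by norm_num) (by positivity) ?_
    rw [← Real.rpow_natCast, ← Real.rpow_mul hd'.le]
    norm_num
    calc (d:ℝ)^3 ≤ _ := b
      _ = _ := by ring
  rw [div_le_iff₀ (Real.sqrt_pos.2 hd'), Real.sqrt_eq_rpow]
  refine h1.trans ?_
  have e : 2 * (1 / (d:ℝ) ^ ((5:ℝ)/4)) * (d:ℝ) ^ ((1:ℝ)/2) = 2 / (d:ℝ) ^ ((3:ℝ)/4) := by
    have : (d:ℝ) ^ ((5:ℝ)/4) = (d:ℝ) ^ ((3:ℝ)/4) * (d:ℝ) ^ ((1:ℝ)/2) := by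
      rw [← Real.rpow_add hd']; norm_num
    rw [this]; field_simp
  rw [e, div_le_div_iff₀ ht (by positivity)]
  linarith

lemma hq_summable (p : ℕ) : Summable fun d : ℕ => hq p d / √(d:ℝ) := by
  refine Summable.of_nonneg_of_le (fun d => div_nonneg (hq_nonneg p d) (by positivity)) (hq_le p) ?_
  exact (Real.summable_one_div_nat_rpow.2 (by norm_num)).mul_left 2

lemma hq_summable1 (p : ℕ) : Summable fun d : ℕ => hq p d / d := by
  refine Summable.of_nonneg_of_le (fun d => div_nonneg (hq_nonneg p d) (by positivity))
    (fun d => ?_) (hq_summable p)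
  rcases Nat.eq_zero_or_pos d with rfl | hd
  · simp
  have hd' : (1:ℝ) ≤ d := by exact_mod_cast hd
  have : √(d:ℝ) ≤ d := Real.sqrt_le_iff.2 ⟨by positivity, by nlinarith⟩
  have := Real.sqrt_pos.2 (by linarith : (0:ℝ) < d)
  have := hq_nonneg p d
  gcongr

lemma hq_hasProd (p : ℕ) : HasProd (fun r : Nat.Primes =>
    1 + if Nat.Coprime p r then 1 / ((r:ℝ) * ((r:ℝ) - 1)) else 0) (∑' d : ℕ, hq p d / d) := by
  have := EulerProduct.eulerProduct_hasProd (f := fun d : ℕ => hq p d / (d:ℝ)) (by simp [hq_one])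
    (fun {m n} h => by simp only [hq_mul p m n h]; push_cast; rw [mul_div_mul_comm])
    (by simpa only [Real.norm_of_nonneg (div_nonneg (hq_nonneg p _) (Nat.cast_nonneg _))] using hq_summable1 p)
    (by simp)
  suffices e : (fun r : Nat.Primes => 1 + if Nat.Coprime p r then 1 / ((r:ℝ) * ((r:ℝ) - 1)) else 0) =
      fun r : Nat.Primes => ∑' e : ℕ, hq p ((r:ℕ) ^ e) / (((r:ℕ) ^ e : ℕ) : ℝ) by
    rw [e]; exact this
  funext r
  rw [tsum_eq_sum (s := range 2)]
  · rw [sum_range_succ, sum_range_one]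
    simp only [pow_zero, pow_one, hq_one, hq_prime p r r.2]
    split_ifs
    · rw [div_div, mul_comm]; simp
    · simp
  · intro e he
    rw [mem_range, not_lt] at he
    rw [hq_pow p r e r.2 he, zero_div]

lemma zetaR_hasProd (s : ℕ) (hs : 2 ≤ s) :
    HasProd (fun r : Nat.Primes => (1 - ((r:ℝ) ^ s)⁻¹)⁻¹) (zetaR s) := by
  let f : ℕ →*₀ ℝ :=
    { toFun := fun n => ((n:ℝ) ^ s)⁻¹
      map_zero' := by simp; omega
      map_one' := by simp
      map_mul' := fun a b => by push_cast; rw [mul_pow, mul_inv] }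
  have hf : ∀ n, f n = ((n:ℝ) ^ s)⁻¹ := fun _ => rfl
  have hsum : Summable fun n => f n := by
    simp only [hf]; exact Real.summable_nat_pow_inv.2 (by omega)
  have := EulerProduct.eulerProduct_completely_multiplicative_hasProd (f := f) hsum.norm
  have e : zetaR s = ∑' n, f n := by
    rw [hsum.tsum_eq_zero_add, map_zero, zero_add]
    unfold zetaR
    simp [hf]
  rw [e]
  exact this

lemma zetaR_pos (s : ℕ) (hs : 2 ≤ s) : 0 < zetaR s := by
  have hsum : Summable fun n : ℕ => 1 / ((n:ℝ) + 1) ^ s := by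
    have := (summable_nat_add_iff 1).2 (Real.summable_one_div_nat_pow.2 (by omega : 1 < s))
    simpa using this
  exact hsum.tsum_pos (fun n => by positivity) 0 (by simp)

lemma zeta_id : zetaR 6 * ∑' d : ℕ, hq 1 d / d = zetaR 2 * zetaR 3 := by
  have h1 := (zetaR_hasProd 6 (by norm_num)).mul (hq_hasProd 1)
  have h2 := (zetaR_hasProd 2 (by norm_num)).mul (zetaR_hasProd 3 (by norm_num))
  refine HasProd.unique h1 (Eq.subst (motive := fun f => HasProd f _) (funext fun r => ?_) h2)
  symm
  have hr : (2:ℝ) ≤ (r:ℝ) := by exact_mod_cast r.2.two_le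
  set x : ℝ := (r:ℝ)
  have a6 : 1 - (x^6)⁻¹ = (x^3-1)*(x+1)*(x^2-x+1)/x^6 := by field_simp; ring
  have a2 : 1 - (x^2)⁻¹ = (x-1)*(x+1)/x^2 := by field_simp; ring
  have a3 : 1 - (x^3)⁻¹ = (x^3-1)/x^3 := by field_simp
  have n1 : x - 1 ≠ 0 := by linarith
  have n2 : x + 1 ≠ 0 := by linarith
  have n3 : x^3 - 1 ≠ 0 := by nlinarith [sq_nonneg x]
  have n4 : x^2 - x + 1 ≠ 0 := by nlinarith
  have n5 : x ≠ 0 := by linarith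
  rw [a6, a2, a3]
  rw [if_pos (Nat.coprime_one_left _)]
  have a1 : 1 + 1 / (x * (x - 1)) = (x^2-x+1) / (x * (x - 1)) := by field_simp
  rw [a1]
  generalize x^2 - x + 1 = w at *
  generalize x^3 - 1 = v at *
  field_simp

lemma remove_p (p : ℕ) (hp : p.Prime) :
    ∑' d : ℕ, hq 1 d / d = (1 + 1 / ((p:ℝ) * ((p:ℝ) - 1))) * ∑' d : ℕ, hq p d / d := by
  have h1 := hq_hasProd 1
  have h0 : HasProd (fun r : Nat.Primes => if (r:ℕ) = p then 1 + 1 / ((p:ℝ) * ((p:ℝ) - 1)) else 1)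
      (1 + 1 / ((p:ℝ) * ((p:ℝ) - 1))) := by
    have := hasProd_single (f := fun r : Nat.Primes =>
      if (r:ℕ) = p then 1 + 1 / ((p:ℝ) * ((p:ℝ) - 1)) else 1) (⟨p, hp⟩ : Nat.Primes)
      (fun r hr => if_neg fun h => hr (Subtype.ext h))
    simpa using this
  have key : ∀ r : ℕ, r.Prime →
      (if r = p then 1 + 1 / ((p:ℝ) * ((p:ℝ) - 1)) else 1) *
        (1 + if Nat.Coprime p r then 1 / ((r:ℝ) * ((r:ℝ) - 1)) else 0) =
      1 + if Nat.Coprime 1 r then 1 / ((r:ℝ) * ((r:ℝ) - 1)) else 0 := by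
    intro r hr
    rw [if_pos (Nat.coprime_one_left r)]
    by_cases e : r = p
    · subst e
      simp [hp.ne_one]
    · have : Nat.Coprime p r := (Nat.coprime_primes hp hr).2 fun h => e h.symm
      rw [if_neg e, if_pos this, one_mul]
  exact HasProd.unique h1 (Eq.subst (motive := fun f => HasProd f _)
    (funext fun r => key r r.2) (h0.mul (hq_hasProd p)))

lemma divsum_mul (p m n : ℕ) (h : m.Coprime n) :
    ∑ d ∈ (m * n).divisors, hq p d = (∑ d ∈ m.divisors, hq p d) * ∑ d ∈ n.divisors, hq p d := by
  let F : ArithmeticFunction ℝ := ⟨hq p, hq_zero p⟩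
  have hF : F.IsMultiplicative := ⟨hq_one p, fun {a b} hab => hq_mul p a b hab⟩
  have hz := hF.mul (ArithmeticFunction.isMultiplicative_zeta.natCast (R := ℝ))
  have := hz.map_mul_of_coprime h
  rw [ArithmeticFunction.coe_mul_zeta_apply, ArithmeticFunction.coe_mul_zeta_apply,
    ArithmeticFunction.coe_mul_zeta_apply] at this
  exact this

lemma divsum_formula (p l : ℕ) (hp : p.Prime) (hl : 1 ≤ l) (b : ℕ) (hb : 1 ≤ b) :
    ((p ^ l * b).totient : ℝ) * ∑ d ∈ b.divisors, hq p d = b * ((p ^ l).totient : ℝ) := by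
  induction b using Nat.recOnPosPrimePosCoprime with
  | zero => omega
  | one => simp [hq_one]
  | prime_pow r k hr hk =>
    have hr1 : (1:ℝ) < r := by exact_mod_cast hr.one_lt
    have hsum : ∑ d ∈ (r ^ k).divisors, hq p d = 1 + hq p r := by
      rw [Nat.sum_divisors_prime_pow hr]
      have : range 2 ⊆ range (k + 1) := range_subset_range.2 (by omega)
      rw [← sum_subset this, sum_range_succ, sum_range_one, pow_zero, pow_one, hq_one]
      intro e _ he
      exact hq_pow p r e hr (by rw [mem_range, not_lt] at he; exact he)
    rw [hsum, hq_prime p r hr]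
    by_cases e : p = r
    · subst e
      rw [if_neg (by simp [hp.ne_one]), ← pow_add, Nat.totient_prime_pow hp (by omega),
        Nat.totient_prime_pow hp (by omega)]
      have : l + k - 1 = (l - 1) + k := by omega
      rw [this]; push_cast; ring
    · have hc : Nat.Coprime p r := (Nat.coprime_primes hp hr).2 e
      rw [if_pos hc, Nat.totient_mul (hc.pow l k), Nat.totient_prime_pow hr hk]
      obtain ⟨j, rfl⟩ : ∃ j, k = j + 1 := ⟨k - 1, by omega⟩
      rw [Nat.add_sub_cancel]
      push_cast [Nat.cast_sub hr.one_lt.le]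
      have : (r:ℝ) - 1 ≠ 0 := by linarith
      field_simp
      ring
  | coprime m n hm hn hmn ihm ihn =>
    have ihm := ihm hm.le
    have ihn := ihn hn.le
    rw [divsum_mul p m n hmn]
    have hq0 : (0:ℝ) < (p ^ l).totient := by
      exact_mod_cast Nat.totient_pos.2 (Nat.pow_pos hp.pos)
    have key : ((p ^ l * (m * n)).totient : ℝ) * (p ^ l).totient =
        (p ^ l * m).totient * (p ^ l * n).totient := by
      by_cases e : p ∣ m
      · have hpn : Nat.Coprime p n := Nat.Coprime.coprime_dvd_left e hmn
        have c1 : Nat.Coprime (p ^ l) n := hpn.pow_left l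
        rw [← mul_assoc, Nat.totient_mul (Nat.Coprime.mul_left c1 hmn), Nat.totient_mul c1]
        push_cast; ring
      · have hpn : Nat.Coprime p m := (Nat.Prime.coprime_iff_not_dvd hp).2 e
        have c1 : Nat.Coprime (p ^ l) m := hpn.pow_left l
        rw [mul_comm m n, ← mul_assoc, Nat.totient_mul (Nat.Coprime.mul_left c1 hmn.symm),
          Nat.totient_mul c1]
        push_cast; ring
    refine mul_right_cancel₀ hq0.ne' ?_
    calc _ = ((p ^ l * (m * n)).totient : ℝ) * (p ^ l).totient *
          ((∑ d ∈ m.divisors, hq p d) * ∑ d ∈ n.divisors, hq p d) := by ring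
      _ = (((p ^ l * m).totient : ℝ) * ∑ d ∈ m.divisors, hq p d) *
          (((p ^ l * n).totient : ℝ) * ∑ d ∈ n.divisors, hq p d) := by rw [key]; ring
      _ = _ := by rw [ihm, ihn]; push_cast; ring

lemma ellp_pos (p : ℕ) : 1 ≤ ellp p := by unfold ellp; split_ifs <;> norm_num

/-- the constant -/
lemma const_eq (p : ℕ) (hp : p.Prime) :
    ∑' d : ℕ, (hq p d / ((p ^ ellp p).totient : ℝ)) / d = ap p := by
  have hl := ellp_pos p
  have hp1 : (1:ℝ) < p := by exact_mod_cast hp.one_lt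
  have e1 : ∀ d : ℕ, (hq p d / ((p ^ ellp p).totient : ℝ)) / d =
      (hq p d / d) / ((p ^ ellp p).totient : ℝ) := fun d => by rw [div_right_comm]
  simp_rw [e1]
  rw [tsum_div_const]
  have h6 := zetaR_pos 6 (by norm_num)
  have z := zeta_id
  rw [remove_p p hp] at z
  set S := ∑' d : ℕ, hq p d / d with hS
  unfold ap
  rw [← z, Nat.totient_prime_pow hp hl]
  obtain ⟨j, hj⟩ : ∃ j, ellp p = j + 1 := ⟨ellp p - 1, by omega⟩
  rw [hj]
  have hz : (p:ℝ) ^ (((j + 1 : ℕ) : ℤ) - 2) = (p:ℝ) ^ j / p := by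
    have : (((j + 1 : ℕ) : ℤ) - 2) = (j : ℤ) - 1 := by push_cast; ring
    rw [this, zpow_sub_one₀ (by linarith), zpow_natCast, div_eq_mul_inv]
  rw [hz, Nat.add_sub_cancel]
  push_cast [Nat.cast_sub hp.one_lt.le]
  have n1 : (p:ℝ) - 1 ≠ 0 := by linarith
  have n3 : (p:ℝ) ≠ 0 := by linarith
  have e2 : 1 + 1 / ((p:ℝ) * ((p:ℝ) - 1)) = ((p:ℝ)^2 - p + 1) / ((p:ℝ) * ((p:ℝ) - 1)) := by
    field_simp
  have n2 : (p:ℝ)^2 - p + 1 ≠ 0 := by nlinarith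
  rw [e2]
  generalize (p:ℝ)^2 - p + 1 = w at *
  field_simp

/-- the set `Ψ_n` for natural `n`, as a finset -/
def Psi (p n : ℕ) : Finset ℕ :=
  (Ioc 0 (16 * n ^ 4)).filter fun b => (p ^ ellp p * b).totient ≤ n

lemma mem_Psi (p n b : ℕ) (hp : p.Prime) :
    b ∈ Psi p n ↔ 1 ≤ b ∧ (p ^ ellp p * b).totient ≤ n := by
  unfold Psi
  simp only [mem_filter, mem_Ioc]
  refine ⟨fun h => ⟨h.1.1, h.2⟩, fun h => ⟨⟨h.1, ?_⟩, h.2⟩⟩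
  have h1 : 1 ≤ p ^ ellp p := Nat.pow_pos hp.pos
  calc b ≤ b ^ 3 := Nat.le_self_pow (by norm_num) b
    _ ≤ (p ^ ellp p * b) ^ 3 := Nat.pow_le_pow_left (Nat.le_mul_of_pos_left b h1) 3
    _ ≤ _ := totient_bound _
    _ ≤ _ := by gcongr; exact h.2

lemma Psi_card (p : ℕ) (hp : p.Prime) :
    Tendsto (fun n : ℕ => ((Psi p n).card : ℝ) / n) atTop (nhds (ap p)) := by
  have hq0 : (0:ℝ) < (p ^ ellp p).totient := by
    exact_mod_cast Nat.totient_pos.2 (Nat.pow_pos hp.pos)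
  have iff1 : ∀ X b : ℕ, 1 ≤ b →
      ((b:ℝ) ≤ X * ∑ d ∈ b.divisors, hq p d / ((p ^ ellp p).totient : ℝ) ↔
        (p ^ ellp p * b).totient ≤ X) := by
    intro X b hb
    have f := divsum_formula p (ellp p) hp (ellp_pos p) b hb
    have ht : (0:ℝ) < (p ^ ellp p * b).totient := by
      exact_mod_cast Nat.totient_pos.2 (Nat.mul_pos (Nat.pow_pos hp.pos) hb)
    have hb' : (0:ℝ) < b := by exact_mod_cast hb
    rw [← sum_div]
    have e : (∑ d ∈ b.divisors, hq p d) / ((p ^ ellp p).totient : ℝ) =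
        b / ((p ^ ellp p * b).totient : ℝ) := by
      rw [div_eq_div_iff hq0.ne' ht.ne']; linarith
    rw [e, ← mul_div_assoc, le_div_iff₀ ht, mul_comm (X:ℝ), mul_le_mul_iff_right₀ hb']
    exact Nat.cast_le
  have := count_asymp (fun d => hq p d / ((p ^ ellp p).totient : ℝ))
    (fun d => div_nonneg (hq_nonneg p d) hq0.le)
    (by
      refine ((hq_summable p).div_const ((p ^ ellp p).totient : ℝ)).congr fun d => ?_
      rw [div_right_comm])
    (by
      refine ((hq_summable1 p).div_const ((p ^ ellp p).totient : ℝ)).congr fun d => ?_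
      rw [div_right_comm])
    (fun n => 16 * n ^ 4)
    (fun X n hn hle => by
      have := (mem_Psi p X n hp).2 ⟨hn, (iff1 X n hn).1 hle⟩
      exact (mem_Ioc.1 (mem_filter.1 this).1).2)
  rw [const_eq p hp] at this
  refine this.congr fun X => ?_
  congr 3
  unfold Psi
  refine filter_congr fun b hb => iff1 X b (mem_Ioc.1 hb).1

lemma Psi_sum (p n : ℕ) (hp : p.Prime) :
    ∑ b ∈ Psi p n, (p ^ ellp p * b).totient + ∑ k ∈ range n, (Psi p k).card = n * (Psi p n).card := by
  have h1 : ∑ k ∈ range n, (Psi p k).card =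
      ∑ b ∈ Psi p n, ((range n).filter fun k => (p ^ ellp p * b).totient ≤ k).card := by
    have e : ∀ k ∈ range n, (Psi p k).card =
        ((Psi p n).filter fun b => (p ^ ellp p * b).totient ≤ k).card := by
      intro k hk
      rw [mem_range] at hk
      congr 1
      ext b
      rw [mem_filter, mem_Psi p _ _ hp, mem_Psi p _ _ hp]
      constructor
      · rintro ⟨x, y⟩; exact ⟨⟨x, by omega⟩, y⟩
      · rintro ⟨⟨x, y⟩, z⟩; exact ⟨x, z⟩
    rw [sum_congr rfl e]
    simp_rw [card_filter]
    exact sum_comm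
  rw [h1, ← sum_add_distrib, mul_comm, ← smul_eq_mul, ← sum_const]
  refine sum_congr rfl fun b hb => ?_
  have hb2 := ((mem_Psi p n b hp).1 hb).2
  have : (range n).filter (fun k => (p ^ ellp p * b).totient ≤ k) =
      Ico (p ^ ellp p * b).totient n := by
    ext k; simp only [mem_filter, mem_range, mem_Ico]; tauto
  rw [this, Nat.card_Ico]
  omega

lemma sum_asymp (N : ℕ → ℝ) (a : ℝ) (hN : Tendsto (fun n : ℕ => N n / n) atTop (nhds a)) :
    Tendsto (fun n : ℕ => (n * N n - ∑ k ∈ range n, N k) / (n:ℝ)^2) atTop (nhds (a / 2)) := by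
  have hlo : (fun n : ℕ => N n - a * n) =o[atTop] (fun n : ℕ => (n:ℝ)) := by
    rw [Asymptotics.isLittleO_iff_tendsto']
    · have : Tendsto (fun n : ℕ => N n / n - a) atTop (nhds (a - a)) := hN.sub_const a
      rw [sub_self] at this
      refine this.congr' ?_
      filter_upwards [eventually_gt_atTop 0] with n hn
      have : (0:ℝ) < n := by exact_mod_cast hn
      field_simp
    · filter_upwards [eventually_gt_atTop 0] with n hn h
      have : (0:ℝ) < n := by exact_mod_cast hn
      linarith
  have hg : ∀ n : ℕ, ∑ k ∈ range n, (k:ℝ) = (n:ℝ) * (n - 1) / 2 := by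
    intro n
    induction n with
    | zero => simp
    | succ n ih => rw [sum_range_succ, ih]; push_cast; ring
  have hinv : Tendsto (fun n : ℕ => (n:ℝ)⁻¹) atTop (nhds 0) :=
    tendsto_inv_atTop_zero.comp tendsto_natCast_atTop_atTop
  have hgt : Tendsto (fun n : ℕ => ∑ k ∈ range n, (k:ℝ)) atTop atTop := by
    refine tendsto_atTop_mono' _ (f₁ := fun n : ℕ => (n:ℝ) / 2 - 1) ?_ ?_
    · filter_upwards [eventually_ge_atTop 2] with n hn
      have : (2:ℝ) ≤ n := by exact_mod_cast hn
      rw [hg]; nlinarith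
    · exact tendsto_atTop_add_const_right _ _
        (tendsto_natCast_atTop_atTop.atTop_div_const (by norm_num))
  have hs := hlo.sum_range (fun n => by positivity) hgt
  have hs2 : (fun n : ℕ => ∑ k ∈ range n, (N k - a * k)) =o[atTop] (fun n : ℕ => (n:ℝ)^2) := by
    refine hs.trans_le fun n => ?_
    rw [hg, Real.norm_eq_abs, Real.norm_eq_abs, abs_of_nonneg (sq_nonneg (n:ℝ)), abs_le]
    have : (0:ℝ) ≤ n := by positivity
    constructor <;> nlinarith [sq_nonneg ((n:ℝ) - 1), hg n, sum_nonneg (fun k (_ : k ∈ range n) => (Nat.cast_nonneg k : (0:ℝ) ≤ k))]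
  have h3 := hs2.tendsto_div_nhds_zero
  have h4 : Tendsto (fun n : ℕ => N n / n - (∑ k ∈ range n, (N k - a * k)) / (n:ℝ)^2
      - a * ((1 - (n:ℝ)⁻¹) / 2)) atTop (nhds (a - 0 - a * ((1 - 0) / 2))) :=
    (hN.sub h3).sub (((hinv.const_sub 1).div_const 2).const_mul a)
  have : a - 0 - a * ((1 - 0) / 2) = a / 2 := by ring
  rw [this] at h4
  refine h4.congr' ?_
  filter_upwards [eventually_gt_atTop 0] with n hn
  have : (0:ℝ) < n := by exact_mod_cast hn
  rw [sum_sub_distrib, ← mul_sum, hg]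
  field_simp
  ring

lemma Zset_card (p : ℕ) (hp : p.Prime) (B : ℝ) (hB : 0 ≤ B) :
    Nat.card (Zset p B) = ∑ b ∈ Psi p ⌊B⌋₊, (p ^ ellp p * b).totient := by
  classical
  set q := p ^ ellp p with hq
  have hq1 : 1 ≤ q := Nat.pow_pos hp.pos
  let S : Finset (Σ _ : ℕ, ℕ) := (Psi p ⌊B⌋₊).sigma fun b =>
    (Ico 1 (1 + q * b)).filter fun a => (q * b).Coprime a
  let F : (Σ _ : ℕ, ℕ) → ℚ := fun x => (x.2 : ℚ) / ((q * x.1 : ℕ) : ℚ)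
  have memS : ∀ x : (Σ _ : ℕ, ℕ), x ∈ S ↔ (1 ≤ x.1 ∧ (q * x.1).totient ≤ ⌊B⌋₊) ∧
      (1 ≤ x.2 ∧ x.2 < 1 + q * x.1) ∧ (q * x.1).Coprime x.2 := by
    intro x
    simp only [S, mem_sigma, mem_Psi p _ _ hp, mem_filter, mem_Ico, hq]
  have hinj : Set.InjOn F S := by
    intro x hx y hy hxy
    rw [mem_coe, memS] at hx hy
    have den : ∀ z : (Σ _ : ℕ, ℕ), 1 ≤ z.1 → (q * z.1).Coprime z.2 →
        (F z).den = q * z.1 ∧ (F z).num = z.2 := by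
      intro z h1 h2
      have hpos : (0:ℤ) < ((q * z.1 : ℕ) : ℤ) := by exact_mod_cast Nat.mul_pos hq1 h1
      have hc : ((z.2 : ℕ) : ℤ).natAbs.Coprime (((q * z.1 : ℕ) : ℤ)).natAbs := by
        rw [Int.natAbs_natCast, Int.natAbs_natCast]; exact h2.symm
      have d := Rat.den_div_eq_of_coprime hpos hc
      have n := Rat.num_div_eq_of_coprime hpos hc
      rw [Int.cast_natCast, Int.cast_natCast] at d n
      exact ⟨by exact_mod_cast d, n⟩
    have dx := den x hx.1.1 hx.2.2
    have dy := den y hy.1.1 hy.2.2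
    rw [hxy] at dx
    have e1 : q * x.1 = q * y.1 := dx.1.symm.trans dy.1
    have e2 : (x.2 : ℤ) = y.2 := dx.2.symm.trans dy.2
    obtain ⟨x1, x2⟩ := x
    obtain ⟨y1, y2⟩ := y
    have e1' : x1 = y1 := Nat.eq_of_mul_eq_mul_left hq1 e1
    have e2' : x2 = y2 := by exact_mod_cast e2
    rw [e1', e2']
  have hZ : Zset p B = ((S.image F : Finset ℚ) : Set ℚ) := by
    ext x
    rw [mem_coe, mem_image]
    constructor
    · rintro ⟨a, b, ⟨h1, h2⟩, h3, h4, h5, h6⟩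
      refine ⟨⟨b, a⟩, (memS _).2 ⟨⟨h1, Nat.le_floor h2⟩, ⟨h3, ?_⟩, (Nat.Coprime.symm h5)⟩, h6.symm⟩
      show a < 1 + q * b
      have h4' : a ≤ q * b := h4
      omega
    · rintro ⟨⟨b, a⟩, h, rfl⟩
      rw [memS] at h
      obtain ⟨⟨h1, h2⟩, ⟨h3, h4⟩, h5⟩ := h
      refine ⟨a, b, ⟨h1, (Nat.le_floor_iff hB).1 h2⟩, h3, ?_, h5.symm, rfl⟩
      have h4' : a < 1 + q * b := h4
      show a ≤ q * b
      omega
  rw [hZ, Nat.card_eq_card_toFinset, Finset.toFinset_coe, card_image_of_injOn hinj, card_sigma]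
  refine sum_congr rfl fun b _ => ?_
  rw [add_comm 1]
  have := Nat.filter_coprime_Ico_eq_totient (q * b) 1
  rw [add_comm 1] at this
  exact this

end ZB

/-- size of `𝒵_B`: `|𝒵_B| = (a_p/2 + o(1))·B²` as `B → +∞`. -/
theorem card_ZB_asymptotic (p : ℕ) [Fact p.Prime] :
    Tendsto (fun B : ℝ => (Nat.card (Zset p B) : ℝ) / B ^ 2)
      atTop (nhds (ap p / 2)) := by
  have hp : p.Prime := Fact.out
  have h1 := ZB.sum_asymp (fun n => ((ZB.Psi p n).card : ℝ)) (ap p) (ZB.Psi_card p hp)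
  have h2 := h1.comp (tendsto_nat_floor_atTop (α := ℝ))
  have h3 := h2.mul ((tendsto_nat_floor_div_atTop (R := ℝ)).pow 2)
  rw [one_pow, mul_one] at h3
  refine h3.congr' ?_
  filter_upwards [eventually_ge_atTop 1] with B hB
  have hn : (0:ℝ) < (⌊B⌋₊ : ℝ) := by exact_mod_cast Nat.floor_pos.2 hB
  have hB0 : 0 < B := by linarith
  simp only [Function.comp]
  rw [ZB.Zset_card p hp B hB0.le]
  have e := ZB.Psi_sum p ⌊B⌋₊ hp
  have e' : ((∑ b ∈ ZB.Psi p ⌊B⌋₊, (p ^ ellp p * b).totient : ℕ) : ℝ) =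
      ⌊B⌋₊ * ((ZB.Psi p ⌊B⌋₊).card : ℝ) - ∑ k ∈ Finset.range ⌊B⌋₊, ((ZB.Psi p k).card : ℝ) := by
    rw [eq_sub_iff_add_eq]; exact_mod_cast e
  rw [e']
  field_simp
end

section
/- With the standing setup (prime p, l_p, B, Ψ_B, 𝒵_B, b_max, θ_max, A_1(B), A_2(B), P_B, I, odd s, n ∈ I, the rational function R_n and its partial fraction coefficients r_{i,k}, and d_n = lcm(1,…,n)), for every i ∈ {1, 2, …, s} and every k ∈ {0, 1, …, n} the rational number d_n^{s−i} · r_{i,k} is an integer. -/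
/-- Power series `f` over `ℚ` such that `d^j * coeff j f` is an integer for all `j`. -/
noncomputable def SS (d : ℤ) : Subring (PowerSeries ℚ) :=
  Subring.comap (PowerSeries.rescale (d : ℚ)) (PowerSeries.map (Int.castRingHom ℚ)).range

lemma SS_coeff {d : ℤ} {f : PowerSeries ℚ} (hf : f ∈ SS d) (j : ℕ) :
    ∃ z : ℤ, (d : ℚ) ^ j * PowerSeries.coeff j f = z := by
  obtain ⟨g, hg⟩ := hf
  refine ⟨PowerSeries.coeff j g, ?_⟩
  rw [← PowerSeries.coeff_rescale, ← hg]
  simp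

lemma SS_X {d j : ℤ} (hj : j ∣ d) (hj0 : j ≠ 0) :
    PowerSeries.C (1 / (j : ℚ)) * PowerSeries.X ∈ SS d := by
  obtain ⟨e, rfl⟩ := hj
  refine ⟨PowerSeries.C e * PowerSeries.X, ?_⟩
  have : (j : ℚ) ≠ 0 := by exact_mod_cast hj0
  have h : (PowerSeries.C (e:ℚ)) = PowerSeries.C (1 / (j : ℚ)) * PowerSeries.C ((j * e : ℤ) : ℚ) := by
    rw [← map_mul]; congr 1; push_cast; field_simp
  rw [map_mul, map_mul, PowerSeries.rescale_X, ← mul_assoc]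
  simp only [PowerSeries.map_C, PowerSeries.map_X, Int.coe_castRingHom, h]
  congr 2
  ext m
  rw [PowerSeries.coeff_rescale, PowerSeries.coeff_C]
  split_ifs with hm <;> simp [hm]

lemma SS_inv {d : ℤ} {f : PowerSeries ℚ} (hf : f ∈ SS d)
    (h1 : PowerSeries.constantCoeff f = 1) : f⁻¹ ∈ SS d := by
  obtain ⟨g, hg⟩ := hf
  have hg1 : PowerSeries.constantCoeff g = 1 := by
    have := congrArg (PowerSeries.coeff 0) hg
    simp [PowerSeries.coeff_rescale, h1] at this
    exact_mod_cast this
  have hu : IsUnit g := by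
    rw [PowerSeries.isUnit_iff_constantCoeff, hg1]; exact isUnit_one
  obtain ⟨h, hh⟩ := hu.exists_right_inv
  refine ⟨h, ?_⟩
  have e1 : PowerSeries.map (Int.castRingHom ℚ) g * PowerSeries.map (Int.castRingHom ℚ) h = 1 := by
    rw [← map_mul, hh, map_one]
  have e2 : PowerSeries.rescale (d : ℚ) f * PowerSeries.rescale (d : ℚ) f⁻¹ = 1 := by
    rw [← map_mul, PowerSeries.mul_inv_cancel _ (by rw [h1]; exact one_ne_zero), map_one]
  rw [← hg] at e2
  exact (left_inv_eq_right_inv (by rw [mul_comm]; exact e1) e2)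

lemma SS_C (d z : ℤ) : PowerSeries.C (z : ℚ) ∈ SS d := by
  have : PowerSeries.C (z : ℚ) = ((z : ℤ) : PowerSeries ℚ) := by simp
  rw [this]; exact intCast_mem _ _

lemma prod_dvd_fact (n k : ℕ) (hk : k ≤ n) :
    (∏ j ∈ (Finset.range (n + 1)).erase k, ((j : ℤ) - k)) ∣ (n.factorial : ℤ) := by
  obtain ⟨m, rfl⟩ := Nat.exists_eq_add_of_le hk
  have h1 : ∏ j ∈ (Finset.range (k + m + 1)).erase k, ((j : ℤ) - k)
      = ∏ j ∈ Finset.range (k + 1 + m), (if j = k then (1:ℤ) else ((j : ℤ) - k)) := by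
    rw [show k + m + 1 = k + 1 + m by ring,
      ← Finset.mul_prod_erase (Finset.range (k+1+m)) _ (a := k) (by simp; omega)]
    simp only [if_true, one_mul]
    apply Finset.prod_congr rfl
    intro j hj
    rw [if_neg (Finset.ne_of_mem_erase hj)]
  rw [h1, Finset.prod_range_add, Finset.prod_range_succ]
  have h2 : ∏ j ∈ Finset.range k, (if j = k then (1:ℤ) else ((j : ℤ) - k)) = (-1)^k * k.factorial := by
    rw [← Finset.prod_range_reflect, ← Finset.prod_range_add_one_eq_factorial]
    push_cast
    have : (-1:ℤ)^k = ∏ j ∈ Finset.range k, (-1:ℤ) := by simp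
    rw [this, ← Finset.prod_mul_distrib]
    apply Finset.prod_congr rfl
    intro j hj
    have hj := Finset.mem_range.1 hj
    rw [if_neg (by omega)]
    have : ((k - 1 - j : ℕ) : ℤ) = k - 1 - j := by omega
    rw [this]; ring
  have h3 : ∏ x ∈ Finset.range m, (if k + 1 + x = k then (1:ℤ) else (((k + 1 + x : ℕ) : ℤ) - k)) = m.factorial := by
    rw [← Finset.prod_range_add_one_eq_factorial]
    push_cast
    apply Finset.prod_congr rfl
    intro j hj
    rw [if_neg (by omega)]
    ring
  rw [h2, h3]
  simp only [if_true, mul_one]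
  rw [mul_assoc]
  have hd : (-1:ℤ)^k ∣ 1 := (isUnit_one.neg.pow k).dvd
  have := Nat.factorial_mul_factorial_dvd_factorial_add k m
  have h4 : ((k.factorial : ℤ) * m.factorial) ∣ ((k+m).factorial : ℤ) := by exact_mod_cast this
  simpa using mul_dvd_mul hd h4

lemma SS_F {d : ℤ} (n k : ℕ) (hk : k ≤ n) (hd : ∀ j : ℤ, j ≠ 0 → |j| ≤ n → j ∣ d) :
    PowerSeries.C (n.factorial : ℚ) *
      (∏ j ∈ (Finset.range (n + 1)).erase k,
        (PowerSeries.X + PowerSeries.C ((j : ℚ) - k)))⁻¹ ∈ SS d := by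
  set s := (Finset.range (n + 1)).erase k
  have hs : ∀ j ∈ s, (j:ℤ) - k ≠ 0 ∧ ((j:ℤ) - k) ∣ d := by
    intro j hj
    have h1 := Finset.ne_of_mem_erase hj
    have h2 := Finset.mem_range.1 (Finset.mem_of_mem_erase hj)
    have h3 : (j:ℤ) - k ≠ 0 := by omega
    exact ⟨h3, hd _ h3 (by rw [abs_le]; omega)⟩
  set U : PowerSeries ℚ := ∏ j ∈ s, (1 + PowerSeries.C (1 / (((j:ℤ) - k : ℤ) : ℚ)) * PowerSeries.X)
  have hU : U ∈ SS d := prod_mem fun j hj => add_mem (one_mem _) (SS_X (hs j hj).2 (hs j hj).1)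
  have hU1 : PowerSeries.constantCoeff U = 1 := by
    simp [U, map_prod]
  obtain ⟨z, hz⟩ := prod_dvd_fact n k hk
  have hp0 : (∏ j ∈ s, ((j : ℤ) - k)) ≠ 0 := Finset.prod_ne_zero_iff.2 fun j hj => (hs j hj).1
  have hp0' : ((∏ j ∈ s, ((j : ℤ) - k) : ℤ) : ℚ) ≠ 0 := by exact_mod_cast hp0
  have e : ∏ j ∈ s, (PowerSeries.X + PowerSeries.C ((j : ℚ) - k))
      = PowerSeries.C ((∏ j ∈ s, ((j : ℤ) - k) : ℤ) : ℚ) * U := by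
    rw [Int.cast_prod, map_prod, ← Finset.prod_mul_distrib]
    apply Finset.prod_congr rfl
    intro j hj
    have : (((j:ℤ) - k : ℤ) : ℚ) ≠ 0 := by exact_mod_cast (hs j hj).1
    rw [mul_add, ← mul_assoc, ← map_mul, mul_one_div_cancel this]
    simp [add_comm]
  have hCinv : (PowerSeries.C ((∏ j ∈ s, ((j : ℤ) - k) : ℤ) : ℚ))⁻¹ =
      PowerSeries.C (((∏ j ∈ s, ((j : ℤ) - k) : ℤ) : ℚ)⁻¹) := by
    rw [PowerSeries.inv_eq_iff_mul_eq_one (by simpa using hp0'), ← map_mul,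
      inv_mul_cancel₀ hp0', map_one]
  have : PowerSeries.C (n.factorial : ℚ) * (∏ j ∈ s, (PowerSeries.X + PowerSeries.C ((j : ℚ) - k)))⁻¹
     = PowerSeries.C (z : ℚ) * U⁻¹ := by
    rw [e, PowerSeries.mul_inv_rev, hCinv, mul_comm U⁻¹, ← mul_assoc, ← map_mul]
    congr 2
    have : (n.factorial : ℚ) = ((∏ j ∈ s, ((j : ℤ) - k) : ℤ) : ℚ) * z := by exact_mod_cast hz
    rw [this]; field_simp
  rw [this]
  exact mul_mem (SS_C _ _) (SS_inv hU hU1)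

/-- Rising binomials. -/
noncomputable def rb (x : PowerSeries ℚ) (i : ℕ) : PowerSeries ℚ :=
  PowerSeries.C (1 / (i.factorial : ℚ)) * ∏ j ∈ Finset.range i, (x + j)

lemma rb_succ (x : PowerSeries ℚ) (i : ℕ) : ((i + 1 : ℕ) : PowerSeries ℚ) * rb x (i + 1) = (x + i) * rb x i := by
  unfold rb
  have h : ((i + 1 : ℕ) : PowerSeries ℚ) = PowerSeries.C ((i + 1 : ℕ) : ℚ) := by simp
  rw [h, ← mul_assoc, ← map_mul, Finset.prod_range_succ]
  have : ((i + 1 : ℕ) : ℚ) * (1 / ((i+1).factorial : ℚ)) = 1 / (i.factorial : ℚ) := by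
    rw [Nat.factorial_succ]; push_cast
    have : (i.factorial : ℚ) ≠ 0 := by positivity
    field_simp
  rw [this]; ring

lemma rb_add (x y : PowerSeries ℚ) (N : ℕ) :
    rb (x + y) N = ∑ ij ∈ Finset.HasAntidiagonal.antidiagonal N, rb x ij.1 * rb y ij.2 := by
  induction N with
  | zero => simp [rb]
  | succ N ih =>
    have h0 : ((N + 1 : ℕ) : PowerSeries ℚ) ≠ 0 := by
      have : ((N + 1 : ℕ) : PowerSeries ℚ) = PowerSeries.C ((N + 1 : ℕ) : ℚ) := by simp
      rw [this, Ne, map_eq_zero_iff _ PowerSeries.C_injective]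
      positivity
    apply mul_left_cancel₀ h0
    rw [rb_succ, ih]
    have h1 : ((N + 1 : ℕ) : PowerSeries ℚ) * ∑ ij ∈ Finset.HasAntidiagonal.antidiagonal (N+1), rb x ij.1 * rb y ij.2
       = ∑ ij ∈ Finset.HasAntidiagonal.antidiagonal (N+1), ((ij.1 : PowerSeries ℚ) * rb x ij.1) * rb y ij.2 +
         ∑ ij ∈ Finset.HasAntidiagonal.antidiagonal (N+1), rb x ij.1 * ((ij.2 : PowerSeries ℚ) * rb y ij.2) := by
      rw [Finset.mul_sum, ← Finset.sum_add_distrib]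
      apply Finset.sum_congr rfl
      intro ij hij
      rw [← Finset.HasAntidiagonal.mem_antidiagonal.1 hij]; push_cast; ring
    rw [h1, Finset.Nat.sum_antidiagonal_succ, Finset.Nat.sum_antidiagonal_succ']
    simp only [rb_succ, Nat.cast_zero, zero_mul, mul_zero, zero_add]
    rw [← Finset.sum_add_distrib, Finset.mul_sum]
    apply Finset.sum_congr rfl
    intro ij hij
    rw [← Finset.HasAntidiagonal.mem_antidiagonal.1 hij]; push_cast; ring

lemma SS_rbX {d : ℤ} (n i : ℕ) (hi : i ≤ n) (hd : ∀ j : ℤ, j ≠ 0 → |j| ≤ n → j ∣ d) :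
    rb PowerSeries.X i ∈ SS d := by
  rcases i with _ | i
  · simp [rb, one_mem]
  · have hd' : ∀ j : ℕ, j ≤ i → PowerSeries.C (1 / (((j:ℤ) + 1 : ℤ) : ℚ)) * PowerSeries.X ∈ SS d :=
      fun j hj => SS_X (hd _ (by omega) (by rw [abs_le]; omega)) (by omega)
    have : rb PowerSeries.X (i+1) = (PowerSeries.C (1 / (((i:ℤ) + 1 : ℤ) : ℚ)) * PowerSeries.X) *
       ∏ j ∈ Finset.range i, (PowerSeries.C (1 / (((j:ℤ) + 1 : ℤ) : ℚ)) * PowerSeries.X + 1) := by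
      unfold rb
      rw [Finset.prod_range_succ', Nat.factorial_succ, ← Finset.prod_range_add_one_eq_factorial]
      have : (1 / (((i + 1) * ∏ x ∈ Finset.range i, (x+1) : ℕ) : ℚ)) = (1 / (((i:ℤ) + 1 : ℤ) : ℚ)) * ∏ j ∈ Finset.range i, (1 / (((j:ℤ) + 1 : ℤ) : ℚ)) := by
        push_cast
        rw [Finset.prod_div_distrib, Finset.prod_const_one, one_div_mul_one_div]
      rw [this, map_mul, map_prod, Nat.cast_zero, add_zero]
      have : ∀ a b c : PowerSeries ℚ, a * b * (c * PowerSeries.X) = a * PowerSeries.X * (b * c) := by intros; ring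
      rw [this, ← Finset.prod_mul_distrib]
      congr 1
      apply Finset.prod_congr rfl
      intro j hj
      rw [mul_add]
      congr 1
      have : ((j + 1 : ℕ) : PowerSeries ℚ) = PowerSeries.C ((j + 1 : ℕ) : ℚ) := by simp
      rw [this, ← map_mul]
      have : ((j:ℚ)+1) ≠ 0 := by positivity
      push_cast
      rw [one_div_mul_cancel this, map_one]
    rw [this]
    exact mul_mem (hd' i le_rfl) (prod_mem fun j hj => add_mem (hd' j (Finset.mem_range.1 hj).le) (one_mem _))

/-- The arithmetic core. -/
lemma fact_dvd (D n M : ℕ) (hM : M ≤ n) (A : ℤ) (hD : D ≠ 0) :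
    (M.factorial : ℤ) ∣ ((∏ q ∈ D.primeFactors, q ^ (n / (q - 1)) : ℕ) : ℤ) *
      ∏ j ∈ Finset.range M, (A + D * j) := by
  rw [← Int.dvd_natAbs, Int.natCast_dvd_natCast, Nat.dvd_iff_prime_pow_dvd_dvd]
  intro q v hq hv
  rw [← Int.natCast_dvd_natCast, Int.dvd_natAbs]
  by_cases hqD : q ∣ D
  · apply Dvd.dvd.mul_right
    rw [Int.natCast_dvd_natCast]
    refine dvd_trans (pow_dvd_pow q ?_) (Finset.dvd_prod_of_mem (fun q => q ^ (n / (q - 1))) (Nat.mem_primeFactors.2 ⟨hq, hqD, hD⟩))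
    rw [Nat.le_div_iff_mul_le (by have := hq.two_le; omega)]
    have := Fact.mk hq
    have h1 := sub_one_mul_padicValNat_factorial (p := q) M
    have h2 : v ≤ padicValNat q M.factorial := (padicValNat_dvd_iff_le (Nat.factorial_ne_zero M)).1 hv
    calc v * (q - 1) ≤ padicValNat q M.factorial * (q-1) := Nat.mul_le_mul_right _ h2
      _ = M - (q.digits M).sum := by rw [mul_comm, h1]
      _ ≤ n := by omega
  · apply Dvd.dvd.mul_left
    have hc : IsCoprime (D : ℤ) ((q ^ v : ℕ) : ℤ) := by
      rw [Nat.isCoprime_iff_coprime]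
      exact (Nat.Coprime.pow_left v ((Nat.Prime.coprime_iff_not_dvd hq).2 hqD)).symm
    obtain ⟨u, w, huw⟩ := hc
    have h1 : ((q ^ v : ℕ) : ℤ) ∣ ∏ j ∈ Finset.range M, (A * u + j) :=
      dvd_trans (Int.natCast_dvd_natCast.2 hv) (Nat.factorial_coe_dvd_prod M (A * u))
    have h2 : (∏ j ∈ Finset.range M, (A + D * j)) ≡ (∏ j ∈ Finset.range M, (D * (A * u + j))) [ZMOD ((q ^ v : ℕ) : ℤ)] := by
      apply Int.ModEq.prod
      intro j hj
      rw [Int.modEq_iff_dvd]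
      refine ⟨-(A * w), ?_⟩
      linear_combination A * huw
    rw [Finset.prod_mul_distrib] at h2
    exact (Int.ModEq.dvd_iff h2).2 (Dvd.dvd.mul_left h1 _)

/-- The normalizing factor attached to a denominator `D`. -/
def EE (n D : ℕ) : ℕ := D ^ n * ∏ q ∈ D.primeFactors, q ^ (n / (q - 1))

lemma EE_int (θ : ℚ) (k n j : ℕ) (hj : j ≤ n) :
    ∃ z : ℤ, (EE n θ.den : ℚ) * (1 / (j.factorial : ℚ) *
      ∏ i ∈ Finset.range j, (θ - k + i)) = z := by
  obtain ⟨z, hz⟩ := fact_dvd θ.den n j hj (θ.num - k * θ.den) θ.den_nz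
  obtain ⟨m, rfl⟩ := Nat.exists_eq_add_of_le hj
  refine ⟨(θ.den : ℤ) ^ m * z, ?_⟩
  have hz' : (((∏ q ∈ θ.den.primeFactors, q ^ ((j + m) / (q - 1)) : ℕ)) : ℚ) *
      ∏ i ∈ Finset.range j, (((θ.num : ℚ) - k * θ.den) + θ.den * i) = j.factorial * z := by
    exact_mod_cast congrArg (Int.cast : ℤ → ℚ) hz
  have hD : (θ.den : ℚ) ≠ 0 := by exact_mod_cast θ.den_nz
  have hp : ∏ i ∈ Finset.range j, (((θ.num : ℚ) - k * θ.den) + θ.den * i) =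
      (θ.den : ℚ) ^ j * ∏ i ∈ Finset.range j, (θ - k + i) := by
    have : (θ.den : ℚ) ^ j = ∏ i ∈ Finset.range j, (θ.den : ℚ) := by simp
    rw [this, ← Finset.prod_mul_distrib]
    apply Finset.prod_congr rfl
    intro i _
    have : (θ.num : ℚ) = θ * θ.den := (Rat.mul_den_eq_num θ).symm
    rw [this]; ring
  rw [hp] at hz'
  have hf : (j.factorial : ℚ) ≠ 0 := by positivity
  unfold EE
  rw [Nat.cast_mul, Nat.cast_pow, pow_add]
  rw [Int.cast_mul, Int.cast_pow, Int.cast_natCast]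
  generalize ((∏ q ∈ θ.den.primeFactors, q ^ ((j + m) / (q - 1)) : ℕ) : ℚ) = Q at *
  generalize ∏ i ∈ Finset.range j, (θ - k + i) = R at *
  have : (z : ℚ) = Q * ((θ.den : ℚ) ^ j * R) / j.factorial := by
    rw [hz']; field_simp
  rw [this]; ring

lemma SS_G {d : ℤ} (θ : ℚ) (k n M : ℕ) (hM : M ≤ n)
    (hd : ∀ j : ℤ, j ≠ 0 → |j| ≤ n → j ∣ d) :
    PowerSeries.C (EE n θ.den : ℚ) * rb (PowerSeries.X + PowerSeries.C (θ - k)) M ∈ SS d := by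
  rw [rb_add, Finset.mul_sum]
  refine sum_mem fun ij hij => ?_
  have h := Finset.HasAntidiagonal.mem_antidiagonal.1 hij
  have h1 := SS_rbX (d := d) n ij.1 (by omega) hd
  obtain ⟨z, hz⟩ := EE_int θ k n ij.2 (by omega)
  have : PowerSeries.C (EE n θ.den : ℚ) * rb (PowerSeries.C (θ - k)) ij.2 = PowerSeries.C (z : ℚ) := by
    rw [← hz, rb, map_mul, map_mul, map_prod]
    congr 2
    apply Finset.prod_congr rfl
    intro i _
    simp
  rw [mul_left_comm, this]
  exact mul_mem h1 (SS_C _ _)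

lemma prod_Z (c : ℕ) (hc : 1 < c) (Ψ : Finset ℕ) (hΨ : ∀ b ∈ Ψ, 1 ≤ b)
    (Z : Finset ℚ)
    (hZ : ∀ x : ℚ, x ∈ Z ↔ ∃ a b : ℕ, b ∈ Ψ ∧ 1 ≤ a ∧ a ≤ c * b ∧
      Nat.gcd a (c * b) = 1 ∧ x = (a : ℚ) / ((c * b : ℕ) : ℚ)) (f : ℕ → ℕ) :
    ∏ θ ∈ Z, f θ.den = ∏ b ∈ Ψ, f (c * b) ^ (c * b).totient := by
  have hden : ∀ a b : ℕ, 1 ≤ b → Nat.gcd a (c * b) = 1 →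
      ((a : ℚ) / ((c * b : ℕ) : ℚ)).den = c * b ∧ ((a : ℚ) / ((c * b : ℕ) : ℚ)).num = a := by
    intro a b hb hab
    have hpos : 0 < c * b := by positivity
    have h1 := Rat.den_div_eq_of_coprime (a := (a : ℤ)) (b := ((c * b : ℕ) : ℤ)) (by exact_mod_cast hpos) (by rw [Int.natAbs_natCast, Int.natAbs_natCast]; exact hab)
    have h2 := Rat.num_div_eq_of_coprime (a := (a : ℤ)) (b := ((c * b : ℕ) : ℤ)) (by exact_mod_cast hpos) (by rw [Int.natAbs_natCast, Int.natAbs_natCast]; exact hab)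
    rw [Int.cast_natCast, Int.cast_natCast] at h1 h2
    exact ⟨by exact_mod_cast h1, h2⟩
  have h : ∏ b ∈ Ψ, f (c * b) ^ (c * b).totient =
      ∏ b ∈ Ψ, ∏ a ∈ (Finset.range (c * b)).filter (fun a => (c * b).Coprime a), f (c * b) := by
    apply Finset.prod_congr rfl
    intro b _
    rw [Finset.prod_const, Nat.totient_eq_card_coprime]
  rw [h, Finset.prod_sigma']
  symm
  refine Finset.prod_bij (fun x _ => ((x.2 : ℕ) : ℚ) / ((c * x.1 : ℕ) : ℚ)) ?_ ?_ ?_ ?_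
  · rintro ⟨b, a⟩ hx
    simp only [Finset.mem_sigma, Finset.mem_filter, Finset.mem_range] at hx
    obtain ⟨hb, ha, hcop⟩ := hx
    rw [hZ]
    refine ⟨a, b, hb, ?_, ha.le, hcop.symm, rfl⟩
    rcases Nat.eq_zero_or_pos a with rfl | h
    · have := hΨ b hb
      rw [Nat.coprime_zero_right] at hcop
      nlinarith
    · exact h
  · rintro ⟨b, a⟩ hx ⟨b', a'⟩ hx' heq
    simp only [Finset.mem_sigma, Finset.mem_filter, Finset.mem_range] at hx hx' heq
    have h1 := hden a b (hΨ b hx.1) hx.2.2.symm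
    have h2 := hden a' b' (hΨ b' hx'.1) hx'.2.2.symm
    rw [heq] at h1
    have e1 : c * b = c * b' := h1.1.symm.trans h2.1
    have e2 : (a : ℤ) = a' := h1.2.symm.trans h2.2
    have e3 : b = b' := Nat.eq_of_mul_eq_mul_left (by omega) e1
    have e4 : a = a' := by exact_mod_cast e2
    subst e3; subst e4; rfl
  · intro x hx
    obtain ⟨a, b, hb, h1, h2, h3, rfl⟩ := (hZ x).1 hx
    refine ⟨⟨b, a⟩, ?_, rfl⟩
    simp only [Finset.mem_sigma, Finset.mem_filter, Finset.mem_range]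
    refine ⟨hb, ?_, Nat.Coprime.symm h3⟩
    rcases h2.lt_or_eq with h | h
    · exact h
    · have := hΨ b hb
      rw [h, Nat.gcd_self] at h3
      nlinarith
  · rintro ⟨b, a⟩ hx
    simp only [Finset.mem_sigma, Finset.mem_filter, Finset.mem_range] at hx
    simp only
    rw [(hden a b (hΨ b hx.1) hx.2.2.symm).1]

lemma extract (n s k : ℕ) (hk : k ∈ Finset.range (n + 1)) (N : Polynomial ℚ) (r : ℕ → ℕ → ℚ)
    (h : ∀ x : ℚ, (∀ j ∈ Finset.range (n + 1), x - k + j ≠ 0) →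
      N.eval x / (∏ j ∈ Finset.range (n + 1), (x - k + j)) ^ s =
      ∑ i ∈ Finset.Icc 1 s, ∑ k' ∈ Finset.range (n + 1), r i k' / (x - k + k') ^ i)
    (i : ℕ) (hi : i ∈ Finset.Icc 1 s) :
    r i k = PowerSeries.coeff (s - i) ((N : PowerSeries ℚ) *
      (∏ j ∈ (Finset.range (n + 1)).erase k,
        (PowerSeries.X + PowerSeries.C ((j : ℚ) - k)))⁻¹ ^ s) := by
  classical
  set I := (Finset.range (n + 1)).erase k with hI
  set q : Polynomial ℚ := ∏ j ∈ I, (Polynomial.X + Polynomial.C ((j : ℚ) - k)) with hq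
  set W : Polynomial ℚ := ∑ i ∈ Finset.Icc 1 s, ∑ k' ∈ I, Polynomial.C (r i k') *
    (Polynomial.X + Polynomial.C ((k' : ℚ) - k)) ^ (s - i) *
    ∏ j ∈ I.erase k', (Polynomial.X + Polynomial.C ((j : ℚ) - k)) ^ s with hW
  set V : Polynomial ℚ := ∑ i ∈ Finset.Icc 1 s, Polynomial.C (r i k) * Polynomial.X ^ (s - i) with hV
  have key : N = V * q ^ s + Polynomial.X ^ s * W := by
    apply Polynomial.eq_of_infinite_eval_eq
    have hfin : (((Finset.range (n + 1)).image (fun j : ℕ => (k : ℚ) - j) : Finset ℚ) : Set ℚ)ᶜ.Infinite :=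
      (Finset.finite_toSet _).infinite_compl
    refine hfin.mono ?_
    intro x hx
    have hx' : ∀ j ∈ Finset.range (n + 1), x - k + j ≠ 0 := by
      intro j hj h0
      apply hx
      simp only [Finset.coe_image, Set.mem_image]
      exact ⟨j, hj, by linarith⟩
    have hxk : x ≠ 0 := by simpa using hx' k hk
    have hh := h x hx'
    have hprod : ∏ j ∈ Finset.range (n + 1), (x - k + j) = x * q.eval x := by
      rw [← Finset.mul_prod_erase _ _ hk, hq, Polynomial.eval_prod]
      congr 1
      · ring
      · apply Finset.prod_congr rfl
        intro j _
        simp; ring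
    have hq0 : q.eval x ≠ 0 := by
      rw [hq, Polynomial.eval_prod, Finset.prod_ne_zero_iff]
      intro j hj
      have := hx' j (Finset.mem_of_mem_erase hj)
      simp only [Polynomial.eval_add, Polynomial.eval_X, Polynomial.eval_C]
      intro h0; apply this; linarith
    rw [hprod, div_eq_iff (by positivity)] at hh
    simp only [Set.mem_ofPred_eq]
    rw [hh]
    simp only [Polynomial.eval_add, Polynomial.eval_mul, Polynomial.eval_pow, Polynomial.eval_X, hV, hW,
      Polynomial.eval_finsetSum, Polynomial.eval_C, Polynomial.eval_prod]
    rw [Finset.sum_mul, Finset.sum_mul, Finset.mul_sum, ← Finset.sum_add_distrib]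
    apply Finset.sum_congr rfl
    intro i hi
    have his := (Finset.mem_Icc.1 hi).2
    obtain ⟨e, rfl⟩ := Nat.exists_eq_add_of_le his
    rw [← Finset.add_sum_erase _ _ hk, add_mul]
    congr 1
    · rw [sub_add_cancel, mul_pow, Nat.add_sub_cancel_left, pow_add x]
      field_simp
    · rw [Finset.sum_mul, Finset.mul_sum]
      apply Finset.sum_congr rfl
      intro k' hk'
      have hne : x + ((k' : ℚ) - k) ≠ 0 := by
        have := hx' k' (Finset.mem_of_mem_erase hk')
        intro h0; apply this; linarith
      have hqk : q.eval x = (x + ((k' : ℚ) - k)) * ∏ j ∈ I.erase k', (x + ((j : ℚ) - k)) := by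
        rw [hq, Polynomial.eval_prod, ← Finset.mul_prod_erase I _ hk']
        simp only [Polynomial.eval_add, Polynomial.eval_X, Polynomial.eval_C]
      rw [show x - k + k' = x + ((k' : ℚ) - k) by ring, hqk, Nat.add_sub_cancel_left, mul_pow, mul_pow,
        Finset.prod_pow, pow_add (x + ((k' : ℚ) - k))]
      field_simp
  set q' : PowerSeries ℚ := ∏ j ∈ I, (PowerSeries.X + PowerSeries.C ((j : ℚ) - k)) with hq'
  have hqq : (q : PowerSeries ℚ) = q' := by
    rw [hq, hq', ← Polynomial.coeToPowerSeries.ringHom_apply, map_prod]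
    apply Finset.prod_congr rfl
    intro j _
    rw [Polynomial.coeToPowerSeries.ringHom_apply, Polynomial.coe_add, Polynomial.coe_X, Polynomial.coe_C]
  have hc0 : PowerSeries.constantCoeff q' ≠ 0 := by
    rw [hq', map_prod, Finset.prod_ne_zero_iff]
    intro j hj
    have := Finset.ne_of_mem_erase hj
    simp only [map_add, PowerSeries.constantCoeff_X, PowerSeries.constantCoeff_C, zero_add]
    rw [sub_ne_zero]; exact_mod_cast this
  have hN : (N : PowerSeries ℚ) * q'⁻¹ ^ s = (V : PowerSeries ℚ) + PowerSeries.X ^ s * ((W : PowerSeries ℚ) * q'⁻¹ ^ s) := by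
    have h1 : q' ^ s * q'⁻¹ ^ s = 1 := by rw [← mul_pow, PowerSeries.mul_inv_cancel _ hc0, one_pow]
    rw [key]
    push_cast
    rw [hqq]
    linear_combination (V : PowerSeries ℚ) * h1
  have hi' := Finset.mem_Icc.1 hi
  rw [hN, map_add, PowerSeries.coeff_X_pow_mul', if_neg (by omega), add_zero, Polynomial.coeff_coe, hV,
    Polynomial.finsetSum_coeff, Finset.sum_eq_single i]
  · simp
  · intro b hb hbi
    have := Finset.mem_Icc.1 hb
    rw [Polynomial.coeff_C_mul, Polynomial.coeff_X_pow, if_neg (by omega), mul_zero]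
  · intro h; exact absurd hi h

lemma rb_coe (y : ℚ) (M : ℕ) :
    ((∏ j ∈ Finset.range M, (Polynomial.X + Polynomial.C (y + j)) : Polynomial ℚ) : PowerSeries ℚ) =
      PowerSeries.C (M.factorial : ℚ) * rb (PowerSeries.X + PowerSeries.C y) M := by
  have hf : (M.factorial : ℚ) ≠ 0 := by positivity
  rw [rb, ← mul_assoc, ← map_mul, mul_one_div_cancel hf, map_one, one_mul,
    ← Polynomial.coeToPowerSeries.ringHom_apply, map_prod]
  apply Finset.prod_congr rfl
  intro j _
  rw [Polynomial.coeToPowerSeries.ringHom_apply, Polynomial.coe_add, Polynomial.coe_X,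
    Polynomial.coe_C, map_add]
  simp [add_assoc]

lemma A_eq (c n : ℕ) (hc : 1 < c) (Ψ : Finset ℕ) (hΨ : ∀ b ∈ Ψ, 1 ≤ b)
    (Z : Finset ℚ)
    (hZ : ∀ x : ℚ, x ∈ Z ↔ ∃ a b : ℕ, b ∈ Ψ ∧ 1 ≤ a ∧ a ≤ c * b ∧
      Nat.gcd a (c * b) = 1 ∧ x = (a : ℚ) / ((c * b : ℕ) : ℚ))
    (hn : ∀ b ∈ Ψ, ∀ q ∈ (c * b).primeFactors, q - 1 ∣ n) :
    (∏ b ∈ Ψ, (c * b) ^ (c * b).totient) ^ n *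
      (∏ b ∈ Ψ, ∏ q ∈ (c * b).primeFactors, q ^ ((c * b).totient / (q - 1))) ^ n =
      ∏ θ ∈ Z, EE n θ.den := by
  rw [prod_Z c hc Ψ hΨ Z hZ (EE n), ← mul_pow, ← Finset.prod_mul_distrib, ← Finset.prod_pow]
  apply Finset.prod_congr rfl
  intro b hb
  have hn' := hn b hb
  generalize c * b = D at hn' ⊢
  rw [EE, mul_pow, mul_pow, ← pow_mul, ← pow_mul, mul_comm n, ← Finset.prod_pow, ← Finset.prod_pow]
  congr 1
  apply Finset.prod_congr rfl
  intro q hq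
  rw [← pow_mul, ← pow_mul]
  congr 1
  have hqp := Nat.prime_of_mem_primeFactors hq
  have h1 : q - 1 ∣ D.totient := by
    rw [← Nat.totient_prime hqp]
    exact Nat.totient_dvd_of_dvd (Nat.dvd_of_mem_primeFactors hq)
  have h2 := hn' q hq
  rw [Nat.div_mul_right_comm h1, Nat.div_mul_right_comm h2, mul_comm]


/-- `d_n = lcm(1, 2, …, n)`. -/
def dd (n : ℕ) : ℕ := (Finset.Icc 1 n).lcm id

/-- The rational function
`R_n(t) = A₁(B)^n A₂(B)^n (n!^{s-|𝒵|+1}/(θ_max n - 1)!) (t+θ_max)_{θ_max n-1}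
  ∏_{θ ∈ 𝒵∖{θ_max}} (t+θ)_n / ((t)_{n+1})^s`,
where `Ψ = Ψ_B`, `Z = 𝒵_B`, `θ_max = (p^{l_p} b_max - 1)/(p^{l_p} b_max)` and
Pochhammer symbols are written as products. -/
noncomputable def Rfun (p : ℕ) (Ψ : Finset ℕ) (Z : Finset ℚ) (bmax s n : ℕ) (t : ℚ) : ℚ :=
  let Nb : ℕ := p ^ ellp p * bmax
  let m : ℕ := (Nb - 1) * n / Nb
  let θmax : ℚ := ((Nb : ℚ) - 1) / (Nb : ℚ)
  let A1 : ℕ := ∏ b ∈ Ψ, (p ^ ellp p * b) ^ (p ^ ellp p * b).totient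
  let A2 : ℕ := ∏ b ∈ Ψ, ∏ q ∈ (p ^ ellp p * b).primeFactors,
    q ^ ((p ^ ellp p * b).totient / (q - 1))
  (A1 : ℚ) ^ n * (A2 : ℚ) ^ n *
    ((Nat.factorial n : ℚ) ^ (s - Z.card + 1) / (Nat.factorial (m - 1) : ℚ)) *
    (∏ j ∈ Finset.range (m - 1), (t + θmax + (j : ℚ))) *
    (∏ θ ∈ Z.erase θmax, ∏ j ∈ Finset.range n, (t + θ + (j : ℚ))) /
    (∏ j ∈ Finset.range (n + 1), (t + (j : ℚ))) ^ s

/-- Lemma 5.3: `d_n^{s-i} · r_{i,k} ∈ ℤ` for all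
`1 ≤ i ≤ s`, `0 ≤ k ≤ n`. -/
theorem dn_pow_mul_partial_fraction_coeff_int
    (p : ℕ) [Fact p.Prime] (B : ℝ) (Ψ : Finset ℕ)
    (hΨ : ∀ b : ℕ, b ∈ Ψ ↔ 1 ≤ b ∧ ((p ^ ellp p * b).totient : ℝ) ≤ B)
    (bmax : ℕ) (hbmem : bmax ∈ Ψ) (hbmax : ∀ b ∈ Ψ, b ≤ bmax)
    (Z : Finset ℚ)
    (hZ : ∀ x : ℚ, x ∈ Z ↔ ∃ a b : ℕ, b ∈ Ψ ∧ 1 ≤ a ∧ a ≤ p ^ ellp p * b ∧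
      Nat.gcd a (p ^ ellp p * b) = 1 ∧ x = (a : ℚ) / ((p ^ ellp p * b : ℕ) : ℚ))
    (s : ℕ) (hsodd : Odd s) (hscard : Z.card + 1 < s)
    (n : ℕ) (hnprime : (n + 1).Prime)
    (hndvd : ((Ψ.biUnion fun b => (p ^ ellp p * b).primeFactors).lcm (fun q => q - 1)) *
      p ^ ellp p * bmax ∣ n)
    (hdeg : (2 : ℤ) ≤ ((n : ℤ) + 1) * s - n * ((Z.card : ℤ) - 1) -
      (((p ^ ellp p * bmax - 1) * n / (p ^ ellp p * bmax) : ℕ) : ℤ) + 1)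
    (r : ℕ → ℕ → ℚ)
    (hr : ∀ t : ℚ, (∀ j ∈ Finset.range (n + 1), t + (j : ℚ) ≠ 0) →
      Rfun p Ψ Z bmax s n t =
        ∑ i ∈ Finset.Icc 1 s, ∑ k ∈ Finset.range (n + 1), r i k / (t + (k : ℚ)) ^ i) :
    ∀ i ∈ Finset.Icc 1 s, ∀ k ∈ Finset.range (n + 1),
      ∃ z : ℤ, (dd n : ℚ) ^ (s - i) * r i k = (z : ℚ) := by
  intro i hi k hk
  have hpp : p.Prime := Fact.out
  have hc : 1 < p ^ ellp p := by
    apply Nat.one_lt_pow _ hpp.one_lt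
    unfold ellp
    split_ifs <;> norm_num
  have hΨ1 : ∀ b ∈ Ψ, 1 ≤ b := fun b hb => ((hΨ b).1 hb).1
  have hn : ∀ b ∈ Ψ, ∀ q ∈ (p ^ ellp p * b).primeFactors, q - 1 ∣ n := by
    intro b hb q hq
    refine dvd_trans ?_ hndvd
    rw [mul_assoc]
    exact Dvd.dvd.mul_right (Finset.dvd_lcm (f := fun q => q - 1)
      (Finset.mem_biUnion.2 ⟨b, hb, hq⟩)) _
  have hA := A_eq (p ^ ellp p) n hc Ψ hΨ1 Z hZ hn
  have hd : ∀ j : ℤ, j ≠ 0 → |j| ≤ n → j ∣ ((dd n : ℕ) : ℤ) := by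
    intro j hj0 hj
    rw [← Int.natAbs_dvd, Int.natCast_dvd_natCast]
    have hmem : j.natAbs ∈ Finset.Icc 1 n := by
      rw [Finset.mem_Icc]
      rw [Int.abs_eq_natAbs] at hj
      exact ⟨Int.natAbs_pos.2 hj0, by exact_mod_cast hj⟩
    exact Finset.dvd_lcm (f := id) hmem
  unfold Rfun at hr
  simp only at hr
  generalize p ^ ellp p = c at *
  have hb1 := hΨ1 bmax hbmem
  have hNb : 1 < c * bmax := by nlinarith
  set Nb := c * bmax with hNbdef
  set θ0 : ℚ := ((Nb : ℚ) - 1) / (Nb : ℚ) with hθ0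
  have hθZ : θ0 ∈ Z := by
    rw [hZ]
    refine ⟨Nb - 1, bmax, hbmem, by omega, by omega, ?_, ?_⟩
    · rw [← hNbdef]
      have := Nat.coprime_self_sub_right (m := 1) (n := Nb) hNb.le
      rw [← Nat.coprime_iff_gcd_eq_one, Nat.coprime_comm, this]
      exact Nat.coprime_one_right _
    · rw [← hNbdef, hθ0, Nat.cast_sub hNb.le, Nat.cast_one]
  set M := (Nb - 1) * n / Nb - 1 with hMdef
  have hM : M ≤ n := by
    have : (Nb - 1) * n / Nb ≤ n :=
      Nat.div_le_of_le_mul (Nat.mul_le_mul_right _ (Nat.sub_le _ _))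
    omega
  set K : ℚ := ((∏ b ∈ Ψ, (c * b) ^ (c * b).totient : ℕ) : ℚ) ^ n *
    ((∏ b ∈ Ψ, ∏ q ∈ (c * b).primeFactors, q ^ ((c * b).totient / (q - 1)) : ℕ) : ℚ) ^ n *
    ((n.factorial : ℚ) ^ (s - Z.card + 1) / (M.factorial : ℚ)) with hK
  set N : Polynomial ℚ := Polynomial.C K *
    (∏ j ∈ Finset.range M, (Polynomial.X + Polynomial.C (θ0 - k + j))) *
    ∏ θ ∈ Z.erase θ0, ∏ j ∈ Finset.range n, (Polynomial.X + Polynomial.C (θ - k + j)) with hN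
  have hex := extract n s k hk N r (by
    intro x hx
    rw [← hr (x - k) hx]
    congr 1
    simp only [hN, Polynomial.eval_mul, Polynomial.eval_C, Polynomial.eval_prod,
      Polynomial.eval_add, Polynomial.eval_X]
    congr 1
    · congr 1
      apply Finset.prod_congr rfl
      intro j _; ring
    · apply Finset.prod_congr rfl
      intro θ _
      apply Finset.prod_congr rfl
      intro j _; ring) i hi
  rw [hex]
  set q' : PowerSeries ℚ := ∏ j ∈ (Finset.range (n + 1)).erase k,
    (PowerSeries.X + PowerSeries.C ((j : ℚ) - k)) with hq'
  have hNS : (N : PowerSeries ℚ) * q'⁻¹ ^ s =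
      (PowerSeries.C (EE n θ0.den : ℚ) * rb (PowerSeries.X + PowerSeries.C (θ0 - k)) M) *
      (∏ θ ∈ Z.erase θ0,
        (PowerSeries.C (EE n θ.den : ℚ) * rb (PowerSeries.X + PowerSeries.C (θ - k)) n)) *
      (PowerSeries.C (n.factorial : ℚ) * q'⁻¹) ^ s := by
    have h1 : (N : PowerSeries ℚ) = PowerSeries.C K *
        (PowerSeries.C (M.factorial : ℚ) * rb (PowerSeries.X + PowerSeries.C (θ0 - k)) M) *
        ∏ θ ∈ Z.erase θ0, (PowerSeries.C (n.factorial : ℚ) *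
          rb (PowerSeries.X + PowerSeries.C (θ - k)) n) := by
      rw [hN, Polynomial.coe_mul, Polynomial.coe_mul, Polynomial.coe_C, rb_coe]
      congr 1
      rw [← Polynomial.coeToPowerSeries.ringHom_apply, map_prod]
      apply Finset.prod_congr rfl
      intro θ _
      rw [Polynomial.coeToPowerSeries.ringHom_apply, rb_coe]
    have hcard : 1 ≤ Z.card := Finset.card_pos.2 ⟨_, hθZ⟩
    have hconst : K * M.factorial * (n.factorial : ℚ) ^ (Z.card - 1) =
        (EE n θ0.den : ℚ) * (∏ θ ∈ Z.erase θ0, (EE n θ.den : ℚ)) * (n.factorial : ℚ) ^ s := by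
      have hA' : ((∏ b ∈ Ψ, (c * b) ^ (c * b).totient : ℕ) : ℚ) ^ n *
        ((∏ b ∈ Ψ, ∏ q ∈ (c * b).primeFactors, q ^ ((c * b).totient / (q - 1)) : ℕ) : ℚ) ^ n =
          ∏ θ ∈ Z, (EE n θ.den : ℚ) := by
        exact_mod_cast congrArg (Nat.cast : ℕ → ℚ) hA
      have hf : (M.factorial : ℚ) ≠ 0 := by positivity
      rw [Finset.mul_prod_erase Z (fun θ => (EE n θ.den : ℚ)) hθZ, hK, hA', mul_assoc, mul_assoc,
        ← mul_assoc (_ / _), div_mul_cancel₀ _ hf, ← pow_add]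
      congr 2
      omega
    have hconst' := congrArg (PowerSeries.C (R := ℚ)) hconst
    simp only [map_mul, map_pow, map_prod] at hconst'
    rw [h1, Finset.prod_mul_distrib, Finset.prod_mul_distrib, Finset.prod_const,
      Finset.card_erase_of_mem hθZ, mul_pow]
    linear_combination (rb (PowerSeries.X + PowerSeries.C (θ0 - k)) M *
      (∏ θ ∈ Z.erase θ0, rb (PowerSeries.X + PowerSeries.C (θ - k)) n) * q'⁻¹ ^ s) * hconst'
  have hmem : (N : PowerSeries ℚ) * q'⁻¹ ^ s ∈ SS (dd n : ℤ) := by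
    rw [hNS]
    have hkn : k ≤ n := by have := Finset.mem_range.1 hk; omega
    exact mul_mem (mul_mem (SS_G _ _ _ _ hM hd) (prod_mem fun θ _ => SS_G _ _ _ _ le_rfl hd))
      (pow_mem (SS_F n k hkn hd) s)
  obtain ⟨z, hz⟩ := SS_coeff hmem (s - i)
  exact ⟨z, by rw [← hz, Int.cast_natCast]⟩
end
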